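/- Let n ≥ 3, let G be a finite-index subgroup of the braid group B_{n+1}, and let ρ : G → B_{n+1} be an injective group homomorphism. Then ρ(Z(G)) ⊆ Z(B_{n+1}) and ρ^{−1}(Z(B_{n+1})) ⊆ Z(G); consequently, ρ descends to a well-defined injective homomorphism G/Z(G) → B_{n+1}/Z(B_{n+1}). -/

import Mathlib

/-- The braid relations on `n` generators `σ_1, …, σ_n` (indexed by `Fin n`):
`σ_i σ_j σ_i = σ_j σ_i σ_j` when `j = i + 1`, and `σ_i σ_j = σ_j σ_i` when `j ≥ i + 2`.
The resulting presented group is the braid group `B_{n+1}` on `n+1` strands. -/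
def braidRels (n : ℕ) : Set (FreeGroup (Fin n)) :=
  {r | (∃ i j : Fin n, (i : ℕ) + 1 = (j : ℕ) ∧
          r = .of i * .of j * .of i * (.of j * .of i * .of j)⁻¹) ∨
       (∃ i j : Fin n, (i : ℕ) + 2 ≤ (j : ℕ) ∧
          r = .of i * .of j * (.of j * .of i)⁻¹)}

/-- The braid group `B_{n+1}` on `n+1` strands, presented with `n` generators. -/
abbrev BraidGroup (n : ℕ) : Type := PresentedGroup (braidRels n)

/-- The standard generator `σ_{i+1}` of the braid group. -/
def braidGen {n : ℕ} (i : Fin n) : BraidGroup n := PresentedGroup.of i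

/-- The full twist `z = (σ_1 σ_2 ⋯ σ_n)^{n+1}`, which generates the center of `B_{n+1}`. -/
def fullTwist (n : ℕ) : BraidGroup n :=
  ((List.ofFn fun i : Fin n => braidGen i).prod) ^ (n + 1)

/-- `T` contains one point of each orbit of `s`, all orbits having `p` points. -/
def IsTransversal {J : Type*} (s : Equiv.Perm J) (p : ℕ) (T : Finset J) : Prop :=
  Set.BijOn (fun x : J × ℕ => (s ^ x.2) x.1) ↑(T ×ˢ Finset.range p) Set.univ

theorem IsTransversal.sum_eq {J M : Type*} [Fintype J] [AddCommMonoid M] {s : Equiv.Perm J} {p : ℕ}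
    {T : Finset J} (hT : IsTransversal s p T) (f : J → M) :
    ∑ i, f i = ∑ r ∈ T, ∑ t ∈ Finset.range p, f ((s ^ t) r) := by
  rw [← Finset.sum_product' T (Finset.range p) (fun r t => f ((s ^ t) r))]
  symm
  refine Finset.sum_nbij (fun x : J × ℕ => (s ^ x.2) x.1) (fun _ _ => Finset.mem_univ _) hT.injOn
    ?_ (fun _ _ => rfl)
  simpa using hT.surjOn

theorem exists_isTransversal {J : Type*} [Fintype J] {s : Equiv.Perm J} {p : ℕ} (hp : p.Prime)
    (hs : s ^ p = 1) (hfix : ∀ i, s i ≠ i) : ∃ T, IsTransversal s p T := by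
  classical
  let St := Equiv.Perm.SameCycle.setoid s
  have hper : ∀ r, Function.minimalPeriod s r = p := fun r => by
    have h1 : Function.IsPeriodicPt s p r := by
      change (s^[p]) r = r
      rw [Equiv.Perm.iterate_eq_pow, hs]; rfl
    refine ((Nat.dvd_prime hp).1 h1.minimalPeriod_dvd).resolve_left fun h => hfix r ?_
    exact Function.minimalPeriod_eq_one_iff_isFixedPt.1 h
  refine ⟨Finset.univ.image fun q : Quotient St => q.out, Set.mapsTo_univ _ _, ?_, ?_⟩
  · rintro ⟨r, t⟩ hr ⟨r', t'⟩ hr' h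
    simp only [Finset.coe_product, Finset.coe_image, Finset.coe_univ, Set.image_univ,
      Finset.coe_range, Set.mem_prod, Set.mem_range, Set.mem_Iio] at hr hr'
    obtain ⟨⟨q, rfl⟩, ht⟩ := hr
    obtain ⟨⟨q', rfl⟩, ht'⟩ := hr'
    simp only at h
    have h1 : q = q' := by
      rw [← Quotient.out_equiv_out]
      refine ⟨(t : ℤ) - t', ?_⟩
      rw [zpow_sub, ← zpow_neg, Equiv.Perm.mul_apply, zpow_natCast, zpow_neg, zpow_natCast]
      rw [← Equiv.Perm.mul_apply, (Commute.pow_pow_self s t t').inv_right.eq,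
        Equiv.Perm.mul_apply, h, ← Equiv.Perm.mul_apply, inv_mul_cancel]
      rfl
    subst h1
    have h2 : t = t' := by
      apply Function.iterate_injOn_Iio_minimalPeriod (f := s) (x := q.out)
      · rwa [hper]
      · rwa [hper]
      · simpa [Equiv.Perm.iterate_eq_pow] using h
    rw [h2]
  · intro i _
    have h1 : s.SameCycle (⟦i⟧ : Quotient St).out i := Quotient.mk_out (s := St) i
    obtain ⟨z, hz⟩ := h1
    have hp0 : (p : ℤ) ≠ 0 := by exact_mod_cast hp.ne_zero
    refine ⟨((⟦i⟧ : Quotient St).out, (z % p).toNat), ?_, ?_⟩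
    · simp only [Finset.coe_product, Finset.coe_image, Finset.coe_univ, Set.image_univ,
        Finset.coe_range, Set.mem_prod, Set.mem_range_self, Set.mem_Iio, true_and]
      have := Int.emod_nonneg z hp0
      have := Int.emod_lt_of_pos z (b := (p : ℤ)) (by exact_mod_cast hp.pos)
      omega
    · simp only
      rw [← zpow_natCast, Int.toNat_of_nonneg (Int.emod_nonneg z hp0)]
      refine Eq.trans ?_ hz
      nth_rewrite 2 [← Int.emod_add_mul_ediv z p]
      rw [zpow_add, zpow_mul, zpow_natCast, hs, one_zpow, mul_one]

section Filtration

variable {A : Type*} [Ring A]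

/-- A decreasing multiplicative filtration of a ring by additive subgroups. -/
structure RingFiltration (F : ℕ → AddSubgroup A) : Prop where
  mem_zero : ∀ a, a ∈ F 0
  succ_le : ∀ k, F (k + 1) ≤ F k
  mul_mem : ∀ {i j : ℕ} {a b : A}, a ∈ F i → b ∈ F j → a * b ∈ F (i + j)

/-- Congruence modulo the `k`-th step of a filtration. -/
def FCong (F : ℕ → AddSubgroup A) (k : ℕ) (a b : A) : Prop := a - b ∈ F k

namespace FCong

variable {F : ℕ → AddSubgroup A} {k : ℕ} {a b c d : A}

theorem rfl' : FCong F k a a := by simp [FCong]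

theorem of_eq (h : a = b) : FCong F k a b := h ▸ rfl'

theorem symm (h : FCong F k a b) : FCong F k b a := by
  unfold FCong at *; rw [← neg_sub]; exact neg_mem h

theorem trans (h : FCong F k a b) (h' : FCong F k b c) : FCong F k a c := by
  unfold FCong at *; rw [← sub_add_sub_cancel a b c]; exact add_mem h h'

theorem add (h : FCong F k a b) (h' : FCong F k c d) : FCong F k (a + c) (b + d) := by
  unfold FCong at *; rw [add_sub_add_comm]; exact add_mem h h'

theorem sub (h : FCong F k a b) (h' : FCong F k c d) : FCong F k (a - c) (b - d) := by
  unfold FCong at *; rw [sub_sub_sub_comm]; exact sub_mem h h'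

theorem sum {J : Type*} {s : Finset J} {f g : J → A} (h : ∀ i ∈ s, FCong F k (f i) (g i)) :
    FCong F k (∑ i ∈ s, f i) (∑ i ∈ s, g i) := by
  unfold FCong at *; rw [← Finset.sum_sub_distrib]; exact sum_mem h

theorem mem (h : FCong F k a b) (hb : b ∈ F k) : a ∈ F k := by
  unfold FCong at h; simpa using add_mem h hb

theorem of_mem (ha : a ∈ F k) : FCong F k a 0 := by simpa [FCong] using ha

theorem mul_left (hF : RingFiltration F) {i : ℕ} (hc : c ∈ F i) (h : FCong F k a b) :
    FCong F (i + k) (c * a) (c * b) := by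
  unfold FCong at *; rw [← mul_sub]; exact hF.mul_mem hc h

theorem mul_right (hF : RingFiltration F) {i : ℕ} (hc : c ∈ F i) (h : FCong F k a b) :
    FCong F (k + i) (a * c) (b * c) := by
  unfold FCong at *; rw [← sub_mul]; exact hF.mul_mem h hc

end FCong

theorem RingFiltration.le {F : ℕ → AddSubgroup A} (hF : RingFiltration F) {i j : ℕ} (h : i ≤ j) :
    F j ≤ F i := antitone_nat_of_succ_le hF.succ_le h

theorem FCong.of_le {F : ℕ → AddSubgroup A} (hF : RingFiltration F) {i j : ℕ} (h : i ≤ j) {a b : A}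
    (hab : FCong F j a b) : FCong F i a b := hF.le h hab

/-- The norm `1 + φ + ⋯ + φ ^ (p - 1)` of an endomorphism. -/
def ringNorm (φ : A →+* A) (p : ℕ) (v : A) : A := ∑ t ∈ Finset.range p, (φ ^ t) v

theorem ringHom_pow_succ_apply (φ : A →+* A) (t : ℕ) (v : A) :
    (φ ^ (t + 1)) v = φ ((φ ^ t) v) := by rw [pow_succ']; rfl

theorem ringHom_pow_succ_apply' (φ : A →+* A) (t : ℕ) (v : A) :
    (φ ^ (t + 1)) v = (φ ^ t) (φ v) := by rw [pow_succ]; rfl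

theorem ringNorm_add (φ : A →+* A) (p : ℕ) (u v : A) :
    ringNorm φ p (u + v) = ringNorm φ p u + ringNorm φ p v := by
  simp [ringNorm, Finset.sum_add_distrib]

theorem ringNorm_sub (φ : A →+* A) (p : ℕ) (u v : A) :
    ringNorm φ p (u - v) = ringNorm φ p u - ringNorm φ p v := by
  simp [ringNorm, Finset.sum_sub_distrib]

theorem ringNorm_zsmul (φ : A →+* A) (p : ℕ) (m : ℤ) (v : A) :
    ringNorm φ p (m • v) = m • ringNorm φ p v := by
  simp only [ringNorm, map_zsmul, Finset.smul_sum]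

theorem map_ringNorm (φ : A →+* A) {p : ℕ} {v : A} (hp : (φ ^ p) v = v) :
    φ (ringNorm φ p v) = ringNorm φ p v := by
  have h1 := Finset.sum_range_succ' (fun t => (φ ^ t) v) p
  have h2 := Finset.sum_range_succ (fun t => (φ ^ t) v) p
  rw [h2, hp] at h1
  simp only [pow_zero, RingHom.coe_one, id] at h1
  rw [ringNorm, map_sum]
  simp only [← ringHom_pow_succ_apply]
  exact (add_right_cancel h1).symm

/-- Generators of a filtration that are permuted by an endomorphism up to higher order. -/
structure PermutedGens (F : ℕ → AddSubgroup A) (φ : A →+* A) {J : Type*} [Fintype J]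
    (s : Equiv.Perm J) (E : J → A) : Prop extends RingFiltration F where
  map_mem : ∀ {k : ℕ} {a : A}, a ∈ F k → φ a ∈ F k
  gen_mem : ∀ i, E i ∈ F 1
  map_gen : ∀ i, FCong F 2 (φ (E i)) (E (s i))
  exists_eq_sum : ∀ {k : ℕ} {v : A}, v ∈ F (k + 1) → ∃ u : J → A, (∀ i, u i ∈ F k) ∧
    v = ∑ i, E i * u i

namespace PermutedGens

variable {F : ℕ → AddSubgroup A} {φ : A →+* A} {J : Type*} [Fintype J] {s : Equiv.Perm J}
  {E : J → A}

theorem pow_map_mem (h : PermutedGens F φ s E) (t : ℕ) {k : ℕ} {a : A} (ha : a ∈ F k) :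
    (φ ^ t) a ∈ F k := by
  induction t with
  | zero => simpa
  | succ t ih => rw [ringHom_pow_succ_apply]; exact h.map_mem ih

theorem map_cong (h : PermutedGens F φ s E) (t : ℕ) {k : ℕ} {a b : A} (ha : FCong F k a b) :
    FCong F k ((φ ^ t) a) ((φ ^ t) b) := by
  unfold FCong at *; rw [← map_sub]; exact h.pow_map_mem t ha

theorem ringNorm_mem (h : PermutedGens F φ s E) (p : ℕ) {k : ℕ} {a : A} (ha : a ∈ F k) :
    ringNorm φ p a ∈ F k := sum_mem fun t _ => h.pow_map_mem t ha

theorem ringNorm_cong (h : PermutedGens F φ s E) (p : ℕ) {k : ℕ} {a b : A} (ha : FCong F k a b) :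
    FCong F k (ringNorm φ p a) (ringNorm φ p b) := by
  unfold FCong at *; rw [← ringNorm_sub]; exact h.ringNorm_mem p ha

theorem pow_map_gen (h : PermutedGens F φ s E) (t : ℕ) (i : J) :
    FCong F 2 ((φ ^ t) (E i)) (E ((s ^ t) i)) := by
  induction t generalizing i with
  | zero => exact FCong.of_eq (by simp)
  | succ t ih =>
    rw [ringHom_pow_succ_apply', pow_succ, Equiv.Perm.mul_apply]
    exact (h.map_cong t (h.map_gen i)).trans (ih (s i))

theorem pow_map_gen_mul (h : PermutedGens F φ s E) (t : ℕ) (i : J) {k : ℕ} {a : A} (ha : a ∈ F k) :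
    FCong F (k + 2) ((φ ^ t) (E i * a)) (E ((s ^ t) i) * (φ ^ t) a) := by
  rw [map_mul, add_comm]
  exact (h.pow_map_gen t i).mul_right h.toRingFiltration (h.pow_map_mem t ha)

/-- The partial norm `1 + φ + ⋯ + φ ^ (t - 1)` applied to the defect of equivariance. -/
theorem coeff_cong (h : PermutedGens F φ s E) {k : ℕ} {v : J → A} {d : A}
    (hv : ∀ i, FCong F k (φ (v i) - v (s i)) d) (t : ℕ) (i : J) :
    FCong F k (v ((s ^ t) i)) ((φ ^ t) (v i) - ringNorm φ t d) := by
  induction t with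
  | zero => exact FCong.of_eq (by simp [ringNorm])
  | succ t ih =>
    have h1 := h.map_cong 1 ih
    simp only [pow_one] at h1
    have h2 : FCong F k (v ((s ^ (t + 1)) i)) (φ (v ((s ^ t) i)) - d) := by
      have := hv ((s ^ t) i)
      rw [pow_succ', Equiv.Perm.mul_apply]
      have h3 := (FCong.rfl' (F := F) (k := k) (a := φ (v ((s ^ t) i)))).sub this
      simpa using h3
    refine h2.trans ((h1.sub FCong.rfl').trans (FCong.of_eq ?_))
    rw [map_sub, ringHom_pow_succ_apply, ringNorm, ringNorm, Finset.sum_range_succ', map_sum]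
    simp only [ringHom_pow_succ_apply, pow_zero, RingHom.coe_one, id]
    abel

theorem sum_cong_norm (h : PermutedGens F φ s E) {p : ℕ} {T : Finset J}
    (hT : IsTransversal s p T) {k : ℕ} {v : J → A} {d : A} (hvk : ∀ i, v i ∈ F k)
    (hv : ∀ i, FCong F (k + 1) (φ (v i) - v (s i)) d) :
    FCong F (k + 2) (∑ i, E i * v i) (ringNorm φ p (∑ r ∈ T, E r * v r) -
      ∑ t ∈ Finset.range p, (∑ r ∈ T, E ((s ^ t) r)) * ringNorm φ t d) := by
  rw [hT.sum_eq, Finset.sum_comm]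
  unfold ringNorm
  rw [← Finset.sum_sub_distrib]
  refine FCong.sum fun t _ => ?_
  rw [Finset.sum_mul, map_sum, ← Finset.sum_sub_distrib]
  refine FCong.sum fun r _ => ?_
  have h1 := (h.coeff_cong hv t r).mul_left h.toRingFiltration (h.gen_mem ((s ^ t) r))
  rw [show 1 + (k + 1) = k + 2 by ring, mul_sub] at h1
  exact h1.trans (((h.pow_map_gen_mul t r (hvk r)).symm).sub FCong.rfl')

theorem map_sum_cong (h : PermutedGens F φ s E) {k : ℕ} {v : J → A} (hvk : ∀ i, v i ∈ F k) :
    FCong F (k + 2) (φ (∑ i, E i * v i)) (∑ i, E (s i) * φ (v i)) := by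
  rw [map_sum]
  refine FCong.sum fun i _ => ?_
  simpa using h.pow_map_gen_mul 1 i (hvk i)

/-- If the generators are independent modulo higher order and `s` is free, an element that is
invariant to leading order is a norm to leading order. -/
theorem exists_norm_of_indep (h : PermutedGens F φ s E) {p : ℕ} {T : Finset J}
    (hT : IsTransversal s p T) {k : ℕ}
    (hind : ∀ u : J → A, ∑ i, E i * u i ∈ F (k + 2) → ∀ i, u i ∈ F (k + 1)) {v : A}
    (hv : v ∈ F (k + 1)) (hφ : FCong F (k + 2) (φ v) v) :
    ∃ u ∈ F (k + 1), FCong F (k + 2) v (ringNorm φ p u) := by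
  obtain ⟨w, hw, rfl⟩ := h.exists_eq_sum hv
  have h1 : ∀ i, FCong F (k + 1) (φ (w i) - w (s i)) 0 := by
    have h2 := ((h.map_sum_cong hw).symm.trans hφ)
    have h3 : ∑ i, E i * w i = ∑ i, E (s i) * w (s i) := (Equiv.sum_comp s _).symm
    rw [h3, FCong, ← Finset.sum_sub_distrib] at h2
    simp only [← mul_sub] at h2
    rw [← Equiv.sum_comp s.symm] at h2
    simp only [Equiv.apply_symm_apply] at h2
    intro i
    have := hind (fun i => φ (w (s.symm i)) - w i) h2 (s i)
    simpa [FCong] using this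
  refine ⟨∑ r ∈ T, E r * w r, sum_mem fun r _ => ?_, ?_⟩
  · rw [add_comm]; exact h.mul_mem (h.gen_mem r) (hw r)
  · simpa [ringNorm] using h.sum_cong_norm hT hw h1

/-- Under the hypotheses of `exists_norm_of_indep`, invariant elements are norms to all orders. -/
theorem exists_norm_of_invariant (h : PermutedGens F φ s E) {p : ℕ} {T : Finset J}
    (hT : IsTransversal s p T)
    (hind : ∀ k, ∀ u : J → A, ∑ i, E i * u i ∈ F (k + 2) → ∀ i, u i ∈ F (k + 1))
    (hp : φ ^ p = 1) {v : A} (hv : v ∈ F 1) (hφ : φ v = v) (k : ℕ) :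
    ∃ u, FCong F (k + 1) v (ringNorm φ p u) := by
  induction k with
  | zero => exact ⟨0, by simpa [ringNorm] using FCong.of_mem hv⟩
  | succ k ih =>
    obtain ⟨u, hu⟩ := ih
    obtain ⟨u', -, hu'⟩ := h.exists_norm_of_indep hT (hind k) hu
      (FCong.of_eq (by rw [map_sub, hφ, map_ringNorm _ (by rw [hp]; rfl)]))
    refine ⟨u + u', ?_⟩
    rw [ringNorm_add]
    have := (FCong.rfl' (F := F) (k := k + 1 + 1) (a := ringNorm φ p u)).add hu'
    simpa using this

variable [Nonempty J]

theorem exists_defect (h : PermutedGens F φ s E) {p : ℕ} (hp : φ ^ p = 1) (hs : s ^ p = 1)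
    (hind : ∀ k, ∀ u : J → A, (∀ i, u i ∈ F k) → ∑ i, E i * u i ∈ F (k + 2) →
      ∀ i j, FCong F (k + 1) (u i) (u j)) {k : ℕ} {v : A} (hv : v ∈ F (k + 1))
    (hφ : FCong F (k + 2) (φ v) v) :
    ∃ (w : J → A) (d : A), (∀ i, w i ∈ F k) ∧ d ∈ F k ∧ v = ∑ i, E i * w i ∧
      (∀ i, FCong F (k + 1) (φ (w i) - w (s i)) d) ∧ ringNorm φ p d ∈ F (k + 1) := by
  obtain ⟨w, hw, rfl⟩ := h.exists_eq_sum hv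
  let i₀ : J := Classical.arbitrary J
  have h2 := ((h.map_sum_cong hw).symm.trans hφ)
  have h3 : ∑ i, E i * w i = ∑ i, E (s i) * w (s i) := (Equiv.sum_comp s _).symm
  rw [h3, FCong, ← Finset.sum_sub_distrib] at h2
  simp only [← mul_sub] at h2
  rw [← Equiv.sum_comp s.symm] at h2
  simp only [Equiv.apply_symm_apply] at h2
  have h4 : ∀ i, FCong F (k + 1) (φ (w i) - w (s i)) (φ (w i₀) - w (s i₀)) := fun i => by
    have := hind k (fun i => φ (w (s.symm i)) - w i)
      (fun i => sub_mem (h.map_mem (hw _)) (hw _)) h2 (s i) (s i₀)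
    simpa using this
  refine ⟨w, _, hw, sub_mem (h.map_mem (hw i₀)) (hw (s i₀)), rfl, h4, ?_⟩
  have h5 := h.coeff_cong h4 p i₀
  rw [hs, hp, FCong] at h5
  simpa using h5

/-- The sum of the generators indexed by the `t`-th translate of a transversal. -/
def transSum (s : Equiv.Perm J) (E : J → A) (T : Finset J) (t : ℕ) : A := ∑ r ∈ T, E ((s ^ t) r)

omit [Nonempty J] in
theorem transSum_mem (h : PermutedGens F φ s E) (T : Finset J) (t : ℕ) :
    transSum s E T t ∈ F 1 := sum_mem fun _ _ => h.gen_mem _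

omit [Nonempty J] in
theorem pow_map_transSum (h : PermutedGens F φ s E) (T : Finset J) (t : ℕ) :
    FCong F 2 ((φ ^ t) (transSum s E T 0)) (transSum s E T t) := by
  unfold transSum
  rw [map_sum]
  exact FCong.sum fun r _ => by simpa using h.pow_map_gen t r

theorem sum_range_shift_of_eq {M : Type*} [AddCommMonoid M] [IsCancelAdd M] {G : ℕ → M} {p : ℕ}
    (hG : G p = G 0) : ∑ u ∈ Finset.range p, G (u + 1) = ∑ u ∈ Finset.range p, G u := by
  have h1 := Finset.sum_range_succ' G p
  rw [Finset.sum_range_succ, hG] at h1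
  exact (add_right_cancel h1).symm

theorem exists_split_of_norm (h : PermutedGens F φ s E) {p : ℕ} {T : Finset J}
    (hT : IsTransversal s p T) (hp : φ ^ p = 1) (hs : s ^ p = 1)
    (hind : ∀ k, ∀ u : J → A, (∀ i, u i ∈ F k) → ∑ i, E i * u i ∈ F (k + 2) →
      ∀ i j, FCong F (k + 1) (u i) (u j)) {k : ℕ} {d : A} (hd : d ∈ F (k + 1))
    (hN : ringNorm φ p d ∈ F (k + 2)) :
    ∃ m ∈ F k, ∃ g ∈ F (k + 1), FCong F (k + 1) (φ m) m ∧
      FCong F (k + 2) d (transSum s E T 0 * m + (φ g - g)) := by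
  obtain ⟨w, hw, rfl⟩ := h.exists_eq_sum hd
  let i₀ : J := Classical.arbitrary J
  let G : J → ℕ → A := fun i u => (φ ^ u) (w ((s ^ u)⁻¹ i))
  let M : J → A := fun i => ∑ u ∈ Finset.range p, G i u
  have hG0 : ∀ i, G i p = G i 0 := fun i => by
    simp only [G, hp, hs]; rfl
  have hM : ∀ i, M i ∈ F k := fun i => sum_mem fun u _ => h.pow_map_mem u (hw _)
  have hφM : ∀ i, φ (M i) = M (s i) := fun i => by
    simp only [M]
    rw [← sum_range_shift_of_eq (hG0 (s i)), map_sum]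
    refine Finset.sum_congr rfl fun u _ => ?_
    simp only [G, ringHom_pow_succ_apply]
    rw [pow_succ', mul_inv_rev, Equiv.Perm.mul_apply, ← Equiv.Perm.mul_apply s⁻¹, inv_mul_cancel]
    rfl
  have hNM : FCong F (k + 2) (ringNorm φ p (∑ i, E i * w i)) (∑ i, E i * M i) := by
    simp only [ringNorm, M, Finset.mul_sum]
    rw [Finset.sum_comm]
    refine FCong.sum fun u _ => ?_
    rw [map_sum, ← Equiv.sum_comp (s ^ u) (fun i => E i * G i u)]
    refine FCong.sum fun i _ => ?_
    simpa [G] using h.pow_map_gen_mul u i (hw i)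
  have hMM := hind k M hM (hNM.symm.mem hN)
  let W : J → ℕ → A := fun r t => E r * (φ ^ (p - t)) (w ((s ^ t) r))
  have hW : ∀ r t, W r t ∈ F (k + 1) := fun r t => by
    rw [add_comm]; exact h.mul_mem (h.gen_mem r) (h.pow_map_mem _ (hw _))
  refine ⟨M i₀, hM i₀, ∑ r ∈ T, ∑ t ∈ Finset.range p, ringNorm φ t (W r t),
    sum_mem fun r _ => sum_mem fun t _ => h.ringNorm_mem t (hW r t), ?_, ?_⟩
  · rw [hφM]; exact hMM _ _
  have h1 : FCong F (k + 2) (∑ i, E i * w i)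
      (∑ r ∈ T, ∑ t ∈ Finset.range p, (φ ^ t) (W r t)) := by
    rw [hT.sum_eq]
    refine FCong.sum fun r _ => FCong.sum fun t ht => ?_
    have h2 := h.pow_map_gen_mul t r (h.pow_map_mem (p - t) (hw ((s ^ t) r)))
    have h3 : (φ ^ t) ((φ ^ (p - t)) (w ((s ^ t) r))) = w ((s ^ t) r) := by
      change (φ ^ t * φ ^ (p - t)) _ = _
      rw [← pow_add, Nat.add_sub_cancel' (Finset.mem_range.1 ht).le, hp]; rfl
    rw [h3] at h2
    exact h2.symm
  have h4 : ∀ r t, (φ ^ t) (W r t) =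
      W r t + (φ (ringNorm φ t (W r t)) - ringNorm φ t (W r t)) := fun r t => by
    have h5 := Finset.sum_range_succ (fun u => (φ ^ u) (W r t)) t
    rw [Finset.sum_range_succ'] at h5
    simp only [ringNorm, map_sum, ← ringHom_pow_succ_apply]
    rw [← sub_eq_zero] at h5 ⊢
    rw [← neg_eq_zero, ← h5]
    simp only [pow_zero, RingHom.coe_one, id]
    abel
  have h6 : ∀ r, ∑ t ∈ Finset.range p, W r t = E r * M r := fun r => by
    simp only [W, ← Finset.mul_sum, M]
    congr 1
    rw [← sum_range_shift_of_eq (hG0 r), ← Finset.sum_range_reflect]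
    refine Finset.sum_congr rfl fun t ht => ?_
    have ht := Finset.mem_range.1 ht
    have h7 : p - (p - 1 - t) = t + 1 := by omega
    have h8 : (s ^ (t + 1))⁻¹ = s ^ (p - 1 - t) := by
      rw [inv_eq_iff_mul_eq_one, ← pow_add, show t + 1 + (p - 1 - t) = p by omega, hs]
    simp only [G, h7, h8]
  refine h1.trans ?_
  simp only [h4, Finset.sum_add_distrib, Finset.sum_sub_distrib, map_sum, h6]
  refine FCong.add ?_ FCong.rfl'
  rw [transSum, Finset.sum_mul]
  refine FCong.sum fun r _ => ?_
  have := (hMM r i₀).mul_left h.toRingFiltration (h.gen_mem r)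
  rw [show 1 + (k + 1) = k + 2 by ring] at this
  simpa using this

omit [Nonempty J] in
theorem sum_transSum_mul_cong (h : PermutedGens F φ s E) {p : ℕ} {T : Finset J}
    (hT : IsTransversal s p T) (hE : ∑ i, E i ∈ F 2) {k : ℕ} {d m g : A}
    (hm : m ∈ F k) (hg : g ∈ F (k + 1)) (hφ : FCong F (k + 1) (φ m) m)
    (hd : FCong F (k + 2) d (transSum s E T 0 * m + (φ g - g))) :
    FCong F (k + 3) (∑ t ∈ Finset.range p, transSum s E T t * ringNorm φ t d)
      ((∑ t ∈ Finset.range p, transSum s E T t * ∑ u ∈ Finset.range t, transSum s E T u) * m +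
        ringNorm φ p (transSum s E T 0 * g)) := by
  have hpow : ∀ u, FCong F (k + 1) ((φ ^ u) m) m := fun u => by
    induction u with
    | zero => exact FCong.of_eq (by simp)
    | succ u ih => rw [ringHom_pow_succ_apply']; exact (h.map_cong u hφ).trans ih
  have h1 : ∀ t, FCong F (k + 2) (ringNorm φ t d)
      ((∑ u ∈ Finset.range t, transSum s E T u) * m + ((φ ^ t) g - g)) := fun t => by
    refine (h.ringNorm_cong t hd).trans ?_
    rw [ringNorm_add]
    refine FCong.add ?_ (FCong.of_eq ?_)
    · rw [Finset.sum_mul]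
      refine FCong.sum fun u _ => ?_
      rw [map_mul]
      have h2 := (h.pow_map_transSum T u).mul_right h.toRingFiltration (h.pow_map_mem u hm)
      have h3 := (hpow u).mul_left h.toRingFiltration (h.transSum_mem T u)
      rw [show 1 + (k + 1) = k + 2 by ring] at h3
      rw [show 2 + k = k + 2 by ring] at h2
      exact h2.trans h3
    · simp only [ringNorm, map_sub, ← ringHom_pow_succ_apply']
      rw [Finset.sum_range_sub (fun u => (φ ^ u) g)]
      simp
  have h2 : FCong F (k + 3) (∑ t ∈ Finset.range p, transSum s E T t * ringNorm φ t d)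
      (∑ t ∈ Finset.range p, (transSum s E T t * ((∑ u ∈ Finset.range t, transSum s E T u) * m) +
        (transSum s E T t * (φ ^ t) g - transSum s E T t * g))) := by
    refine FCong.sum fun t _ => ?_
    have h3 := (h1 t).mul_left h.toRingFiltration (h.transSum_mem T t)
    rw [show 1 + (k + 2) = k + 3 by ring, mul_add, mul_sub] at h3
    exact h3
  refine h2.trans ?_
  rw [Finset.sum_add_distrib, Finset.sum_sub_distrib, Finset.sum_mul]
  simp only [mul_assoc]
  refine FCong.add FCong.rfl' ?_
  have h4 : ∑ t ∈ Finset.range p, transSum s E T t * g ∈ F (k + 3) := by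
    rw [← Finset.sum_mul, show k + 3 = 2 + (k + 1) by ring]
    refine h.mul_mem ?_ hg
    unfold transSum
    rw [Finset.sum_comm, ← hT.sum_eq]
    exact hE
  have h5 : FCong F (k + 3) (∑ t ∈ Finset.range p, transSum s E T t * (φ ^ t) g)
      (ringNorm φ p (transSum s E T 0 * g)) := by
    refine FCong.sum fun t _ => ?_
    rw [map_mul]
    have h6 := (h.pow_map_transSum T t).mul_right h.toRingFiltration (h.pow_map_mem t hg)
    rw [show 2 + (k + 1) = k + 3 by ring] at h6
    exact h6.symm
  simpa using h5.sub (FCong.of_mem h4)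

/-- The powers of `θ`, placed in even degrees. -/
def evenPow (θ : A) : ℕ → A
  | 0 => 1
  | 1 => 0
  | k + 2 => θ * evenPow θ k

/-- Invariant elements are, to leading order, norms plus multiples of powers of the periodicity
class `θ`. -/
theorem exists_norm_add_evenPow (h : PermutedGens F φ s E) {p : ℕ} (hp0 : p ≠ 0) {T : Finset J}
    (hT : IsTransversal s p T) (hp : φ ^ p = 1) (hs : s ^ p = 1)
    (hind : ∀ k, ∀ u : J → A, (∀ i, u i ∈ F k) → ∑ i, E i * u i ∈ F (k + 2) →
      ∀ i j, FCong F (k + 1) (u i) (u j)) (hE : ∑ i, E i ∈ F 2)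
    (hmod : ∀ v : A, ∃ a : ℤ, FCong F 1 v a) (hzero : ∀ a : ℤ, (a : A) ∈ F 1 → a = 0)
    {θ : A} (hφθ : φ θ = θ) (hθ : FCong F 3
      (∑ t ∈ Finset.range p, transSum s E T t * ∑ u ∈ Finset.range t, transSum s E T u) θ)
    (k : ℕ) : ∀ v ∈ F k, FCong F (k + 1) (φ v) v →
    ∃ u ∈ F k, ∃ a : ℤ, FCong F (k + 1) v (ringNorm φ p u + a • evenPow θ k) := by
  induction k using Nat.twoStepInduction with
  | zero =>
    intro v _ _
    obtain ⟨a, ha⟩ := hmod v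
    exact ⟨0, zero_mem _, a, by simpa [ringNorm, evenPow] using ha⟩
  | one =>
    intro v hv hφ
    obtain ⟨w, d, hw, -, rfl, hwd, hNd⟩ := h.exists_defect hp hs hind hv hφ
    obtain ⟨a, ha⟩ := hmod d
    have h1 := (h.ringNorm_cong p ha).symm.mem hNd
    have h2 : ringNorm φ p (a : A) = ((p * a : ℤ) : A) := by simp [ringNorm]
    rw [h2] at h1
    have ha0 : a = 0 := by
      have := hzero _ h1
      simpa [hp0] using this
    subst ha0
    have h3 := h.sum_cong_norm hT (d := 0) hw (fun i => (hwd i).trans (by simpa using ha))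
    refine ⟨∑ r ∈ T, E r * w r, sum_mem fun r _ => h.mul_mem (j := 0) (h.gen_mem r) (hw r), 0, ?_⟩
    simpa [ringNorm] using h3
  | more k ih _ =>
    intro v hv hφ
    obtain ⟨w, d, hw, hd, rfl, hwd, hNd⟩ := h.exists_defect hp hs hind hv hφ
    obtain ⟨m, hm, g, hg, hφm, hdm⟩ := h.exists_split_of_norm hT hp hs hind hd hNd
    obtain ⟨u, hu, a, hua⟩ := ih m hm hφm
    have h1 := h.sum_cong_norm hT hw hwd
    have h2 := h.sum_transSum_mul_cong hT hE hm hg hφm hdm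
    have hθ2 : θ ∈ F 2 := by
      refine (hθ.of_le h.toRingFiltration (by norm_num)).symm.mem (sum_mem fun t _ => ?_)
      exact h.mul_mem (h.transSum_mem T t) (sum_mem fun u _ => h.transSum_mem T u)
    have hθN : ∀ x, θ * ringNorm φ p x = ringNorm φ p (θ * x) := fun x => by
      have hθt : ∀ t, (φ ^ t) θ = θ := fun t => by
        induction t with
        | zero => simp
        | succ t ih => rw [ringHom_pow_succ_apply, ih, hφθ]
      simp [ringNorm, Finset.mul_sum, -RingHom.coe_pow, hθt]
    have h3 := hθ.mul_right h.toRingFiltration hm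
    have h4 := hua.mul_left h.toRingFiltration hθ2
    rw [show 3 + k = k + 3 by ring] at h3
    rw [show 2 + (k + 1) = k + 3 by ring, mul_add, hθN] at h4
    refine ⟨∑ r ∈ T, E r * w r - θ * u - transSum s E T 0 * g, ?_, -a, ?_⟩
    · refine sub_mem (sub_mem (sum_mem fun r _ => ?_) ?_) ?_
      · rw [show k + 2 = 1 + (k + 1) by ring]; exact h.mul_mem (h.gen_mem r) (hw r)
      · rw [show k + 2 = 2 + k by ring]; exact h.mul_mem hθ2 hu
      · rw [show k + 2 = 1 + (k + 1) by ring]; exact h.mul_mem (h.transSum_mem T 0) hg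
    · refine h1.trans ((FCong.rfl'.sub (h2.trans ((h3.trans h4).add FCong.rfl'))).trans
        (FCong.of_eq ?_))
      simp only [ringNorm_sub, evenPow]
      rw [mul_smul_comm, neg_smul]
      abel

/-- Under the hypotheses of `exists_norm_add_evenPow`, if the periodicity class is a norm then
invariant elements are norms to all orders. -/
theorem exists_norm_of_invariant_of_periodic (h : PermutedGens F φ s E) {p : ℕ} (hp0 : p ≠ 0)
    {T : Finset J} (hT : IsTransversal s p T) (hp : φ ^ p = 1) (hs : s ^ p = 1)
    (hind : ∀ k, ∀ u : J → A, (∀ i, u i ∈ F k) → ∑ i, E i * u i ∈ F (k + 2) →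
      ∀ i j, FCong F (k + 1) (u i) (u j)) (hE : ∑ i, E i ∈ F 2)
    (hmod : ∀ v : A, ∃ a : ℤ, FCong F 1 v a) (hzero : ∀ a : ℤ, (a : A) ∈ F 1 → a = 0)
    {ε : A} (hθ : FCong F 3
      (∑ t ∈ Finset.range p, transSum s E T t * ∑ u ∈ Finset.range t, transSum s E T u)
      (ringNorm φ p ε)) {v : A} (hv : v ∈ F 1) (hφ : φ v = v) (k : ℕ) :
    ∃ u, FCong F (k + 1) v (ringNorm φ p u) := by
  have hpa : ∀ x, (φ ^ p) x = x := fun x => by rw [hp]; rfl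
  have hφθ := map_ringNorm φ (hpa ε)
  have hmul : ∀ x y, φ y = y → ringNorm φ p x * y = ringNorm φ p (x * y) := fun x y hy => by
    have hyt : ∀ t, (φ ^ t) y = y := fun t => by
      induction t with
      | zero => simp
      | succ t ih => rw [ringHom_pow_succ_apply, ih, hy]
    simp [ringNorm, Finset.sum_mul, -RingHom.coe_pow, hyt]
  have heven : ∀ k, φ (evenPow (ringNorm φ p ε) k) = evenPow (ringNorm φ p ε) k := fun k => by
    induction k using Nat.twoStepInduction with
    | zero => simp [evenPow]
    | one => simp [evenPow]
    | more k ih _ => rw [evenPow, map_mul, hφθ, ih]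
  have hnorm : ∀ k, ∃ x, evenPow (ringNorm φ p ε) (k + 1) = ringNorm φ p x := fun k => by
    cases k with
    | zero => exact ⟨0, by simp [evenPow, ringNorm]⟩
    | succ k => exact ⟨_, by rw [evenPow, hmul _ _ (heven k)]⟩
  induction k with
  | zero => exact ⟨0, by simpa [ringNorm] using FCong.of_mem hv⟩
  | succ k ih =>
    obtain ⟨u, hu⟩ := ih
    obtain ⟨u', -, a, hu'⟩ := h.exists_norm_add_evenPow hp0 hT hp hs hind hE hmod hzero hφθ hθ
      (k + 1) _ hu (FCong.of_eq (by rw [map_sub, hφ, map_ringNorm _ (hpa u)]))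
    obtain ⟨x, hx⟩ := hnorm k
    refine ⟨u + (u' + a • x), ?_⟩
    rw [ringNorm_add, ringNorm_add, ringNorm_zsmul, ← hx]
    have := (FCong.rfl' (F := F) (k := k + 1 + 1) (a := ringNorm φ p u)).add hu'
    simpa using this

end PermutedGens

end Filtration

section Residual

open Matrix

theorem parabolic_mul_aux (q i k l : ℤ) :
    !![1 - k * i * q, k * i ^ 2 * q; -(k * q), 1 + k * i * q] *
      !![1 - l * i * q, l * i ^ 2 * q; -(l * q), 1 + l * i * q] =
    !![1 - (k + l) * i * q, (k + l) * i ^ 2 * q; -((k + l) * q), 1 + (k + l) * i * q] := by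
  ext a b
  fin_cases a <;> fin_cases b <;> simp <;> ring

/-- The parabolic matrix fixing the direction `(i, 1)`. -/
def parabolic (q i k : ℤ) : (Matrix (Fin 2) (Fin 2) ℤ)ˣ where
  val := !![1 - k * i * q, k * i ^ 2 * q; -(k * q), 1 + k * i * q]
  inv := !![1 - (-k) * i * q, (-k) * i ^ 2 * q; -((-k) * q), 1 + (-k) * i * q]
  val_inv := by rw [parabolic_mul_aux]; simp [Matrix.one_fin_two]
  inv_val := by rw [parabolic_mul_aux]; simp [Matrix.one_fin_two]

theorem parabolic_zpow (q i n : ℤ) : parabolic q i 1 ^ n = parabolic q i n := by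
  let f : Multiplicative ℤ →* (Matrix (Fin 2) (Fin 2) ℤ)ˣ :=
    { toFun := fun k => parabolic q i k.toAdd
      map_one' := by ext1; simp [parabolic, Matrix.one_fin_two]
      map_mul' := fun a b => by
        ext1; exact (parabolic_mul_aux q i _ _).symm }
  have := map_zpow f (Multiplicative.ofAdd 1) n
  rw [← ofAdd_zsmul] at this
  simpa [f] using this.symm

theorem parabolic_apply (q i k : ℤ) (v : Fin 2 → ℤ) :
    (parabolic q i k).val *ᵥ v =
      ![v 0 - k * q * i * (v 0 - i * v 1), v 1 - k * q * (v 0 - i * v 1)] := by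
  ext a
  fin_cases a <;> simp [parabolic, Matrix.mulVec, dotProduct, Fin.sum_univ_two] <;> ring

/-- Invertible matrices as invertible linear maps. -/
def matUnitsToEnd : (Matrix (Fin 2) (Fin 2) ℤ)ˣ →* (Module.End ℤ (Fin 2 → ℤ))ˣ :=
  Units.map (Matrix.toLinAlgEquiv' : Matrix (Fin 2) (Fin 2) ℤ ≃ₐ[ℤ] _).toAlgHom.toMonoidHom

theorem matUnitsToEnd_smul (g : (Matrix (Fin 2) (Fin 2) ℤ)ˣ) (v : Fin 2 → ℤ) :
    matUnitsToEnd g • v = g.val *ᵥ v := rfl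

theorem injective_lift_parabolic {q : ℤ} (hq : 5 ≤ q) :
    Function.Injective (FreeGroup.lift fun i : ℕ => parabolic q i 1) := by
  let H : ℕ → Type := fun _ => FreeGroup Unit
  let f : ∀ i, H i →* (Module.End ℤ (Fin 2 → ℤ))ˣ := fun i =>
    matUnitsToEnd.comp (FreeGroup.lift fun _ => parabolic q i 1)
  let X : ℕ → Set (Fin 2 → ℤ) := fun i => {v | 2 * |v 0 - i * v 1| < |v 1|}
  have key : Function.Injective (Monoid.CoprodI.lift f) := by
    refine Monoid.CoprodI.lift_injective_of_ping_pong f ?_ X ?_ ?_ ?_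
    · refine Or.inr ⟨0, ?_⟩
      have : Infinite (H 0) := FreeGroup.freeGroupUnitEquivInt.infinite_iff.2 inferInstance
      exact (Cardinal.natCast_lt_aleph0 (n := 3)).le.trans (Cardinal.aleph0_le_mk (H 0))
    · exact fun i => ⟨![i, 1], by simp [X]⟩
    · intro i j hij
      refine Set.disjoint_left.2 fun v hi hj => ?_
      simp only [X, Set.mem_ofPred_eq] at hi hj
      have h1 : (1 : ℤ) ≤ |(i : ℤ) - j| := Int.one_le_abs (by
        rw [sub_ne_zero]; exact_mod_cast hij)
      have h2 : |((i : ℤ) - j) * v 1| ≤ |v 0 - j * v 1| + |v 0 - i * v 1| := by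
        have := abs_sub (v 0 - j * v 1) (v 0 - i * v 1)
        rwa [show v 0 - j * v 1 - (v 0 - i * v 1) = ((i : ℤ) - j) * v 1 by ring] at this
      rw [abs_mul] at h2
      nlinarith [abs_nonneg (v 1)]
    · intro i j hij
      refine FreeGroup.freeGroupUnitEquivInt.forall_congr_left.mpr fun n hn => ?_
      have hn0 : n ≠ 0 := by
        rintro rfl
        exact hn (by simp [H, FreeGroup.freeGroupUnitEquivInt])
      have h1 : f i (FreeGroup.freeGroupUnitEquivInt.symm n) =
          matUnitsToEnd (parabolic q i n) := by
        change matUnitsToEnd (FreeGroup.lift _ (FreeGroup.of () ^ n)) = _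
        rw [map_zpow, FreeGroup.lift_apply_of, parabolic_zpow]
      rw [h1]
      rintro _ ⟨v, hv, rfl⟩
      simp only [X, Set.mem_ofPred_eq] at hv ⊢
      rw [matUnitsToEnd_smul, parabolic_apply]
      simp only [cons_val_zero, cons_val_one]
      have h2 : (1 : ℤ) ≤ |(i : ℤ) - j| := Int.one_le_abs (by
        rw [sub_ne_zero]; exact_mod_cast hij)
      have h3 : |((i : ℤ) - j) * v 1| ≤ |v 0 - j * v 1| + |v 0 - i * v 1| := by
        have := abs_sub (v 0 - j * v 1) (v 0 - i * v 1)
        rwa [show v 0 - j * v 1 - (v 0 - i * v 1) = ((i : ℤ) - j) * v 1 by ring] at this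
      rw [abs_mul] at h3
      have h4 : |n * q * (v 0 - i * v 1)| ≤ |v 1 - n * q * (v 0 - i * v 1)| + |v 1| := by
        have := abs_sub (v 1) (v 1 - n * q * (v 0 - i * v 1))
        rw [sub_sub_cancel] at this
        linarith
      have h5 : (1 : ℤ) ≤ |n| := Int.one_le_abs hn0
      rw [abs_mul, abs_mul, abs_of_pos (by linarith : (0 : ℤ) < q)] at h4
      have h6 : v 0 - n * q * i * (v 0 - i * v 1) - i * (v 1 - n * q * (v 0 - i * v 1)) =
          v 0 - i * v 1 := by ring
      rw [h6]
      have h7 : |v 1| < 2 * |v 0 - i * v 1| := by nlinarith [abs_nonneg (v 1)]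
      have h8 : 5 * |v 0 - i * v 1| ≤ |n| * q * |v 0 - i * v 1| := by
        have : 5 ≤ |n| * q := by nlinarith
        exact mul_le_mul_of_nonneg_right this (abs_nonneg _)
      linarith [abs_nonneg (v 0 - i * v 1)]
  have h1 : ⇑(matUnitsToEnd.comp (FreeGroup.lift fun i : ℕ => parabolic q i 1)) =
      Monoid.CoprodI.lift f ∘ freeGroupEquivCoprodI := by
    rw [← MulEquiv.coe_toMonoidHom, ← MonoidHom.coe_comp]
    congr 1
    ext1 i
    change _ = Monoid.CoprodI.lift f (freeGroupEquivCoprodI (FreeGroup.of i))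
    simp [f, H]
  have h2 : Function.Injective (Monoid.CoprodI.lift f ∘ freeGroupEquivCoprodI) :=
    key.comp freeGroupEquivCoprodI.injective
  rw [← h1, MonoidHom.coe_comp] at h2
  exact h2.of_comp

/-- Reduction of invertible integer matrices modulo `n`. -/
def matUnitsMod (n : ℕ) : (Matrix (Fin 2) (Fin 2) ℤ)ˣ →* (Matrix (Fin 2) (Fin 2) (ZMod n))ˣ :=
  Units.map (Int.castRingHom (ZMod n)).mapMatrix.toMonoidHom

theorem matUnitsMod_eq_one_iff (n : ℕ) (g : (Matrix (Fin 2) (Fin 2) ℤ)ˣ) :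
    matUnitsMod n g = 1 ↔ ∀ a b, (n : ℤ) ∣ (g.val - 1) a b := by
  rw [Units.ext_iff, ← Matrix.ext_iff]
  refine forall_congr' fun a => forall_congr' fun b => ?_
  rw [← ZMod.intCast_zmod_eq_zero_iff_dvd, Matrix.sub_apply, Int.cast_sub, sub_eq_zero]
  simp only [matUnitsMod, Units.coe_map, Units.val_one, Matrix.one_apply]
  change ((g.val a b : ℤ) : ZMod n) = _ ↔ _
  split_ifs <;> simp

theorem matUnitsMod_pow_eq_one {p e : ℕ} (g : (Matrix (Fin 2) (Fin 2) ℤ)ˣ)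
    (hg : matUnitsMod p g = 1) : matUnitsMod (p ^ e) (g ^ p ^ e) = 1 := by
  rw [matUnitsMod_eq_one_iff] at hg ⊢
  choose Y hY using hg
  have h2 : g.val = 1 + (p : ℤ) • Matrix.of Y := by
    rw [← sub_eq_iff_eq_add']
    ext a b
    simp [hY]
  obtain ⟨r, hr⟩ := dvd_sub_pow_of_dvd_sub (R := Polynomial ℤ) (p := p)
    (a := 1 + (p : Polynomial ℤ) * Polynomial.X) (b := 1) (by simp) e
  have h3 := congrArg (Polynomial.aeval (Matrix.of Y)) hr
  simp only [map_sub, map_pow, map_add, map_one, map_mul, one_pow, Polynomial.aeval_X,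
    map_natCast] at h3
  have h4 : (g ^ p ^ e).val - 1 = (p ^ e : ℤ) • ((p : ℤ) • Polynomial.aeval (Matrix.of Y) r) := by
    have h5 : (p : ℤ) • Matrix.of Y = (p : Matrix (Fin 2) (Fin 2) ℤ) * Matrix.of Y := by
      rw [zsmul_eq_mul]; simp
    rw [Units.val_pow_eq_pow_val, h2, smul_smul, ← pow_succ, h5, h3, zsmul_eq_mul]; simp
  intro a b
  rw [h4]
  exact ⟨_, by rw [Matrix.smul_apply, smul_eq_mul]; push_cast; rfl⟩

/-- Free groups are residually finite `p`-groups. -/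
theorem FreeGroup.exists_normal_finiteIndex_pow_mem {ι : Type*} [Countable ι] {p : ℕ}
    (hp : p.Prime) {w : FreeGroup ι} (hw : w ≠ 1) :
    ∃ U : Subgroup (FreeGroup ι), U.Normal ∧ U.FiniteIndex ∧ (∀ g, ∃ k, g ^ p ^ k ∈ U) ∧ w ∉ U := by
  obtain ⟨c, hc⟩ := exists_injective_nat ι
  have hq : (5 : ℤ) ≤ (p : ℤ) ^ 3 := by
    have h2 : (2 : ℤ) ≤ p := by exact_mod_cast hp.two_le
    nlinarith [pow_le_pow_left₀ (by norm_num) h2 3]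
  let m : FreeGroup ι →* (Matrix (Fin 2) (Fin 2) ℤ)ˣ :=
    (FreeGroup.lift fun i : ℕ => parabolic ((p : ℤ) ^ 3) i 1).comp (FreeGroup.map c)
  have hm : Function.Injective m :=
    (injective_lift_parabolic hq).comp (FreeGroup.map_injective hc)
  have h1 : ∀ g, matUnitsMod p (m g) = 1 := by
    have : (matUnitsMod p).comp m = 1 := by
      ext1 i
      simp only [m, MonoidHom.comp_apply, FreeGroup.map.of, FreeGroup.lift_apply_of,
        MonoidHom.one_apply]
      have hdvd : (p : ℤ) ∣ (p : ℤ) ^ 3 := dvd_pow_self _ (by norm_num)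
      rw [matUnitsMod_eq_one_iff]
      intro a b
      fin_cases a <;> fin_cases b <;> simp [parabolic] <;>
        first | exact hdvd | exact Dvd.dvd.mul_left hdvd _
    exact fun g => DFunLike.congr_fun this g
  have h2 : m w ≠ 1 := fun h => hw (hm (h.trans (_root_.map_one _).symm))
  obtain ⟨a, b, hab⟩ : ∃ a b, ((m w).val - 1) a b ≠ 0 := by
    by_contra! h
    exact h2 (Units.ext (sub_eq_zero.1 (by ext a b; exact h a b)))
  obtain ⟨e, he⟩ : ∃ e : ℕ, |((m w).val - 1) a b| < ((p : ℤ)) ^ e :=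
    pow_unbounded_of_one_lt _ (by exact_mod_cast hp.one_lt)
  have : NeZero (p ^ e) := ⟨pow_ne_zero _ hp.ne_zero⟩
  refine ⟨((matUnitsMod (p ^ e)).comp m).ker, inferInstance, Subgroup.finiteIndex_ker _,
    fun g => ⟨e, ?_⟩, fun h => ?_⟩
  · rw [MonoidHom.mem_ker, MonoidHom.comp_apply, map_pow]
    exact matUnitsMod_pow_eq_one _ (h1 g)
  · rw [MonoidHom.mem_ker, MonoidHom.comp_apply, matUnitsMod_eq_one_iff] at h
    exact hab (Int.eq_zero_of_abs_lt_dvd (h a b) (by exact_mod_cast he))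

end Residual

section Fox

variable {ι : Type*} [DecidableEq ι]

open MonoidAlgebra

/-- Left multiplication by a generator, recording the Fox derivatives. -/
noncomputable def foxPerm (i : ι) :
    Equiv.Perm (FreeGroup ι × (ι → MonoidAlgebra ℤ (FreeGroup ι))) where
  toFun x := (FreeGroup.of i * x.1, x.2 + Pi.single i (single x.1 1))
  invFun x := ((FreeGroup.of i)⁻¹ * x.1, x.2 - Pi.single i (single ((FreeGroup.of i)⁻¹ * x.1) 1))
  left_inv x := by simp
  right_inv x := by simp

/-- The Fox derivatives of an element of the free group. -/
noncomputable def foxGroup (g : FreeGroup ι) : ι → MonoidAlgebra ℤ (FreeGroup ι) :=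
  (FreeGroup.lift foxPerm g (1, 0)).2

theorem lift_foxPerm (g h : FreeGroup ι) (d : ι → MonoidAlgebra ℤ (FreeGroup ι)) :
    FreeGroup.lift foxPerm g (h, d) = (g * h, d + fun i => foxGroup g i * single h 1) := by
  have aux : ∀ g : FreeGroup ι, ∀ h d, FreeGroup.lift foxPerm g (h, d) =
      (g * h, d + fun i => foxGroup g i * single h 1) := by
    intro g
    induction g using FreeGroup.induction_on with
    | C1 =>
      intro h d
      simp [foxGroup]; rfl
    | of i =>
      intro h d
      simp only [foxGroup, FreeGroup.lift_apply_of]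
      simp only [foxPerm, Equiv.coe_fn_mk, Prod.mk.injEq, true_and, zero_add]
      congr 1
      ext1 j
      rcases eq_or_ne i j with rfl | hij
      · simp
      · simp [hij.symm]
    | inv_of i _ =>
      intro h d
      simp only [foxGroup, _root_.map_inv, FreeGroup.lift_apply_of]
      change (foxPerm i).symm _ = (_, _ + fun j => ((foxPerm i).symm (1, 0)).2 j * _)
      simp only [foxPerm, Equiv.coe_fn_symm_mk, Prod.mk.injEq, true_and, sub_eq_add_neg]
      congr 1
      ext1 j
      rcases eq_or_ne i j with rfl | hij
      · simp
      · simp [hij.symm]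
    | mul x y hx hy =>
      intro h d
      have h1 : foxGroup (x * y) = fun i => foxGroup y i + foxGroup x i * single y 1 := by
        rw [foxGroup, _root_.map_mul, Equiv.Perm.mul_apply, hy, hx]
        ext1 i
        simp [one_def.symm]
      rw [_root_.map_mul, Equiv.Perm.mul_apply, hy, hx, h1]
      ext1
      · simp [mul_assoc]
      · ext1 i
        simp [add_mul, mul_assoc, add_assoc]
  exact aux g h d

theorem foxGroup_mul (g h : FreeGroup ι) (i : ι) :
    foxGroup (g * h) i = foxGroup g i * single h 1 + foxGroup h i := by
  rw [foxGroup, _root_.map_mul, Equiv.Perm.mul_apply, lift_foxPerm, lift_foxPerm]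
  simp [one_def.symm, add_comm]

theorem foxGroup_of (i j : ι) :
    foxGroup (FreeGroup.of i) j = if i = j then 1 else 0 := by
  rw [foxGroup, FreeGroup.lift_apply_of]
  simp [foxPerm, Pi.single_apply, one_def, eq_comm]

/-- The Fox derivative with respect to a generator. -/
noncomputable def foxDeriv (i : ι) : MonoidAlgebra ℤ (FreeGroup ι) →+ MonoidAlgebra ℤ (FreeGroup ι) :=
  liftNC (Int.castAddHom _) fun g => foxGroup g i

/-- The augmentation of the group ring. -/
noncomputable def augm (G : Type*) [Group G] : MonoidAlgebra ℤ G →+* ℤ :=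
  liftNCRingHom (RingHom.id ℤ) (1 : G →* ℤ) fun _ _ => Commute.all _ _

theorem augm_single {G : Type*} [Group G] (g : G) (a : ℤ) : augm G (single g a) = a := by
  simp [augm]

theorem foxDeriv_single (i : ι) (g : FreeGroup ι) :
    foxDeriv i (single g 1) = foxGroup g i := by
  simp [foxDeriv]

theorem groupRing_induction {G : Type*} [Group G] {M : Type*} [AddGroup M]
    {f g : MonoidAlgebra ℤ G →+ M} (h : ∀ x, f (single x 1) = g (single x 1)) : f = g := by
  refine MonoidAlgebra.addMonoidHom_ext fun x n => ?_
  have : (single x n : MonoidAlgebra ℤ G) = n • single x 1 := by simp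
  rw [this, map_zsmul, map_zsmul, h]

theorem foxDeriv_mul (i : ι) (u v : MonoidAlgebra ℤ (FreeGroup ι)) :
    foxDeriv i (u * v) = foxDeriv i u * v + augm _ u • foxDeriv i v := by
  let L : MonoidAlgebra ℤ (FreeGroup ι) →+ MonoidAlgebra ℤ (FreeGroup ι) →+
      MonoidAlgebra ℤ (FreeGroup ι) :=
    AddMonoidHom.mk' (fun u => AddMonoidHom.mk' (fun v => foxDeriv i (u * v) -
      (foxDeriv i u * v + augm _ u • foxDeriv i v)) fun a b => by
        simp only [mul_add, map_add, smul_add]; abel)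
      fun a b => by
        refine AddMonoidHom.ext fun v => ?_
        simp only [AddMonoidHom.mk'_apply, AddMonoidHom.add_apply, add_mul, map_add, add_smul]
        abel
  have hL : L = 0 := by
    refine groupRing_induction fun g => groupRing_induction fun h => ?_
    simp [L, single_mul_single, foxDeriv_single, foxGroup_mul, augm_single]
  exact sub_eq_zero.1 (DFunLike.congr_fun (DFunLike.congr_fun hL u) v)

end Fox

section FoxFiltration

open MonoidAlgebra

/-- The element `g - 1` of the group ring. -/
noncomputable def grDelta {G : Type*} [Group G] (g : G) : MonoidAlgebra ℤ G := of ℤ G g - 1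

section Delta

variable {G : Type*} [Group G]

theorem grDelta_one : grDelta (1 : G) = 0 := by simp [grDelta, -of_apply]

theorem grDelta_mul (g h : G) :
    grDelta (g * h) = grDelta g + grDelta h + grDelta g * grDelta h := by
  simp only [grDelta, _root_.map_mul]; noncomm_ring

theorem augm_of (g : G) : augm G (of ℤ G g) = 1 := by
  rw [of_apply, augm_single]

theorem augm_grDelta (g : G) : augm G (grDelta g) = 0 := by
  rw [grDelta, map_sub, augm_of, _root_.map_one, sub_self]

theorem mapDomainRingHom_of {H : Type*} [Group H] (f : G →* H) (g : G) :
    mapDomainRingHom ℤ f (of ℤ G g) = of ℤ H (f g) := by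
  simp

theorem mapDomainRingHom_grDelta {H : Type*} [Group H] (f : G →* H) (g : G) :
    mapDomainRingHom ℤ f (grDelta g) = grDelta (f g) := by
  rw [grDelta, grDelta, map_sub, mapDomainRingHom_of, _root_.map_one]

theorem mapDomainRingHom_pow (f : MulAut G) (t : ℕ) :
    mapDomainRingHom ℤ f.toMonoidHom ^ t = mapDomainRingHom ℤ (f ^ t).toMonoidHom := by
  induction t with
  | zero => ext <;> simp
  | succ t ih =>
    rw [pow_succ, ih, pow_succ]
    ext <;> simp

end Delta

variable {ι : Type*} [DecidableEq ι]

/-- The filtration of the group ring of a free group by powers of the augmentation ideal. -/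
noncomputable def foxFilt (ι : Type*) [DecidableEq ι] : ℕ → AddSubgroup (MonoidAlgebra ℤ (FreeGroup ι))
  | 0 => ⊤
  | k + 1 => (augm (FreeGroup ι)).toAddMonoidHom.ker ⊓ ⨅ i, (foxFilt ι k).comap (foxDeriv i)

theorem mem_foxFilt_succ {k : ℕ} {v : MonoidAlgebra ℤ (FreeGroup ι)} :
    v ∈ foxFilt ι (k + 1) ↔ augm _ v = 0 ∧ ∀ i, foxDeriv i v ∈ foxFilt ι k := by
  simp [foxFilt, AddSubgroup.mem_inf, AddSubgroup.mem_iInf, AddMonoidHom.mem_ker]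

theorem mem_foxFilt_one {v : MonoidAlgebra ℤ (FreeGroup ι)} :
    v ∈ foxFilt ι 1 ↔ augm _ v = 0 := by
  simp [foxFilt]

theorem foxFilt_ringFiltration : RingFiltration (foxFilt ι) where
  mem_zero a := by simp [foxFilt]
  succ_le k := by
    induction k with
    | zero => simp [foxFilt]
    | succ k ih =>
      intro v hv
      rw [mem_foxFilt_succ] at hv ⊢
      exact ⟨hv.1, fun i => ih (hv.2 i)⟩
  mul_mem := by
    have hsucc : ∀ k, foxFilt ι (k + 1) ≤ foxFilt ι k := fun k => by
      induction k with
      | zero => simp [foxFilt]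
      | succ k ih =>
        intro v hv
        rw [mem_foxFilt_succ] at hv ⊢
        exact ⟨hv.1, fun i => ih (hv.2 i)⟩
    have hzero : ∀ j, ∀ a b, b ∈ foxFilt ι j → a * b ∈ foxFilt ι j := fun j => by
      induction j with
      | zero => simp [foxFilt]
      | succ j ih =>
        intro a b hb
        have hb' := mem_foxFilt_succ.1 hb
        refine mem_foxFilt_succ.2 ⟨by rw [_root_.map_mul, hb'.1, mul_zero], fun i => ?_⟩
        rw [foxDeriv_mul]
        exact add_mem (ih _ _ (hsucc j hb)) (zsmul_mem (hb'.2 i) _)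
    intro i
    induction i with
    | zero => intro j a b _ hb; rw [zero_add]; exact hzero j a b hb
    | succ i ih =>
      intro j a b ha hb
      rw [show i + 1 + j = i + j + 1 by ring]
      rw [mem_foxFilt_succ] at ha ⊢
      refine ⟨by rw [_root_.map_mul, ha.1, zero_mul], fun l => ?_⟩
      rw [foxDeriv_mul, ha.1, zero_smul, add_zero]
      exact ih (ha.2 l) hb

theorem grDelta_mem (g : FreeGroup ι) : grDelta g ∈ foxFilt ι 1 :=
  mem_foxFilt_one.2 (augm_grDelta g)

theorem grDelta_mul_cong (g h : FreeGroup ι) :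
    FCong (foxFilt ι) 2 (grDelta (g * h)) (grDelta g + grDelta h) := by
  rw [grDelta_mul, FCong, add_sub_cancel_left]
  exact foxFilt_ringFiltration.mul_mem (grDelta_mem g) (grDelta_mem h)

theorem grDelta_inv_cong (g : FreeGroup ι) :
    FCong (foxFilt ι) 2 (grDelta g⁻¹) (-grDelta g) := by
  have := grDelta_mul_cong g g⁻¹
  rw [mul_inv_cancel, grDelta_one] at this
  have h2 := this.symm.sub (FCong.rfl' (a := grDelta g))
  simpa using h2

theorem grDelta_conj_cong (g h : FreeGroup ι) :
    FCong (foxFilt ι) 2 (grDelta (g * h * g⁻¹)) (grDelta h) := by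
  refine (grDelta_mul_cong _ _).trans (((grDelta_mul_cong _ _).add (grDelta_inv_cong _)).trans
    (FCong.of_eq ?_))
  abel

theorem grDelta_cong_of_isConj {g h : FreeGroup ι} (hc : IsConj g h) :
    FCong (foxFilt ι) 2 (grDelta g) (grDelta h) := by
  obtain ⟨c, rfl⟩ := isConj_iff.1 hc
  exact (grDelta_conj_cong c g).symm

theorem foxDeriv_grDelta_of (i j : ι) :
    foxDeriv i (grDelta (FreeGroup.of j)) = if j = i then 1 else 0 := by
  have h0 : foxDeriv i (1 : MonoidAlgebra ℤ (FreeGroup ι)) = 0 := by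
    have := foxDeriv_mul i 1 1
    simpa using this
  rw [grDelta, map_sub, h0, sub_zero, of_apply, foxDeriv_single, foxGroup_of]

theorem foxFilt_intCast (v : MonoidAlgebra ℤ (FreeGroup ι)) :
    ∃ a : ℤ, FCong (foxFilt ι) 1 v a :=
  ⟨augm _ v, mem_foxFilt_one.2 (by simp)⟩

theorem eq_zero_of_intCast_mem_foxFilt {a : ℤ}
    (h : (a : MonoidAlgebra ℤ (FreeGroup ι)) ∈ foxFilt ι 1) : a = 0 := by
  simpa using mem_foxFilt_one.1 h

variable [Fintype ι]

theorem grDelta_eq_sum (g : FreeGroup ι) :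
    grDelta g = ∑ i, grDelta (FreeGroup.of i) * foxGroup g i := by
  have hmul : ∀ g h : FreeGroup ι, grDelta g = ∑ i, grDelta (FreeGroup.of i) * foxGroup g i →
      grDelta h = ∑ i, grDelta (FreeGroup.of i) * foxGroup h i →
      grDelta (g * h) = ∑ i, grDelta (FreeGroup.of i) * foxGroup (g * h) i := by
    intro g h hg hh
    simp only [foxGroup_mul, mul_add, Finset.sum_add_distrib, ← mul_assoc, ← Finset.sum_mul]
    rw [← hg, ← hh, ← of_apply, grDelta_mul]
    simp only [grDelta]; noncomm_ring
  have hone : ∀ i, foxGroup (1 : FreeGroup ι) i = 0 := fun i => by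
    have := foxGroup_mul (1 : FreeGroup ι) 1 i
    rw [← one_def] at this
    simpa using this
  induction g using FreeGroup.induction_on with
  | C1 => simp [grDelta_one, hone]
  | of i => simp [foxGroup_of]
  | inv_of i hi =>
    have h1 : ∀ j, foxGroup (FreeGroup.of i)⁻¹ j =
        -(foxGroup (FreeGroup.of i) j * of ℤ _ (FreeGroup.of i)⁻¹) := fun j => by
      have := foxGroup_mul (FreeGroup.of i) (FreeGroup.of i)⁻¹ j
      rw [mul_inv_cancel, hone] at this
      rw [of_apply, ← sub_eq_zero, sub_neg_eq_add, add_comm, ← this]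
    simp only [h1, mul_neg, ← mul_assoc, Finset.sum_neg_distrib, ← Finset.sum_mul]
    rw [show ∑ j, grDelta (FreeGroup.of j) * foxGroup (FreeGroup.of i) j =
      grDelta (FreeGroup.of i) from hi.symm]
    simp only [grDelta, sub_mul, ← _root_.map_mul, mul_inv_cancel]
    simp [-of_apply]
  | mul x y hx hy => exact hmul x y hx hy

theorem eq_augm_add_sum (v : MonoidAlgebra ℤ (FreeGroup ι)) :
    v = augm _ v + ∑ i, grDelta (FreeGroup.of i) * foxDeriv i v := by
  have : AddMonoidHom.id (MonoidAlgebra ℤ (FreeGroup ι)) =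
      (Int.castAddHom _).comp (augm (FreeGroup ι)).toAddMonoidHom +
        ∑ i, (AddMonoidHom.mulLeft (grDelta (FreeGroup.of i))).comp (foxDeriv i) := by
    refine groupRing_induction fun x => ?_
    simp only [AddMonoidHom.id_apply, AddMonoidHom.add_apply, AddMonoidHom.comp_apply,
      AddMonoidHom.finsetSum_apply, AddMonoidHom.coe_mulLeft, foxDeriv_single]
    rw [← grDelta_eq_sum]
    simp [grDelta, augm_single]
  have h := DFunLike.congr_fun this v
  simpa [AddMonoidHom.finsetSum_apply] using h

theorem exists_eq_sum_of_mem_foxFilt {k : ℕ} {v : MonoidAlgebra ℤ (FreeGroup ι)}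
    (hv : v ∈ foxFilt ι (k + 1)) : ∃ u : ι → MonoidAlgebra ℤ (FreeGroup ι),
    (∀ i, u i ∈ foxFilt ι k) ∧ v = ∑ i, grDelta (FreeGroup.of i) * u i := by
  rw [mem_foxFilt_succ] at hv
  refine ⟨fun i => foxDeriv i v, hv.2, ?_⟩
  have := eq_augm_add_sum v
  rwa [hv.1, Int.cast_zero, zero_add] at this

theorem mem_foxFilt_of_sum_mem {k : ℕ} {u : ι → MonoidAlgebra ℤ (FreeGroup ι)}
    (h : ∑ i, grDelta (FreeGroup.of i) * u i ∈ foxFilt ι (k + 1)) (j : ι) : u j ∈ foxFilt ι k := by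
  have := (mem_foxFilt_succ.1 h).2 j
  rw [map_sum] at this
  simpa [foxDeriv_mul, foxDeriv_grDelta_of, augm_grDelta] using this

theorem map_mem_foxFilt {κ : Type*} [DecidableEq κ] (f : FreeGroup ι →* FreeGroup κ) {k : ℕ} :
    ∀ {v : MonoidAlgebra ℤ (FreeGroup ι)}, v ∈ foxFilt ι k →
      mapDomainRingHom ℤ f v ∈ foxFilt κ k := by
  induction k with
  | zero => simp [foxFilt]
  | succ k ih =>
    intro v hv
    obtain ⟨u, hu, rfl⟩ := exists_eq_sum_of_mem_foxFilt hv
    rw [map_sum]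
    refine sum_mem fun i _ => ?_
    rw [_root_.map_mul, mapDomainRingHom_grDelta, add_comm k 1]
    exact foxFilt_ringFiltration.mul_mem (grDelta_mem _) (ih (hu i))

theorem permutedGens_of_isConj {f : MulAut (FreeGroup ι)} {s : Equiv.Perm ι}
    (hf : ∀ i, IsConj (f (FreeGroup.of i)) (FreeGroup.of (s i))) :
    PermutedGens (foxFilt ι) (mapDomainRingHom ℤ f.toMonoidHom) s
      fun i => grDelta (FreeGroup.of i) where
  toRingFiltration := foxFilt_ringFiltration
  map_mem := map_mem_foxFilt _
  gen_mem i := grDelta_mem _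
  map_gen i := by
    rw [mapDomainRingHom_grDelta]
    exact grDelta_cong_of_isConj (hf i)
  exists_eq_sum := exists_eq_sum_of_mem_foxFilt

end FoxFiltration

section Norms

open MonoidAlgebra

/-- The additive extension of a function on a group to the group ring. -/
noncomputable def groupRingPair {G M : Type*} [Group G] [Ring M] (f : G → M) :
    MonoidAlgebra ℤ G →+ M :=
  liftNC (Int.castAddHom M) f

section Pair

variable {G M : Type*} [Group G] [Ring M]

theorem groupRingPair_of (f : G → M) (g : G) : groupRingPair f (of ℤ G g) = f g := by
  simp [groupRingPair]

theorem groupRingPair_of_mul (f : G → M) (g : G) (v : MonoidAlgebra ℤ G) :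
    groupRingPair f (of ℤ G g * v) = groupRingPair (fun x => f (g * x)) v := by
  have : (groupRingPair f).comp (AddMonoidHom.mulLeft (of ℤ G g)) =
      groupRingPair fun x => f (g * x) := by
    refine groupRing_induction fun x => ?_
    simp [groupRingPair, single_mul_single]
  exact DFunLike.congr_fun this v

theorem groupRingPair_mapDomain (f : G → M) (φ : G →* G) (v : MonoidAlgebra ℤ G) :
    groupRingPair f (mapDomainRingHom ℤ φ v) = groupRingPair (fun x => f (φ x)) v := by
  have : (groupRingPair f).comp (mapDomainRingHom ℤ φ).toAddMonoidHom =
      groupRingPair fun x => f (φ x) := by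
    refine groupRing_induction fun x => ?_
    simp [groupRingPair]
  exact DFunLike.congr_fun this v

theorem groupRingPair_sub (f g : G → M) (v : MonoidAlgebra ℤ G) :
    groupRingPair (f - g) v = groupRingPair f v - groupRingPair g v := by
  have : groupRingPair (f - g) = groupRingPair f - groupRingPair g := by
    refine groupRing_induction fun x => ?_
    simp [groupRingPair]
  exact DFunLike.congr_fun this v

end Pair

variable {ι : Type*} [DecidableEq ι] [Fintype ι]

theorem groupRingPair_eq_zero_of_mem_upperCentralSeries {Q : Type*} [Group Q] {p : ℕ}
    (π : FreeGroup ι →* Q) (m : ℕ) : ∀ f : Q → Multiplicative (ZMod p),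
    (⟨f, 1⟩ : RegularWreathProduct (Multiplicative (ZMod p)) Q) ∈
      Subgroup.upperCentralSeries _ m → ∀ v ∈ foxFilt ι m,
      groupRingPair (fun x => (f (π x)).toAdd) v = 0 := by
  induction m with
  | zero =>
    intro f hf v _
    have h1 : f = 1 := congrArg RegularWreathProduct.left
      (Subgroup.mem_bot.1 (by simpa using hf))
    have h2 : groupRingPair (M := ZMod p)
        (fun x : FreeGroup ι => ((1 : Q → Multiplicative (ZMod p)) (π x)).toAdd) = 0 := by
      refine groupRing_induction fun x => ?_
      simp [groupRingPair]
    rw [h1, h2]; rfl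
  | succ m ih =>
    intro f hf v hv
    obtain ⟨u, hu, rfl⟩ := exists_eq_sum_of_mem_foxFilt hv
    rw [map_sum]
    refine Finset.sum_eq_zero fun i _ => ?_
    have h1 := ih _ (by
      have := Subgroup.mem_upperCentralSeries_succ_iff.1 hf ⟨1, (π (FreeGroup.of i))⁻¹⟩
      rw [commutatorElement_def, show (⟨f, 1⟩ : RegularWreathProduct (Multiplicative (ZMod p)) Q) *
        ⟨1, (π (FreeGroup.of i))⁻¹⟩ * (⟨f, 1⟩)⁻¹ * (⟨1, (π (FreeGroup.of i))⁻¹⟩)⁻¹ =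
        ⟨fun x => f x * (f (π (FreeGroup.of i) * x))⁻¹, 1⟩ by ext <;> simp] at this
      exact this) (u i) (hu i)
    rw [grDelta, sub_mul, one_mul, map_sub, groupRingPair_of_mul, sub_eq_zero]
    symm
    rw [← sub_eq_zero, ← groupRingPair_sub, ← h1]
    congr 2
    ext x
    simp [sub_eq_add_neg]

theorem FreeGroup.not_forall_exists_norm {p : ℕ} (hp : p.Prime) {φ : MulAut (FreeGroup ι)}
    (hφ : φ ^ p = 1) {w : FreeGroup ι} (hw : w ≠ 1) :
    ¬ ∀ k, ∃ u, FCong (foxFilt ι) (k + 1) (grDelta w)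
      (ringNorm (mapDomainRingHom ℤ φ.toMonoidHom) p u) := by
  classical
  intro hnorm
  obtain ⟨U, hUn, hUf, hUp, hwU⟩ := FreeGroup.exists_normal_finiteIndex_pow_mem hp hw
  have := Fact.mk hp
  let U' : Subgroup (FreeGroup ι) := ⨅ t : Fin p, U.comap (φ ^ (t : ℕ)).toMonoidHom
  have hU' : ∀ {x}, x ∈ U' ↔ ∀ t : ℕ, (φ ^ t) x ∈ U := fun {x} => by
    simp only [U', Subgroup.mem_iInf, Subgroup.mem_comap]
    refine ⟨fun h t => ?_, fun h t => h t⟩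
    rw [pow_eq_pow_mod t hφ]
    exact h ⟨t % p, Nat.mod_lt _ hp.pos⟩
  have : U'.Normal := Subgroup.normal_iInf_normal fun t => hUn.comap _
  have : U'.FiniteIndex := Subgroup.finiteIndex_iInf fun t =>
    ⟨by rw [Subgroup.index_comap]; exact Subgroup.FiniteIndex.index_ne_zero (H := U.subgroupOf _)⟩
  have hφU : ∀ x, φ x ∈ U' ↔ x ∈ U' := fun x => by
    rw [hU', hU']
    refine ⟨fun h t => ?_, fun h t => ?_⟩
    · have := h (t + (p - 1))
      rw [← MulAut.mul_apply, ← pow_succ, show t + (p - 1) + 1 = t + p by have := hp.pos; omega,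
        pow_add, hφ, mul_one] at this
      exact this
    · rw [← MulAut.mul_apply, ← pow_succ]; exact h _
  have hQ : IsPGroup p (FreeGroup ι ⧸ U') := by
    intro g
    induction g using QuotientGroup.induction_on with
    | H g =>
      choose k hk using fun t : Fin p => hUp ((φ ^ (t : ℕ)) g)
      refine ⟨∑ t, k t, ?_⟩
      rw [← QuotientGroup.mk_pow, QuotientGroup.eq_one_iff]
      simp only [U', Subgroup.mem_iInf, Subgroup.mem_comap]
      intro t
      obtain ⟨c, hc⟩ := pow_dvd_pow p (Finset.single_le_sum (f := k) (fun _ _ => Nat.zero_le _)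
        (Finset.mem_univ t))
      rw [hc, pow_mul]
      have := U.pow_mem (hk t) c
      simpa using this
  have : Finite (FreeGroup ι ⧸ U') := inferInstance
  obtain ⟨a, ha⟩ := IsPGroup.iff_card.1 hQ
  have hW : IsPGroup p (RegularWreathProduct (Multiplicative (ZMod p)) (FreeGroup ι ⧸ U')) := by
    refine IsPGroup.of_card (n := p ^ a + a) ?_
    rw [RegularWreathProduct.card, ha, pow_add]
    simp
  have := hW.isNilpotent
  obtain ⟨k, hk⟩ := Group.IsNilpotent.nilpotent
    (RegularWreathProduct (Multiplicative (ZMod p)) (FreeGroup ι ⧸ U'))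
  obtain ⟨u, hu⟩ := hnorm k
  let f : FreeGroup ι ⧸ U' → Multiplicative (ZMod p) := fun x =>
    if x = 1 then Multiplicative.ofAdd 1 else 1
  have hf := groupRingPair_eq_zero_of_mem_upperCentralSeries (QuotientGroup.mk' U') k f
    (hk ▸ Subgroup.mem_top _) _ (foxFilt_ringFiltration.succ_le k hu)
  have hfφ : ∀ x, f (QuotientGroup.mk' U' (φ x)) = f (QuotientGroup.mk' U' x) := fun x => by
    simp only [f, QuotientGroup.mk'_apply, QuotientGroup.eq_one_iff, hφU]
  have hinv : ∀ t v, groupRingPair (fun x => (f (QuotientGroup.mk' U' x)).toAdd)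
      ((mapDomainRingHom ℤ φ.toMonoidHom ^ t) v) =
      groupRingPair (fun x => (f (QuotientGroup.mk' U' x)).toAdd) v := fun t v => by
    induction t with
    | zero => simp
    | succ t ih =>
      rw [ringHom_pow_succ_apply, groupRingPair_mapDomain]
      refine Eq.trans ?_ ih
      congr 2
      ext x
      exact congrArg _ (hfφ x)
  rw [map_sub, ringNorm, map_sum] at hf
  simp only [hinv, Finset.sum_const, Finset.card_range, nsmul_eq_mul, CharP.cast_eq_zero,
    zero_mul, sub_zero] at hf
  have hw' : w ∉ U' := fun h => hwU (by simpa using hU'.1 h 0)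
  rw [grDelta, map_sub, groupRingPair_of, ← _root_.map_one (MonoidAlgebra.of ℤ (FreeGroup ι)),
    groupRingPair_of] at hf
  simp [f, hw'] at hf

end Norms

section FixedPoints

open MonoidAlgebra

variable {ι : Type*} [DecidableEq ι] [Fintype ι]

theorem mapDomainRingHom_pow_eq_one {G : Type*} [Group G] {φ : MulAut G} {p : ℕ} (hφ : φ ^ p = 1) :
    mapDomainRingHom ℤ φ.toMonoidHom ^ p = 1 := by
  rw [mapDomainRingHom_pow, hφ]
  ext <;> simp

/-- An automorphism of prime order of a free group that permutes the conjugacy classes of a basis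
without fixed points has no nontrivial fixed points. -/
theorem FreeGroup.eq_one_of_map_eq_self {p : ℕ} (hp : p.Prime) {φ : MulAut (FreeGroup ι)}
    {s : Equiv.Perm ι} (hφ : φ ^ p = 1) (hs : s ^ p = 1) (hfix : ∀ i, s i ≠ i)
    (hconj : ∀ i, IsConj (φ (FreeGroup.of i)) (FreeGroup.of (s i))) {w : FreeGroup ι}
    (hw : φ w = w) : w = 1 := by
  by_contra hw1
  obtain ⟨T, hT⟩ := exists_isTransversal hp hs hfix
  refine FreeGroup.not_forall_exists_norm hp hφ hw1 fun k =>
    (permutedGens_of_isConj hconj).exists_norm_of_invariant hT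
      (fun k u hu i => mem_foxFilt_of_sum_mem hu i) (mapDomainRingHom_pow_eq_one hφ)
      (grDelta_mem w) ?_ k
  rw [mapDomainRingHom_grDelta]
  exact congrArg _ hw

omit [Fintype ι] in
theorem grDelta_listProd_cong (l : List (FreeGroup ι)) :
    FCong (foxFilt ι) 2 (grDelta l.prod) (l.map grDelta).sum := by
  induction l with
  | nil => exact FCong.of_eq (by simp [grDelta_one])
  | cons a l ih =>
    rw [List.prod_cons, List.map_cons, List.sum_cons]
    exact (grDelta_mul_cong _ _).trans (FCong.rfl'.add ih)

/-- The product `g * φ g * ⋯ * φ ^ (t - 1) g`. -/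
def orbitProd {G : Type*} [Group G] (φ : MulAut G) (g : G) : ℕ → G
  | 0 => 1
  | t + 1 => orbitProd φ g t * (φ ^ t) g

theorem mul_map_orbitProd {G : Type*} [Group G] (φ : MulAut G) (g : G) (t : ℕ) :
    g * φ (orbitProd φ g t) = orbitProd φ g t * (φ ^ t) g := by
  induction t with
  | zero => simp [orbitProd]
  | succ t ih =>
    rw [orbitProd, _root_.map_mul, ← mul_assoc, ih, pow_succ' φ t, MulAut.mul_apply]

omit [Fintype ι] in
theorem grDelta_orbitProd_cong {φ : MulAut (FreeGroup ι)} {h : FreeGroup ι}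
    {e : ℕ → MonoidAlgebra ℤ (FreeGroup ι)}
    (he : ∀ t, FCong (foxFilt ι) 2 (grDelta ((φ ^ t) h)) (e t)) (m : ℕ) :
    FCong (foxFilt ι) 2 (grDelta (orbitProd φ h m)) (∑ t ∈ Finset.range m, e t) ∧
    FCong (foxFilt ι) 3 (grDelta (orbitProd φ h m))
      (ringNorm (mapDomainRingHom ℤ φ.toMonoidHom) m (grDelta h) +
        ∑ t ∈ Finset.range m, (∑ u ∈ Finset.range t, e u) * e t) := by
  have hF := foxFilt_ringFiltration (ι := ι)
  have he1 : ∀ t, e t ∈ foxFilt ι 1 := fun t =>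
    ((he t).symm.of_le hF (by norm_num)).mem (grDelta_mem _)
  induction m with
  | zero => exact ⟨FCong.of_eq (by simp [orbitProd, grDelta_one]),
      FCong.of_eq (by simp [orbitProd, grDelta_one, ringNorm])⟩
  | succ m ih =>
    rw [orbitProd, Finset.sum_range_succ, Finset.sum_range_succ]
    refine ⟨(grDelta_mul_cong _ _).trans (ih.1.add (he m)), ?_⟩
    rw [grDelta_mul]
    have h1 : FCong (foxFilt ι) 3 (grDelta (orbitProd φ h m) * grDelta ((φ ^ m) h))
        ((∑ t ∈ Finset.range m, e t) * e m) :=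
      (ih.1.mul_right hF (grDelta_mem _)).trans ((he m).mul_left (i := 1) hF (sum_mem fun t _ => he1 t))
    refine ((ih.2.add FCong.rfl').add h1).trans (FCong.of_eq ?_)
    have h2 : grDelta ((φ ^ m) h) = (mapDomainRingHom ℤ φ.toMonoidHom ^ m) (grDelta h) := by
      rw [mapDomainRingHom_pow, mapDomainRingHom_grDelta]; rfl
    rw [h2, ringNorm, ringNorm, Finset.sum_range_succ]
    abel

theorem sum_range_sq_eq {A : Type*} [Ring A] (e : ℕ → A) (m : ℕ) :
    (∑ t ∈ Finset.range m, e t) * ∑ t ∈ Finset.range m, e t =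
      ∑ t ∈ Finset.range m, e t * ∑ u ∈ Finset.range t, e u +
      ∑ t ∈ Finset.range m, (∑ u ∈ Finset.range t, e u) * e t + ∑ t ∈ Finset.range m, e t * e t := by
  induction m with
  | zero => simp
  | succ m ih =>
    simp only [Finset.sum_range_succ, add_mul, mul_add]
    rw [ih]
    abel

variable {n : ℕ}

theorem permutedGens_quotient {q : FreeGroup (Fin (n + 1)) →* FreeGroup (Fin n)}
    (hq : ∀ i : Fin n, q (FreeGroup.of i.castSucc) = FreeGroup.of i)
    {φ : MulAut (FreeGroup (Fin (n + 1)))} {ψ : MulAut (FreeGroup (Fin n))}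
    (hψ : ∀ f, q (φ f) = ψ (q f)) {s : Equiv.Perm (Fin (n + 1))}
    (hconj : ∀ i, IsConj (φ (FreeGroup.of i)) (FreeGroup.of (s i))) :
    PermutedGens (foxFilt (Fin n)) (mapDomainRingHom ℤ ψ.toMonoidHom) s
      fun i => grDelta (q (FreeGroup.of i)) where
  toRingFiltration := foxFilt_ringFiltration
  map_mem := map_mem_foxFilt _
  gen_mem i := grDelta_mem _
  map_gen i := by
    rw [mapDomainRingHom_grDelta]
    refine grDelta_cong_of_isConj ?_
    have := q.map_isConj (hconj i)
    rwa [hψ] at this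
  exists_eq_sum hv := by
    obtain ⟨u, hu, h⟩ := exists_eq_sum_of_mem_foxFilt hv
    refine ⟨Fin.snoc u 0, fun i => ?_, ?_⟩
    · refine Fin.lastCases ?_ (fun i => ?_) i
      · simp
      · simpa using hu i
    · rw [Fin.sum_univ_castSucc]
      simpa [hq] using h

/-- The analogue of `FreeGroup.eq_one_of_map_eq_self` for the quotient of a free group by the
product `c` of its basis elements, when `φ ^ p` is conjugation by `c`. -/
theorem FreeGroup.eq_one_of_map_eq_self_of_quotient {p : ℕ} (hp : p.Prime)
    {q : FreeGroup (Fin (n + 1)) →* FreeGroup (Fin n)}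
    (hq : ∀ i : Fin n, q (FreeGroup.of i.castSucc) = FreeGroup.of i)
    {c : FreeGroup (Fin (n + 1))} (hqc : q c = 1)
    (hc : FCong (foxFilt (Fin (n + 1))) 2 (grDelta c) (∑ i, grDelta (FreeGroup.of i)))
    {φ : MulAut (FreeGroup (Fin (n + 1)))} {ψ : MulAut (FreeGroup (Fin n))}
    (hψ : ∀ f, q (φ f) = ψ (q f)) {s : Equiv.Perm (Fin (n + 1))} (hs : s ^ p = 1)
    (hfix : ∀ i, s i ≠ i) (hφc : φ c = c) (hφp : ∀ f, (φ ^ p) f = c⁻¹ * f * c)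
    (hconj : ∀ i, IsConj (φ (FreeGroup.of i)) (FreeGroup.of (s i))) {w : FreeGroup (Fin n)}
    (hw : ψ w = w) : w = 1 := by
  by_contra hw1
  obtain ⟨T, hT⟩ := exists_isTransversal hp hs hfix
  have hF := foxFilt_ringFiltration (ι := Fin n)
  have hF' := foxFilt_ringFiltration (ι := Fin (n + 1))
  have hψt : ∀ t f, q ((φ ^ t) f) = (ψ ^ t) (q f) := fun t f => by
    induction t with
    | zero => rfl
    | succ t ih => rw [pow_succ', pow_succ', MulAut.mul_apply, MulAut.mul_apply, hψ, ih]
  have hqs : Function.Surjective q := by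
    let r : FreeGroup (Fin n) →* FreeGroup (Fin (n + 1)) :=
      FreeGroup.lift fun i => FreeGroup.of i.castSucc
    have h1 : q.comp r = MonoidHom.id _ := by ext i; simp [r, hq]
    exact fun x => ⟨r x, DFunLike.congr_fun h1 x⟩
  have hψp : ψ ^ p = 1 := by
    ext x
    obtain ⟨f, rfl⟩ := hqs x
    rw [← hψt, hφp]
    simp [hqc]
  have hP := permutedGens_quotient hq hψ hconj
  have hP' := permutedGens_of_isConj hconj
  set E : Fin (n + 1) → MonoidAlgebra ℤ (FreeGroup (Fin n)) :=
    fun i => grDelta (q (FreeGroup.of i)) with hEdef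
  set Φ := mapDomainRingHom ℤ φ.toMonoidHom with hΦ
  set Ψ := mapDomainRingHom ℤ ψ.toMonoidHom with hΨ
  let Q := mapDomainRingHom ℤ q
  have hE : ∑ i, E i ∈ foxFilt (Fin n) 2 := by
    have h1 := map_mem_foxFilt q hc
    rw [map_sub, mapDomainRingHom_grDelta, hqc, grDelta_one, map_sum, zero_sub, neg_mem_iff] at h1
    simpa only [mapDomainRingHom_grDelta] using h1
  have hind : ∀ k, ∀ u : Fin (n + 1) → MonoidAlgebra ℤ (FreeGroup (Fin n)),
      (∀ i, u i ∈ foxFilt (Fin n) k) → ∑ i, E i * u i ∈ foxFilt (Fin n) (k + 2) →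
      ∀ i j, FCong (foxFilt (Fin n)) (k + 1) (u i) (u j) := by
    intro k u hu h
    have h1 : ∑ i, grDelta (FreeGroup.of i) * (u (Fin.castSucc i) - u (Fin.last n)) ∈
        foxFilt (Fin n) (k + 1 + 1) := by
      have h2 := hF.mul_mem hE (hu (Fin.last n))
      rw [add_comm 2 k] at h2
      have h3 := sub_mem h h2
      rw [Fin.sum_univ_castSucc, Fin.sum_univ_castSucc, add_mul, add_sub_add_right_eq_sub,
        Finset.sum_mul, ← Finset.sum_sub_distrib] at h3
      simpa only [hEdef, hq, ← mul_sub] using h3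
    have h4 : ∀ i, FCong (foxFilt (Fin n)) (k + 1) (u i) (u (Fin.last n)) := fun i => by
      refine Fin.lastCases FCong.rfl' (fun i => ?_) i
      exact mem_foxFilt_of_sum_mem h1 i
    exact fun i j => (h4 i).trans (h4 j).symm
  let g : FreeGroup (Fin (n + 1)) := (T.toList.map FreeGroup.of).prod
  have hg : ∀ t, FCong (foxFilt _) 2 (grDelta ((φ ^ t) g))
      (PermutedGens.transSum s (fun i => grDelta (FreeGroup.of i)) T t) := fun t => by
    have h1 : FCong (foxFilt _) 2 (grDelta g)
        (PermutedGens.transSum s (fun i => grDelta (FreeGroup.of i)) T 0) := by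
      refine (grDelta_listProd_cong _).trans (FCong.of_eq ?_)
      simp [PermutedGens.transSum]
    have h2 : grDelta ((φ ^ t) g) = (Φ ^ t) (grDelta g) := by
      rw [hΦ, mapDomainRingHom_pow, mapDomainRingHom_grDelta]; rfl
    rw [h2]
    exact (hP'.map_cong t h1).trans (hP'.pow_map_transSum T t)
  let V := orbitProd φ g p * c⁻¹
  have hV2 : grDelta V ∈ foxFilt (Fin (n + 1)) 2 := by
    have h1 := (grDelta_mul_cong (orbitProd φ g p) c⁻¹).trans
      ((grDelta_orbitProd_cong hg p).1.add ((grDelta_inv_cong c).trans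
        ((FCong.rfl' (a := 0)).sub hc |>.trans (FCong.of_eq (zero_sub _)) |> fun h =>
          (FCong.of_eq (zero_sub _).symm).trans h)))
    refine h1.mem ?_
    rw [hT.sum_eq (fun i => grDelta (FreeGroup.of i)), Finset.sum_comm]
    simp [PermutedGens.transSum]
  have hφV : φ V = g⁻¹ * V * g := by
    have h1 : φ (orbitProd φ g p) = g⁻¹ * (orbitProd φ g p * (c⁻¹ * g * c)) := by
      rw [← hφp, ← mul_map_orbitProd]; group
    simp only [V, _root_.map_mul, _root_.map_inv, h1, hφc]
    group
  have hφV3 : FCong (foxFilt (Fin (n + 1))) 3 (Φ (grDelta V)) (grDelta V) := by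
    have h1 : Φ (grDelta V) = (grDelta g⁻¹ + 1) * grDelta V * (grDelta g + 1) := by
      rw [hΦ, mapDomainRingHom_grDelta, show φ.toMonoidHom V = g⁻¹ * V * g from hφV]
      simp only [grDelta, _root_.map_mul, sub_add_cancel]
      rw [mul_sub, sub_mul, mul_one, ← _root_.map_mul, ← _root_.map_mul, ← _root_.map_mul,
        inv_mul_cancel, _root_.map_one]
    have h2 := hF'.mul_mem (grDelta_mem g⁻¹) hV2
    have h3 := hF'.mul_mem (add_mem (hF'.le (by norm_num) h2) hV2) (grDelta_mem g)
    rw [h1, FCong]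
    have h4 : (grDelta g⁻¹ + 1) * grDelta V * (grDelta g + 1) - grDelta V =
        (grDelta g⁻¹ * grDelta V + grDelta V) * grDelta g + grDelta g⁻¹ * grDelta V := by
      noncomm_ring
    rw [h4]
    exact add_mem h3 h2
  obtain ⟨ξ, -, hξ⟩ := hP'.exists_norm_of_indep (k := 1) hT
    (fun u hu i => mem_foxFilt_of_sum_mem hu i) hV2 hφV3
  have hQ : ∀ t x, Q ((Φ ^ t) x) = (Ψ ^ t) (Q x) := fun t x => by
    have : (Q.comp (Φ ^ t)).toAddMonoidHom = ((Ψ ^ t).comp Q).toAddMonoidHom := by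
      refine groupRing_induction fun x => ?_
      rw [hΦ, hΨ, mapDomainRingHom_pow, mapDomainRingHom_pow]
      simpa [Q] using congrArg (fun y => single y (1 : ℤ)) (hψt t x)
    exact DFunLike.congr_fun this x
  have hq3 : FCong (foxFilt (Fin n)) 3 (grDelta (orbitProd ψ (q g) p)) (ringNorm Ψ p (Q ξ)) := by
    have h1 := map_mem_foxFilt q hξ
    have h2 : ∀ t, q (orbitProd φ g t) = orbitProd ψ (q g) t := fun t => by
      induction t with
      | zero => exact _root_.map_one q
      | succ t ih => rw [orbitProd, orbitProd, _root_.map_mul, ih, hψt]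
    rw [map_sub, mapDomainRingHom_grDelta, ringNorm, map_sum] at h1
    simp only [V, _root_.map_mul, _root_.map_inv, hqc, inv_one, mul_one, h2] at h1
    refine FCong.trans (F := foxFilt (Fin n)) (k := 3) h1 (FCong.of_eq ?_)
    exact Finset.sum_congr rfl fun t _ => hQ t ξ
  have he : ∀ t, FCong (foxFilt (Fin n)) 2 (grDelta ((ψ ^ t) (q g)))
      (PermutedGens.transSum s E T t) := fun t => by
    have h1 := map_mem_foxFilt q (hg t)
    rw [map_sub, mapDomainRingHom_grDelta, hψt] at h1
    refine FCong.trans (F := foxFilt (Fin n)) (k := 2) h1 (FCong.of_eq ?_)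
    simp only [PermutedGens.transSum, map_sum, mapDomainRingHom_grDelta, hEdef]
  have hprod := (grDelta_orbitProd_cong he p).2
  have hsum : ∑ t ∈ Finset.range p, PermutedGens.transSum s E T t ∈ foxFilt (Fin n) 2 := by
    rw [hT.sum_eq E, Finset.sum_comm] at hE
    exact hE
  have hsq := hF.le (show 3 ≤ 2 + 2 by norm_num) (hF.mul_mem hsum hsum)
  rw [sum_range_sq_eq] at hsq
  have hsq' : FCong (foxFilt (Fin n)) 3
      (∑ t ∈ Finset.range p, PermutedGens.transSum s E T t * PermutedGens.transSum s E T t)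
      (ringNorm Ψ p (PermutedGens.transSum s E T 0 * PermutedGens.transSum s E T 0)) := by
    refine FCong.sum fun t _ => ?_
    rw [_root_.map_mul]
    have h1 := hP.pow_map_transSum T t
    exact ((h1.mul_right hF (hP.pow_map_mem t (hP.transSum_mem T 0))).trans
      (h1.mul_left (i := 1) hF (hP.transSum_mem T t))).symm
  refine FreeGroup.not_forall_exists_norm hp hψp hw1 fun k =>
    hP.exists_norm_of_invariant_of_periodic hp.ne_zero hT (mapDomainRingHom_pow_eq_one hψp) hs
      hind hE foxFilt_intCast (fun a => eq_zero_of_intCast_mem_foxFilt)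
      (ε := grDelta (q g) - Q ξ - PermutedGens.transSum s E T 0 * PermutedGens.transSum s E T 0)
      ?_ (grDelta_mem w) (by rw [hΨ, mapDomainRingHom_grDelta]; exact congrArg _ hw) k
  rw [ringNorm_sub, ringNorm_sub]
  have h1 := ((FCong.of_mem hsq).sub (hprod.symm.trans hq3)).sub hsq'
  have h2 := h1.add (FCong.rfl' (a := ringNorm Ψ p (grDelta (q g))))
  refine (FCong.of_eq ?_).trans (h2.trans (FCong.of_eq ?_))
  · abel
  · abel

end FixedPoints

section BraidSequences

variable {G : Type*} [Group G]

/-- A sequence of group elements, the first `N` of which satisfy the braid relations. -/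
structure IsBraidSeq (s : ℕ → G) (N : ℕ) : Prop where
  far : ∀ {i j : ℕ}, i + 2 ≤ j → s i * s j = s j * s i
  braid : ∀ {i : ℕ}, i + 1 < N → s i * s (i + 1) * s i = s (i + 1) * s i * s (i + 1)

/-- The product `s k * s (k + 1) * ⋯` with `l` factors. -/
def seqRun (s : ℕ → G) : ℕ → ℕ → G
  | _, 0 => 1
  | k, l + 1 => s k * seqRun s (k + 1) l

theorem seqRun_succ_right (s : ℕ → G) (k l : ℕ) :
    seqRun s k (l + 1) = seqRun s k l * s (k + l) := by
  induction l generalizing k with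
  | zero => simp [seqRun]
  | succ l ih =>
    rw [seqRun, ih, seqRun, mul_assoc, show k + 1 + l = k + (l + 1) by ring]

theorem seqRun_congr {s s' : ℕ → G} {k l : ℕ} (h : ∀ i, i < k + l → s i = s' i) :
    seqRun s k l = seqRun s' k l := by
  induction l generalizing k with
  | zero => rfl
  | succ l ih => rw [seqRun, seqRun, h k (by omega), ih fun i hi => h i (by omega)]

/-- The element `s (k - 1) * ⋯ * s 0 * s 0 * ⋯ * s (k - 1)`. -/
def seqLoop (s : ℕ → G) : ℕ → G
  | 0 => 1
  | k + 1 => s k * seqLoop s k * s k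

/-- The full twist on the first `k` elements of the sequence. -/
def seqTwist (s : ℕ → G) : ℕ → G
  | 0 => 1
  | k + 1 => seqLoop s (k + 1) * seqTwist s k

theorem map_seqLoop {H : Type*} [Group H] (f : G →* H) (s : ℕ → G) (k : ℕ) :
    f (seqLoop s k) = seqLoop (fun i => f (s i)) k := by
  induction k with
  | zero => simp [seqLoop]
  | succ k ih => simp [seqLoop, ih]

theorem seqLoop_congr {s s' : ℕ → G} {k : ℕ} (h : ∀ i, i < k → s i = s' i) :
    seqLoop s k = seqLoop s' k := by
  induction k with
  | zero => rfl
  | succ k ih => rw [seqLoop, seqLoop, h k (by omega), ih fun i hi => h i (by omega)]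

theorem map_seqTwist {H : Type*} [Group H] (f : G →* H) (s : ℕ → G) (k : ℕ) :
    f (seqTwist s k) = seqTwist (fun i => f (s i)) k := by
  induction k with
  | zero => simp [seqTwist]
  | succ k ih => simp [seqTwist, ih, map_seqLoop]

theorem seqTwist_congr {s s' : ℕ → G} {k : ℕ} (h : ∀ i, i < k → s i = s' i) :
    seqTwist s k = seqTwist s' k := by
  induction k with
  | zero => rfl
  | succ k ih => rw [seqTwist, seqTwist, seqLoop_congr h, ih fun i hi => h i (by omega)]

namespace IsBraidSeq

variable {s : ℕ → G} {N : ℕ}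

theorem map {H : Type*} [Group H] (h : IsBraidSeq s N) (f : G →* H) :
    IsBraidSeq (fun i => f (s i)) N where
  far hij := by simp only [← map_mul, h.far hij]
  braid hi := by simp only [← map_mul, h.braid hi]

theorem commute_seqRun_of_lt (h : IsBraidSeq s N) {i k : ℕ} (hik : i + 2 ≤ k) (l : ℕ) :
    Commute (s i) (seqRun s k l) := by
  induction l generalizing k with
  | zero => exact Commute.one_right _
  | succ l ih => exact Commute.mul_right (h.far hik) (ih (by omega))

theorem mul_seqRun (h : IsBraidSeq s N) {i k l : ℕ} (hki : k ≤ i) (hil : i + 1 < k + l)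
    (hN : i + 1 < N) : s (i + 1) * seqRun s k l = seqRun s k l * s i := by
  induction l generalizing k with
  | zero => omega
  | succ l ih =>
    rcases hki.eq_or_lt with rfl | hki
    · obtain ⟨l, rfl⟩ : ∃ l', l = l' + 1 := ⟨l - 1, by omega⟩
      rw [seqRun, seqRun]
      have h1 := h.commute_seqRun_of_lt (show k + 2 ≤ k + 1 + 1 by omega) l
      rw [mul_assoc (s k), mul_assoc (s (k + 1)), ← h1.eq]
      simp only [← mul_assoc]
      rw [h.braid hN]
    · rw [seqRun, ← mul_assoc, ← h.far (by omega), mul_assoc, ih (by omega) (by omega), mul_assoc]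

theorem commute_seqLoop_of_gt (h : IsBraidSeq s N) {j k : ℕ} (hj : k + 1 ≤ j) :
    Commute (s j) (seqLoop s k) := by
  induction k with
  | zero => exact Commute.one_right _
  | succ k ih =>
    have h1 : Commute (s j) (s k) := (h.far (by omega)).symm
    exact (h1.mul_right (ih (by omega))).mul_right h1

theorem commute_seqLoop (h : IsBraidSeq s N) {i k : ℕ} (hik : i + 1 < k) (hk : k ≤ N) :
    Commute (s i) (seqLoop s k) := by
  induction k with
  | zero => omega
  | succ k ih =>
    rcases (show i + 1 ≤ k by omega).eq_or_lt with rfl | hik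
    · have h1 : Commute (s (i + 1)) (seqLoop s i) := h.commute_seqLoop_of_gt le_rfl
      have h2 := h.braid (show i + 1 < N by omega)
      rw [seqLoop, seqLoop]
      generalize s i = a at *
      generalize s (i + 1) = b at *
      generalize seqLoop s i = t at *
      change a * (b * (a * t * a) * b) = b * (a * t * a) * b * a
      calc a * (b * (a * t * a) * b) = (a * b * a) * t * (a * b) := by group
        _ = b * a * (b * t) * (a * b) := by rw [h2]; group
        _ = b * a * t * (b * a * b) := by rw [h1.eq]; group
        _ = b * (a * t * a) * b * a := by rw [← h2]; group
    · have h1 : Commute (s i) (s k) := h.far (by omega)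
      exact (h1.mul_right (ih hik (by omega))).mul_right h1

theorem commute_seqLoop_seqLoop (h : IsBraidSeq s N) {k : ℕ} (hk : k + 1 ≤ N) (j : ℕ)
    (hj : j ≤ k) : Commute (seqLoop s j) (seqLoop s (k + 1)) := by
  induction j with
  | zero => exact Commute.one_left _
  | succ j ih =>
    have h1 := h.commute_seqLoop (show j + 1 < k + 1 by omega) hk
    exact (h1.mul_left (ih (by omega))).mul_left h1

theorem seqLoop_typeB (h : IsBraidSeq s N) {k : ℕ} (hk : k + 1 ≤ N) :
    s k * seqLoop s k * s k * seqLoop s k = seqLoop s k * s k * seqLoop s k * s k := by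
  have := h.commute_seqLoop_seqLoop hk k le_rfl
  rw [seqLoop, commute_iff_eq] at this
  rw [← this]; group

theorem commute_seqLoop_mul (h : IsBraidSeq s N) {k : ℕ} (hk : k + 1 ≤ N) :
    Commute (s k) (seqLoop s (k + 1) * seqLoop s k) := by
  have h1 := h.seqLoop_typeB hk
  rw [seqLoop, commute_iff_eq]
  calc s k * (s k * seqLoop s k * s k * seqLoop s k)
      = s k * (seqLoop s k * s k * seqLoop s k * s k) := by rw [h1]
    _ = s k * seqLoop s k * s k * seqLoop s k * s k := by group

theorem seqLoop_succ_inv_typeB (h : IsBraidSeq s N) {k : ℕ} (hk : k + 1 ≤ N) :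
    s k * (seqLoop s (k + 1))⁻¹ * s k * (seqLoop s (k + 1))⁻¹ =
      (seqLoop s (k + 1))⁻¹ * s k * (seqLoop s (k + 1))⁻¹ * s k := by
  have h1 := h.commute_seqLoop_mul hk
  have h2 : Commute (seqLoop s k) (seqLoop s (k + 1) * seqLoop s k) :=
    (h.commute_seqLoop_seqLoop hk k le_rfl).mul_right (Commute.refl _)
  have h3 := h.seqLoop_typeB hk
  set T := seqLoop s (k + 1) * seqLoop s k with hT
  have h4 : (seqLoop s (k + 1))⁻¹ = seqLoop s k * T⁻¹ := by rw [hT]; group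
  rw [h4]
  have h5 := h1.inv_right
  have h6 := h2.inv_right
  generalize seqLoop s k = a at *
  generalize s k = b at *
  generalize T⁻¹ = t at *
  have h7 : b * (a * (b * a)) * (t * t) = a * (b * (a * b)) * (t * t) := by
    simp only [← mul_assoc, h3]
  have h5' (x : G) : t * (b * x) = b * (t * x) := by rw [← mul_assoc, ← h5.eq, mul_assoc]
  have h6' (x : G) : t * (a * x) = a * (t * x) := by rw [← mul_assoc, ← h6.eq, mul_assoc]
  simp only [mul_assoc, h5', h6', ← h5.eq] at h7 ⊢
  exact h7

theorem commute_seqTwist_of_gt (h : IsBraidSeq s N) {j k : ℕ} (hj : k + 1 ≤ j) :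
    Commute (s j) (seqTwist s k) := by
  induction k with
  | zero => exact Commute.one_right _
  | succ k ih => exact (h.commute_seqLoop_of_gt hj).mul_right (ih (by omega))

theorem commute_seqTwist (h : IsBraidSeq s N) {i k : ℕ} (hik : i < k) (hk : k ≤ N) :
    Commute (s i) (seqTwist s k) := by
  induction k with
  | zero => omega
  | succ k ih =>
    rcases (show i ≤ k by omega).eq_or_lt with rfl | hik
    · cases i with
      | zero =>
        simp [seqTwist, seqLoop, commute_iff_eq, mul_assoc]
      | succ i =>
        rw [seqTwist, seqTwist, ← mul_assoc]
        exact (h.commute_seqLoop_mul hk).mul_right (h.commute_seqTwist_of_gt le_rfl)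
    · exact (h.commute_seqLoop (by omega) hk).mul_right (ih hik (by omega))

end IsBraidSeq

end BraidSequences

namespace BraidGroup

/-- The standard generators of the braid group as an infinite sequence, trivial from `m` on. -/
def sg (m i : ℕ) : BraidGroup m := if h : i < m then braidGen ⟨i, h⟩ else 1

theorem sg_of_le {m i : ℕ} (h : m ≤ i) : sg m i = 1 := dif_neg h.not_gt

theorem isBraidSeq_sg (m : ℕ) : IsBraidSeq (sg m) m where
  far {i j} hij := by
    by_cases hj : j < m
    · have hi : i < m := by omega
      have h : PresentedGroup.mk (braidRels m) (.of ⟨i, hi⟩ * .of ⟨j, hj⟩) =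
          PresentedGroup.mk (braidRels m) (.of ⟨j, hj⟩ * .of ⟨i, hi⟩) :=
        PresentedGroup.mk_eq_mk_of_mul_inv_mem (Or.inr ⟨⟨i, hi⟩, ⟨j, hj⟩, hij, rfl⟩)
      simp only [sg, hi, hj, dite_true]
      exact h
    · simp [sg, hj]
  braid {i} hi := by
    have hi' : i < m := by omega
    have h : PresentedGroup.mk (braidRels m)
          (.of ⟨i, hi'⟩ * .of ⟨i + 1, hi⟩ * .of ⟨i, hi'⟩) =
        PresentedGroup.mk (braidRels m)
          (.of ⟨i + 1, hi⟩ * .of ⟨i, hi'⟩ * .of ⟨i + 1, hi⟩) :=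
      PresentedGroup.mk_eq_mk_of_mul_inv_mem (Or.inl ⟨⟨i, hi'⟩, ⟨i + 1, hi⟩, rfl, rfl⟩)
    simp only [sg, hi, hi', dite_true]
    exact h

section Lift

variable {G : Type*} [Group G] {m : ℕ}

/-- The homomorphism out of the braid group determined by a sequence satisfying the braid
relations. -/
def lift (s : ℕ → G) (h : IsBraidSeq s m) : BraidGroup m →* G :=
  PresentedGroup.toGroup (f := fun i : Fin m => s i) <| by
    rintro r (⟨i, j, hij, rfl⟩ | ⟨i, j, hij, rfl⟩)
    · have := h.braid (i := i) (by omega)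
      rw [hij] at this
      simp [this]
    · simp [h.far hij]

theorem lift_sg (s : ℕ → G) (h : IsBraidSeq s m) {i : ℕ} (hi : i < m) :
    lift s h (sg m i) = s i := by
  rw [sg, dif_pos hi]
  exact PresentedGroup.toGroup.of _

theorem hom_ext {f g : BraidGroup m →* G} (h : ∀ i < m, f (sg m i) = g (sg m i)) : f = g := by
  refine PresentedGroup.ext fun i => ?_
  have := h i i.2
  rwa [sg, dif_pos i.2] at this

@[elab_as_elim]
theorem induction {P : BraidGroup m → Prop} (b : BraidGroup m) (one : P 1)
    (gen : ∀ i < m, P (sg m i)) (mul : ∀ a b, P a → P b → P (a * b))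
    (inv : ∀ a, P a → P a⁻¹) : P b := by
  have hb : b ∈ Subgroup.closure (Set.range (PresentedGroup.of : Fin m → BraidGroup m)) := by
    rw [PresentedGroup.closure_range_of]; trivial
  induction hb using Subgroup.closure_induction with
  | mem x hx =>
    obtain ⟨i, rfl⟩ := hx
    have := gen i i.2
    rwa [sg, dif_pos i.2] at this
  | one => exact one
  | mul x y _ _ hx hy => exact mul x y hx hy
  | inv x _ hx => exact inv x hx

end Lift

end BraidGroup

section ArtinAutomorphism

variable {ι : Type*} [DecidableEq ι]

/-- The endomorphism `y_b ↦ y_a`, `y_a ↦ y_a⁻¹ y_b y_a` of a free group. -/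
def artHom (a b : ι) : FreeGroup ι →* FreeGroup ι :=
  FreeGroup.lift fun i =>
    if i = b then .of a else if i = a then (.of a)⁻¹ * .of b * .of a else .of i

/-- The endomorphism `y_a ↦ y_b`, `y_b ↦ y_b y_a y_b⁻¹` of a free group. -/
def artHomInv (a b : ι) : FreeGroup ι →* FreeGroup ι :=
  FreeGroup.lift fun i =>
    if i = a then .of b else if i = b then .of b * .of a * (.of b)⁻¹ else .of i

theorem artHom_right (a b : ι) : artHom a b (.of b) = .of a := by simp [artHom]

theorem artHom_left {a b : ι} (h : a ≠ b) :
    artHom a b (.of a) = (.of a)⁻¹ * .of b * .of a := by simp [artHom, h]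

theorem artHom_of_ne {a b i : ι} (ha : i ≠ a) (hb : i ≠ b) : artHom a b (.of i) = .of i := by
  simp [artHom, ha, hb]

/-- The elementary Artin automorphism `y_b ↦ y_a`, `y_a ↦ y_a⁻¹ y_b y_a` of a free group. -/
def artAut {a b : ι} (h : a ≠ b) : MulAut (FreeGroup ι) :=
  MonoidHom.toMulEquiv (artHom a b) (artHomInv a b)
    (FreeGroup.ext_hom _ _ fun i => by
      by_cases hb : i = b
      · subst hb; simp [artHom, artHomInv]
      · by_cases ha : i = a
        · subst ha; simp [artHom, artHomInv, h, h.symm, mul_assoc]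
        · simp [artHom, artHomInv, ha, hb])
    (FreeGroup.ext_hom _ _ fun i => by
      by_cases hb : i = a
      · subst hb; simp [artHom, artHomInv]
      · by_cases ha : i = b
        · subst ha; simp [artHom, artHomInv, h, h.symm, mul_assoc]
        · simp [artHom, artHomInv, ha, hb])

theorem artAut_apply {a b : ι} (h : a ≠ b) (x : FreeGroup ι) : artAut h x = artHom a b x := rfl

omit [DecidableEq ι] in
theorem FreeGroup.mulAut_ext {φ ψ : MulAut (FreeGroup ι)}
    (h : ∀ i, φ (.of i) = ψ (.of i)) : φ = ψ :=
  MulEquiv.toMonoidHom_injective (FreeGroup.ext_hom _ _ h)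

theorem artAut_commute {a b c d : ι} (hab : a ≠ b) (hcd : c ≠ d) (hac : a ≠ c) (had : a ≠ d)
    (hbc : b ≠ c) (hbd : b ≠ d) : artAut hab * artAut hcd = artAut hcd * artAut hab := by
  refine FreeGroup.mulAut_ext fun i => ?_
  simp only [MulAut.mul_apply, artAut_apply]
  by_cases ha : i = a
  · subst ha
    simp [artHom_left, artHom_of_ne, *]
  by_cases hb : i = b
  · subst hb
    simp [artHom_right, artHom_of_ne, *]
  by_cases hc : i = c
  · subst hc
    simp [artHom_left, artHom_of_ne, hcd, hac.symm, had.symm, hbc.symm, hbd.symm]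
  by_cases hd : i = d
  · subst hd
    simp [artHom_right, artHom_of_ne, hac.symm, had.symm, hbc.symm, hbd.symm]
  simp [artHom_of_ne, *]

theorem artAut_braid {a b c : ι} (hab : a ≠ b) (hbc : b ≠ c) (hac : a ≠ c) :
    artAut hab * artAut hbc * artAut hab = artAut hbc * artAut hab * artAut hbc := by
  refine FreeGroup.mulAut_ext fun i => ?_
  simp only [MulAut.mul_apply, artAut_apply]
  have hc : artHom a b (.of c) = .of c := artHom_of_ne hac.symm hbc.symm
  by_cases h1 : i = a
  · subst h1
    simp [artHom_left, artHom_right, artHom_of_ne, hab, hbc, hac, hc, mul_assoc]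
  by_cases h2 : i = b
  · subst h2
    simp [artHom_left, artHom_right, artHom_of_ne, hab, hbc, hac, hc]
  by_cases h3 : i = c
  · subst h3
    simp [artHom_right, artHom_of_ne, hab, hac, hc]
  simp [artHom_of_ne, *]

end ArtinAutomorphism

namespace BraidGroup

/-- The generators of a free group of rank `m + 1` as an infinite sequence, trivial from
`m + 1` on. -/
def yy (m k : ℕ) : FreeGroup (Fin (m + 1)) := if h : k < m + 1 then .of ⟨k, h⟩ else 1

theorem of_eq_yy {m : ℕ} (i : Fin (m + 1)) : .of i = yy m i := by rw [yy, dif_pos i.2]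

/-- The product `y_{k-1} ⋯ y_0`. -/
def cprod (m : ℕ) : ℕ → FreeGroup (Fin (m + 1))
  | 0 => 1
  | k + 1 => yy m k * cprod m k

/-- The Artin automorphisms as an infinite sequence. -/
def artSeq (m i : ℕ) : MulAut (FreeGroup (Fin (m + 1))) :=
  if h : i < m then
    artAut (show (⟨i, by omega⟩ : Fin (m + 1)) ≠ ⟨i + 1, by omega⟩ by simp) else 1

theorem isBraidSeq_artSeq (m : ℕ) : IsBraidSeq (artSeq m) m where
  far {i j} hij := by
    by_cases hj : j < m
    · have hi : i < m := by omega
      simp only [artSeq, hi, hj, dite_true]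
      apply artAut_commute <;> simp <;> omega
    · simp [artSeq, hj]
  braid {i} hi := by
    have hi' : i < m := by omega
    simp only [artSeq, hi, hi', dite_true]
    apply artAut_braid
    simp [Fin.ext_iff, add_assoc]

/-- The Artin representation of the braid group on a free group. -/
def art (m : ℕ) : BraidGroup m →* MulAut (FreeGroup (Fin (m + 1))) :=
  lift (artSeq m) (isBraidSeq_artSeq m)

section Art

variable {m i k : ℕ}

theorem art_sg_succ (hi : i < m) : art m (sg m i) (yy m (i + 1)) = yy m i := by
  rw [art, lift_sg _ _ hi, artSeq, dif_pos hi, yy, yy, dif_pos (by omega), dif_pos (by omega)]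
  exact artHom_right _ _

theorem art_sg_self (hi : i < m) :
    art m (sg m i) (yy m i) = (yy m i)⁻¹ * yy m (i + 1) * yy m i := by
  rw [art, lift_sg _ _ hi, artSeq, dif_pos hi, yy, yy, dif_pos (by omega), dif_pos (by omega)]
  exact artHom_left (by simp)

theorem art_sg_of_ne (h1 : k ≠ i) (h2 : k ≠ i + 1) : art m (sg m i) (yy m k) = yy m k := by
  by_cases hi : i < m
  · by_cases hk : k < m + 1
    · rw [art, lift_sg _ _ hi, artSeq, dif_pos hi, yy, dif_pos hk]
      exact artHom_of_ne (by simpa using h1) (by simpa using h2)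
    · simp [yy, hk]
  · rw [sg_of_le (not_lt.1 hi)]; simp

theorem art_sg_cprod_of_le (hk : k ≤ i) : art m (sg m i) (cprod m k) = cprod m k := by
  induction k with
  | zero => simp [cprod]
  | succ k ih => rw [cprod, map_mul, ih (by omega), art_sg_of_ne (by omega) (by omega)]

theorem art_sg_cprod (hi : i < m) (hk : i + 2 ≤ k) :
    art m (sg m i) (cprod m k) = cprod m k := by
  obtain ⟨l, rfl⟩ := Nat.exists_eq_add_of_le hk
  clear hk
  induction l with
  | zero =>
    simp only [cprod, map_mul, art_sg_cprod_of_le le_rfl, art_sg_succ hi,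
      art_sg_self hi]
    group
  | succ l ih => rw [← add_assoc, cprod, map_mul, ih, art_sg_of_ne (by omega) (by omega)]

theorem art_cprod (b : BraidGroup m) : art m b (cprod m (m + 1)) = cprod m (m + 1) := by
  induction b using induction with
  | one => simp
  | gen i hi => exact art_sg_cprod hi (by omega)
  | mul a b ha hb => rw [map_mul, MulAut.mul_apply, hb, ha]
  | inv a ha => rw [map_inv, MulAut.inv_apply, MulEquiv.symm_apply_eq, ha]

end Art

/-- The transpositions `(i, i + 1)` as an infinite sequence. -/
def swapSeq (m i : ℕ) : Equiv.Perm (Fin (m + 1)) :=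
  if h : i < m then Equiv.swap ⟨i, by omega⟩ ⟨i + 1, by omega⟩ else 1

theorem swap_braid {ι : Type*} [DecidableEq ι] {a b c : ι} (hab : a ≠ b) (hbc : b ≠ c)
    (hac : a ≠ c) : Equiv.swap a b * Equiv.swap b c * Equiv.swap a b =
      Equiv.swap b c * Equiv.swap a b * Equiv.swap b c := by
  rw [Equiv.swap_mul_swap_mul_swap hab hac, Equiv.swap_comm a b, Equiv.swap_comm b c,
    Equiv.swap_mul_swap_mul_swap hbc.symm hac.symm, Equiv.swap_comm]

theorem isBraidSeq_swapSeq (m : ℕ) : IsBraidSeq (swapSeq m) m where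
  far {i j} hij := by
    by_cases hj : j < m
    · have hi : i < m := by omega
      simp only [swapSeq, hi, hj, dite_true]
      refine (Equiv.Perm.disjoint_swap_swap ?_).commute
      simp
      omega
    · simp [swapSeq, hj]
  braid {i} hi := by
    have hi' : i < m := by omega
    simp only [swapSeq, hi, hi', dite_true]
    apply swap_braid <;> simp [Fin.ext_iff, add_assoc]

/-- The permutation of the strands defined by a braid. -/
def prm (m : ℕ) : BraidGroup m →* Equiv.Perm (Fin (m + 1)) :=
  lift (swapSeq m) (isBraidSeq_swapSeq m)

theorem prm_sg {m i : ℕ} (hi : i < m) :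
    prm m (sg m i) = Equiv.swap ⟨i, by omega⟩ ⟨i + 1, by omega⟩ := by
  rw [prm, lift_sg _ _ hi, swapSeq, dif_pos hi]

theorem isConj_art {m : ℕ} (b : BraidGroup m) (i : Fin (m + 1)) :
    IsConj (art m b (.of i)) (.of (prm m b i)) := by
  induction b using induction generalizing i with
  | one => simpa using IsConj.refl (FreeGroup.of i)
  | gen k hk =>
    rw [prm_sg hk]
    by_cases h1 : (i : ℕ) = k
    · have h : i = ⟨k, by omega⟩ := Fin.ext h1
      rw [h, of_eq_yy, Equiv.swap_apply_left, art_sg_self hk, of_eq_yy]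
      exact isConj_iff.2 ⟨yy m k, by group⟩
    by_cases h2 : (i : ℕ) = k + 1
    · have h : i = ⟨k + 1, by omega⟩ := Fin.ext h2
      rw [h, of_eq_yy, Equiv.swap_apply_right, art_sg_succ hk, of_eq_yy]
    · rw [Equiv.swap_apply_of_ne_of_ne (fun h => h1 (by rw [h])) (fun h => h2 (by rw [h])),
        of_eq_yy, art_sg_of_ne h1 h2]
  | mul a b ha hb =>
    rw [map_mul, map_mul, MulAut.mul_apply, Equiv.Perm.mul_apply]
    exact ((art m a).toMonoidHom.map_isConj (hb i)).trans (ha _)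
  | inv a ha =>
    have h := (art m a⁻¹).toMonoidHom.map_isConj (ha ((prm m a)⁻¹ i))
    simp only [map_inv, MulEquiv.coe_toMonoidHom, MulAut.inv_apply_self,
      ← Equiv.Perm.mul_apply, mul_inv_cancel, Equiv.Perm.one_apply] at h ⊢
    exact h.symm

theorem exists_prm_apply_eq {m : ℕ} (i j : Fin (m + 1)) : ∃ b, prm m b i = j := by
  suffices h : ∀ k : ℕ, ∀ hk : k < m + 1, ∃ b, prm m b 0 = ⟨k, hk⟩ by
    obtain ⟨a, ha⟩ := h i i.2
    obtain ⟨b, hb⟩ := h j j.2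
    exact ⟨b * a⁻¹, by rw [map_mul, map_inv, Equiv.Perm.mul_apply,
      (Equiv.Perm.inv_eq_iff_eq).2 ha.symm, hb]⟩
  intro k
  induction k with
  | zero => exact fun _ => ⟨1, by simp⟩
  | succ k ih =>
    intro hk
    obtain ⟨b, hb⟩ := ih (by omega)
    refine ⟨sg m k * b, ?_⟩
    rw [map_mul, Equiv.Perm.mul_apply, hb, prm_sg (by omega), Equiv.swap_apply_left]

end BraidGroup

theorem IsBraidSeq.mono {G : Type*} [Group G] {s : ℕ → G} {N N' : ℕ} (h : IsBraidSeq s N)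
    (hN : N' ≤ N) : IsBraidSeq s N' where
  far := h.far
  braid hi := h.braid (hi.trans_le hN)

namespace BraidGroup

variable {m i k n : ℕ}

theorem cprod_succ (m k : ℕ) : cprod m (k + 1) = yy m k * cprod m k := rfl

/-- The embedding of braid groups adding a last strand. -/
def incl (m : ℕ) : BraidGroup m →* BraidGroup (m + 1) :=
  lift (sg (m + 1)) ((isBraidSeq_sg (m + 1)).mono m.le_succ)

theorem incl_sg (hi : i < m) : incl m (sg m i) = sg (m + 1) i := lift_sg _ _ hi

/-- The embedding of free groups adding a last generator. -/
def fincl (m : ℕ) : FreeGroup (Fin (m + 1)) →* FreeGroup (Fin (m + 2)) :=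
  FreeGroup.map Fin.castSucc

theorem fincl_of (i : Fin (m + 1)) : fincl m (.of i) = .of i.castSucc := FreeGroup.map.of

theorem fincl_yy (hk : k < m + 1) : fincl m (yy m k) = yy (m + 1) k := by
  rw [yy, dif_pos hk, fincl_of, yy, dif_pos (by omega)]
  rfl

theorem fincl_injective (m : ℕ) : Function.Injective (fincl m) :=
  FreeGroup.map_injective (Fin.castSucc_injective _)

theorem fincl_cprod (hk : k ≤ m + 1) : fincl m (cprod m k) = cprod (m + 1) k := by
  induction k with
  | zero => simp [cprod]
  | succ k ih => rw [cprod, map_mul, ih (by omega), fincl_yy (by omega), cprod]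

theorem fincl_art_sg (hi : i < m) (f : FreeGroup (Fin (m + 1))) :
    fincl m (art m (sg m i) f) = art (m + 1) (sg (m + 1) i) (fincl m f) := by
  suffices h : (fincl m).comp (art m (sg m i)).toMonoidHom =
      (art (m + 1) (sg (m + 1) i)).toMonoidHom.comp (fincl m) from DFunLike.congr_fun h f
  refine FreeGroup.ext_hom _ _ fun k => ?_
  simp only [MonoidHom.comp_apply, MulEquiv.coe_toMonoidHom, of_eq_yy]
  have hk := k.2
  generalize (k : ℕ) = k at *
  rw [fincl_yy hk]
  by_cases h1 : k = i
  · subst h1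
    rw [art_sg_self hi, art_sg_self (by omega), map_mul, map_mul, map_inv, fincl_yy (by omega),
      fincl_yy (by omega)]
  by_cases h2 : k = i + 1
  · subst h2
    rw [art_sg_succ hi, art_sg_succ (by omega), fincl_yy (by omega)]
  rw [art_sg_of_ne h1 h2, art_sg_of_ne h1 h2, fincl_yy hk]

theorem fincl_art (b : BraidGroup m) (f : FreeGroup (Fin (m + 1))) :
    fincl m (art m b f) = art (m + 1) (incl m b) (fincl m f) := by
  induction b using induction generalizing f with
  | one => simp
  | gen i hi => rw [fincl_art_sg hi, incl_sg hi]
  | mul a b ha hb => simp only [map_mul, MulAut.mul_apply, ha, hb]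
  | inv a ha =>
    have := ha (art m a⁻¹ f)
    rw [map_inv, MulAut.apply_inv_self] at this
    rw [this, map_inv (incl m), map_inv (art (m + 1)), MulAut.inv_apply_self, map_inv]

theorem art_incl_last (b : BraidGroup m) :
    art (m + 1) (incl m b) (yy (m + 1) (m + 1)) = yy (m + 1) (m + 1) := by
  induction b using induction with
  | one => simp
  | gen i hi => rw [incl_sg hi, art_sg_of_ne (by omega) (by omega)]
  | mul a b ha hb => rw [map_mul, map_mul, MulAut.mul_apply, hb, ha]
  | inv a ha => rw [map_inv, map_inv, MulAut.inv_apply, MulEquiv.symm_apply_eq, ha]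

theorem prm_incl_castSucc (b : BraidGroup m) (i : Fin (m + 1)) :
    prm (m + 1) (incl m b) i.castSucc = (prm m b i).castSucc := by
  induction b using induction generalizing i with
  | one => simp
  | gen k hk =>
    rw [incl_sg hk, prm_sg hk, prm_sg (by omega)]
    have h1 : (⟨k, by omega⟩ : Fin (m + 1 + 1)) = Fin.castSucc ⟨k, by omega⟩ := rfl
    have h2 : (⟨k + 1, by omega⟩ : Fin (m + 1 + 1)) = Fin.castSucc ⟨k + 1, by omega⟩ := rfl
    rw [h1, h2, (Fin.castSucc_injective _).swap_apply]
  | mul a b ha hb => simp only [map_mul, Equiv.Perm.mul_apply, ha, hb]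
  | inv a ha =>
    rw [map_inv, map_inv, Equiv.Perm.inv_eq_iff_eq, ha, ← Equiv.Perm.mul_apply]
    simp

theorem prm_incl_last (b : BraidGroup m) :
    prm (m + 1) (incl m b) (Fin.last (m + 1)) = Fin.last (m + 1) := by
  induction b using induction with
  | one => simp
  | gen k hk =>
    rw [incl_sg hk, prm_sg (by omega), Equiv.swap_apply_of_ne_of_ne] <;>
      simp [Fin.ext_iff] <;> omega
  | mul a b ha hb => simp only [map_mul, Equiv.Perm.mul_apply, ha, hb]
  | inv a ha => rw [map_inv, map_inv, Equiv.Perm.inv_eq_iff_eq, ha]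

theorem prm_sg_mul_self (i : ℕ) : prm m (sg m i) * prm m (sg m i) = 1 := by
  by_cases hi : i < m
  · rw [prm_sg hi, Equiv.swap_mul_self]
  · simp [sg_of_le (not_lt.1 hi)]

theorem prm_seqLoop (k : ℕ) : prm m (seqLoop (sg m) k) = 1 := by
  induction k with
  | zero => simp [seqLoop]
  | succ k ih => rw [seqLoop, map_mul, map_mul, ih, mul_one, prm_sg_mul_self]

theorem art_sg_conj (hi : i < m) :
    art m (sg m i) ((cprod m i)⁻¹ * yy m i * cprod m i) =
      (cprod m (i + 1))⁻¹ * yy m (i + 1) * cprod m (i + 1) := by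
  rw [map_mul, map_mul, map_inv, art_sg_cprod_of_le le_rfl, art_sg_self hi, cprod]
  group

theorem art_seqLoop (hn : n ≤ m) :
    (∀ k, n < k → art m (seqLoop (sg m) n) (yy m k) = yy m k) ∧
    (art m (seqLoop (sg m) n) (yy m n) = (cprod m n)⁻¹ * yy m n * cprod m n) ∧
    (∀ k, k < n → art m (seqLoop (sg m) n) (yy m k) =
      ((cprod m n)⁻¹ * yy m n * cprod m n)⁻¹ * yy m k *
        ((cprod m n)⁻¹ * yy m n * cprod m n)) := by
  induction n with
  | zero => simp [seqLoop, cprod]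
  | succ n ih =>
    obtain ⟨h1, h2, h3⟩ := ih (by omega)
    simp only [seqLoop, map_mul, MulAut.mul_apply]
    refine ⟨fun k hk => ?_, ?_, fun k hk => ?_⟩
    · rw [art_sg_of_ne (by omega) (by omega), h1 k (by omega),
        art_sg_of_ne (by omega) (by omega)]
    · rw [art_sg_succ (by omega), h2, art_sg_conj (by omega)]
    · rcases (Nat.lt_succ_iff.1 hk).eq_or_lt with rfl | hk
      · rw [art_sg_self (by omega), map_mul (art m (seqLoop _ _)), map_mul (art m (seqLoop _ _)),
          map_inv (art m (seqLoop _ _)), h2, h1 _ (by omega), map_mul (art m _), map_mul (art m _),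
            map_inv (art m _), art_sg_conj (by omega), art_sg_succ (by omega)]
      · rw [art_sg_of_ne (by omega) (by omega), h3 k hk, map_mul (art m _), map_mul (art m _),
          map_inv (art m _), art_sg_conj (by omega), art_sg_of_ne (by omega) (by omega)]

theorem art_seqLoop_cprod (hn : n ≤ m) (hk : k ≤ n) :
    art m (seqLoop (sg m) n) (cprod m k) =
      ((cprod m n)⁻¹ * yy m n * cprod m n)⁻¹ * cprod m k *
        ((cprod m n)⁻¹ * yy m n * cprod m n) := by
  induction k with
  | zero => simp only [cprod, map_one]; group
  | succ k ih =>
    rw [cprod, map_mul, ih (by omega), (art_seqLoop hn).2.2 k (by omega)]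
    group

theorem art_seqTwist (hn : n ≤ m) :
    (∀ k, n < k → art m (seqTwist (sg m) n) (yy m k) = yy m k) ∧
    (∀ k, k ≤ n → art m (seqTwist (sg m) n) (yy m k) =
      (cprod m (n + 1))⁻¹ * yy m k * cprod m (n + 1)) := by
  induction n with
  | zero => simp [seqTwist, cprod]
  | succ n ih =>
    obtain ⟨h1, h2⟩ := ih (by omega)
    obtain ⟨h3, h4, h5⟩ := art_seqLoop hn
    simp only [seqTwist, map_mul, MulAut.mul_apply]
    refine ⟨fun k hk => ?_, fun k hk => ?_⟩
    · rw [h1 k (by omega), h3 k hk]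
    · rcases hk.eq_or_lt with rfl | hk
      · rw [h1 _ (by omega), h4, cprod_succ m (n + 1)]
        group
      · rw [h2 k (by omega), map_mul, map_mul, map_inv, h5 k hk,
          art_seqLoop_cprod hn le_rfl, cprod_succ m (n + 1)]
        group

/-- The full twist, in a form suited to induction on the number of strands. -/
def zz (m : ℕ) : BraidGroup m := seqTwist (sg m) m

theorem art_zz (f : FreeGroup (Fin (m + 1))) :
    art m (zz m) f = (cprod m (m + 1))⁻¹ * f * cprod m (m + 1) := by
  have h : art m (zz m) = MulAut.conj (cprod m (m + 1))⁻¹ := by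
    refine FreeGroup.mulAut_ext fun k => ?_
    rw [of_eq_yy, zz, (art_seqTwist le_rfl).2 _ (by omega)]
    simp
  rw [h]
  simp

theorem commute_zz (b : BraidGroup m) : Commute b (zz m) := by
  induction b using induction with
  | one => exact Commute.one_left _
  | gen i hi => exact (isBraidSeq_sg m).commute_seqTwist hi le_rfl
  | mul a b ha hb => exact ha.mul_left hb
  | inv a ha => exact ha.inv_left

theorem prm_zz : prm m (zz m) = 1 := by
  suffices h : ∀ k, prm m (seqTwist (sg m) k) = 1 from h m
  intro k
  induction k with
  | zero => simp [seqTwist]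
  | succ k ih => rw [seqTwist, map_mul, ih, mul_one, prm_seqLoop]

theorem incl_seqLoop (hk : k ≤ m) :
    incl m (seqLoop (sg m) k) = seqLoop (sg (m + 1)) k := by
  rw [map_seqLoop]
  exact seqLoop_congr fun i hi => incl_sg (by omega)

theorem zz_succ : zz (m + 1) = seqLoop (sg (m + 1)) (m + 1) * incl m (zz m) := by
  rw [zz, seqTwist, zz, map_seqTwist]
  congr 1
  exact seqTwist_congr fun i hi => (incl_sg (by omega)).symm

end BraidGroup

namespace BraidGroup

variable {m : ℕ}

theorem art_seqRun {k l : ℕ} (h : k + l ≤ m) :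
    art m (seqRun (sg m) k l) (yy m (k + l)) = yy m k := by
  induction l generalizing k with
  | zero => simp [seqRun]
  | succ l ih =>
    rw [seqRun, map_mul, MulAut.mul_apply, show k + (l + 1) = k + 1 + l by ring,
      ih (by omega), art_sg_succ (by omega)]

section Conjugates

variable {G : Type*} [Group G] (s : ℕ → G) (a : G)

/-- The conjugate of `a` by `s k * ⋯ * s (m - 1)`. -/
def annSeq (m k : ℕ) : G := seqRun s k (m - k) * a * (seqRun s k (m - k))⁻¹

theorem annSeq_self (m : ℕ) : annSeq s a m m = a := by simp [annSeq, seqRun]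

theorem annSeq_of_lt {m k : ℕ} (hk : k < m) :
    annSeq s a m k = s k * annSeq s a m (k + 1) * (s k)⁻¹ := by
  obtain ⟨l, rfl⟩ := Nat.exists_eq_add_of_lt hk
  rw [annSeq, annSeq, show k + l + 1 - k = l + 1 by omega, show k + l + 1 - (k + 1) = l by omega,
    seqRun]
  group

variable {s a}

theorem commute_annSeq (hs : IsBraidSeq s m) (hc : ∀ i, i + 1 < m → Commute (s i) a) {i k : ℕ}
    (hi : i < m) (hk : k ≤ m) (h1 : k ≠ i) (h2 : k ≠ i + 1) : Commute (s i) (annSeq s a m k) := by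
  rcases lt_or_gt_of_ne h1 with h | h
  · obtain ⟨i, rfl⟩ : ∃ j, i = j + 1 := ⟨i - 1, by omega⟩
    have h3 := hs.mul_seqRun (show k ≤ i by omega) (show i + 1 < k + (m - k) by omega) hi
    have h4 := (hc i hi).eq
    have h5 : s (i + 1) = seqRun s k (m - k) * s i * (seqRun s k (m - k))⁻¹ := by
      rw [← h3]; group
    rw [commute_iff_eq, annSeq, h5]
    calc _ = seqRun s k (m - k) * (s i * a) * (seqRun s k (m - k))⁻¹ := by group
      _ = _ := by rw [h4]; group
  · have h3 := hs.commute_seqRun_of_lt (show i + 2 ≤ k by omega) (m - k)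
    exact (h3.mul_right (hc i (by omega))).mul_right h3.inv_right

theorem annSeq_typeB (hs : IsBraidSeq s m) (hc : ∀ i, i + 1 < m → Commute (s i) a)
    (hB : ∀ i, i + 1 = m → s i * a * s i * a = a * s i * a * s i) {i : ℕ} (hi : i < m) :
    s i * annSeq s a m (i + 1) * s i * annSeq s a m (i + 1) =
      annSeq s a m (i + 1) * s i * annSeq s a m (i + 1) * s i := by
  obtain ⟨l, hl⟩ := Nat.exists_eq_add_of_lt hi
  induction l generalizing i with
  | zero =>
    obtain rfl : m = i + 1 := by omega
    rw [annSeq_self]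
    exact hB i rfl
  | succ l ih =>
    have h1 := ih (i := i + 1) (by omega) (by omega)
    have h2 := (commute_annSeq hs hc hi (show i + 2 ≤ m by omega) (by omega) (by omega)).eq
    have h3 := hs.braid (show i + 1 < m by omega)
    rw [annSeq_of_lt s a (show i + 1 < m by omega)]
    generalize annSeq s a m (i + 1 + 1) = x at *
    generalize s (i + 1) = u at *
    generalize s i = v at *
    have hv : v = u * v * u * (u * v)⁻¹ := by rw [← h3]; group
    have hx : u * x * u⁻¹ = u * v * x * (u * v)⁻¹ := by
      rw [mul_assoc u v x, h2]; group
    rw [hx]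
    have e1 : v * (u * v * x * (u * v)⁻¹) * v * (u * v * x * (u * v)⁻¹) =
        u * v * (u * x * u * x) * (u * v)⁻¹ := by
      calc _ = (u * v * u * (u * v)⁻¹) * (u * v * x * (u * v)⁻¹) * (u * v * u * (u * v)⁻¹) *
            (u * v * x * (u * v)⁻¹) := by rw [← hv]
        _ = _ := by group
    have e2 : (u * v * x * (u * v)⁻¹) * v * (u * v * x * (u * v)⁻¹) * v =
        u * v * (x * u * x * u) * (u * v)⁻¹ := by
      calc _ = (u * v * x * (u * v)⁻¹) * (u * v * u * (u * v)⁻¹) * (u * v * x * (u * v)⁻¹) *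
            (u * v * u * (u * v)⁻¹) := by rw [← hv]
        _ = _ := by group
    rw [e1, e2, h1]

end Conjugates

/-- The semidirect product of a free group by the braid group acting through the Artin
representation. -/
abbrev ABraid (m : ℕ) : Type := FreeGroup (Fin (m + 1)) ⋊[art m] BraidGroup m

section Lift

variable {G : Type*} [Group G]

/-- The homomorphism of free groups used to define `annLift`. -/
def annLiftFree (β : BraidGroup m →* G) (a : G) : FreeGroup (Fin (m + 1)) →* G :=
  FreeGroup.lift fun k => annSeq (fun i => β (sg m i)) a m k

theorem annLiftFree_yy (β : BraidGroup m →* G) (a : G) {k : ℕ} (hk : k ≤ m) :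
    annLiftFree β a (yy m k) = annSeq (fun i => β (sg m i)) a m k := by
  rw [yy, dif_pos (by omega), annLiftFree, FreeGroup.lift_apply_of]

theorem annLiftFree_art (β : BraidGroup m →* G) (a : G)
    (hc : ∀ i, i + 1 < m → Commute (β (sg m i)) a)
    (hB : ∀ i, i + 1 = m →
      β (sg m i) * a * β (sg m i) * a = a * β (sg m i) * a * β (sg m i))
    (b : BraidGroup m) (f : FreeGroup (Fin (m + 1))) :
    annLiftFree β a (art m b f) = β b * annLiftFree β a f * (β b)⁻¹ := by
  induction b using induction generalizing f with
  | one => simp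
  | gen i hi =>
    have hs := (isBraidSeq_sg m).map β
    suffices h : (annLiftFree β a).comp (art m (sg m i)).toMonoidHom =
        (MulAut.conj (β (sg m i))).toMonoidHom.comp (annLiftFree β a) from DFunLike.congr_fun h f
    refine FreeGroup.ext_hom _ _ fun k => ?_
    simp only [MonoidHom.comp_apply, MulEquiv.coe_toMonoidHom, of_eq_yy, MulAut.conj_apply]
    have hk := k.2
    generalize (k : ℕ) = k at *
    by_cases h1 : k = i
    · subst h1
      have h := annSeq_typeB hs hc hB hi
      rw [art_sg_self hi, map_mul, map_mul, map_inv, annLiftFree_yy _ _ (by omega),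
        annLiftFree_yy _ _ (by omega), annSeq_of_lt _ _ hi]
      generalize annSeq (fun i => β (sg m i)) a m (k + 1) = x at *
      generalize β (sg m k) = s at *
      calc (s * x * s⁻¹)⁻¹ * x * (s * x * s⁻¹) = s * x⁻¹ * s⁻¹ * (x * s * x * s) * s⁻¹ * s⁻¹ := by
            group
        _ = _ := by rw [← h]; group
    by_cases h2 : k = i + 1
    · subst h2
      rw [art_sg_succ hi, annLiftFree_yy _ _ (by omega), annLiftFree_yy _ _ (by omega),
        annSeq_of_lt _ _ hi]
    · rw [art_sg_of_ne h1 h2, annLiftFree_yy _ _ (by omega)]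
      have h := commute_annSeq hs hc hi (Nat.lt_succ_iff.1 hk) h1 h2
      rw [h.eq, mul_inv_cancel_right]
  | mul x y hx hy => simp only [map_mul, MulAut.mul_apply, hx, hy]; group
  | inv x hx =>
    have h := hx (art m x⁻¹ f)
    rw [map_inv, MulAut.apply_inv_self] at h
    rw [h, map_inv, map_inv]
    group

/-- A homomorphism out of `ABraid m` is given by a homomorphism `β` out of the braid group and an
element commuting with all but the last generator and satisfying a relation of type `B` with
that last one. -/
def annLift (β : BraidGroup m →* G) (a : G) (hc : ∀ i, i + 1 < m → Commute (β (sg m i)) a)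
    (hB : ∀ i, i + 1 = m →
      β (sg m i) * a * β (sg m i) * a = a * β (sg m i) * a * β (sg m i)) : ABraid m →* G :=
  SemidirectProduct.lift (annLiftFree β a) β fun b =>
    MonoidHom.ext fun f => annLiftFree_art β a hc hB b f

section

variable (β : BraidGroup m →* G) (a : G) (hc : ∀ i, i + 1 < m → Commute (β (sg m i)) a)
  (hB : ∀ i, i + 1 = m →
      β (sg m i) * a * β (sg m i) * a = a * β (sg m i) * a * β (sg m i))

theorem annLift_inr (b : BraidGroup m) :
    annLift β a hc hB (SemidirectProduct.inr b) = β b := SemidirectProduct.lift_inr _ _ _ _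

theorem annLift_inl_yy {k : ℕ} (hk : k ≤ m) :
    annLift β a hc hB (SemidirectProduct.inl (yy m k)) =
      annSeq (fun i => β (sg m i)) a m k := by
  rw [annLift, SemidirectProduct.lift_inl, annLiftFree_yy _ _ hk]

theorem annLift_inl_last : annLift β a hc hB (SemidirectProduct.inl (yy m m)) = a := by
  rw [annLift_inl_yy _ _ _ _ le_rfl, annSeq_self]

end

theorem inr_mul_inl_mul_inr (b : BraidGroup m) (f : FreeGroup (Fin (m + 1))) :
    (SemidirectProduct.inr b * SemidirectProduct.inl f * (SemidirectProduct.inr b)⁻¹ : ABraid m) =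
      SemidirectProduct.inl (art m b f) := by
  rw [SemidirectProduct.inl_aut, map_inv]

theorem ABraid.hom_ext {f g : ABraid m →* G}
    (hr : ∀ b, f (SemidirectProduct.inr b) = g (SemidirectProduct.inr b))
    (hl : f (SemidirectProduct.inl (yy m m)) = g (SemidirectProduct.inl (yy m m))) : f = g := by
  refine SemidirectProduct.hom_ext (FreeGroup.ext_hom _ _ fun k => ?_) (MonoidHom.ext hr)
  have h := art_seqRun (show (k : ℕ) + (m - k) ≤ m by omega)
  rw [show (k : ℕ) + (m - k) = m by omega] at h
  rw [MonoidHom.comp_apply, MonoidHom.comp_apply, of_eq_yy, ← h, ← inr_mul_inl_mul_inr]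
  simp only [map_mul, map_inv, hr, hl]

end Lift

end BraidGroup

namespace BraidGroup

open SemidirectProduct (inl inr)

variable {m : ℕ}

theorem ABraid.induction {P : ABraid m → Prop} (h : ABraid m) (hr : ∀ b, P (inr b))
    (hl : P (inl (yy m m))) (mul : ∀ a b, P a → P b → P (a * b)) (inv : ∀ a, P a → P a⁻¹) :
    P h := by
  have h1 (f : FreeGroup (Fin (m + 1))) : P (inl f) := by
    have h2 (k : Fin (m + 1)) : P (inl (.of k)) := by
      have h := art_seqRun (show (k : ℕ) + (m - k) ≤ m by omega)
      rw [show (k : ℕ) + (m - k) = m by omega] at h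
      rw [of_eq_yy, ← h, ← inr_mul_inl_mul_inr]
      exact mul _ _ (mul _ _ (hr _) hl) (inv _ (hr _))
    induction f using FreeGroup.induction_on with
    | C1 => simpa using hr 1
    | of k => exact h2 k
    | inv_of k _ => rw [map_inv]; exact inv _ (h2 k)
    | mul x y hx hy => rw [map_mul]; exact mul _ _ hx hy
  rw [← SemidirectProduct.inl_left_mul_inr_right h]
  exact mul _ _ (h1 _) (hr _)

/-- The transposition `(i, i + 1)` of natural numbers. -/
def natSwap (i k : ℕ) : ℕ := if k = i then i + 1 else if k = i + 1 then i else k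

theorem natSwap_natSwap (i k : ℕ) : natSwap i (natSwap i k) = k := by
  unfold natSwap; split_ifs <;> omega

/-- The cocycle describing the action of the braid group on the cosets of the stabilizer of the
last strand. -/
def coc (m i k : ℕ) : ABraid m :=
  if k < i then inr (sg m (i - 1)) else if k = i then inl (yy m i) else if k = i + 1 then 1
  else if k ≤ m + 1 then inr (sg m i) else 1

theorem natSwap_of_ne {i k : ℕ} (h1 : k ≠ i) (h2 : k ≠ i + 1) : natSwap i k = k := by
  rw [natSwap, if_neg h1, if_neg h2]

/-- The permutation by which a generator acts on cosets. -/
def cosetEquiv (m i : ℕ) : Equiv.Perm (ℕ × ABraid m) where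
  toFun p := (natSwap i p.1, coc m i p.1 * p.2)
  invFun p := (natSwap i p.1, (coc m i (natSwap i p.1))⁻¹ * p.2)
  left_inv p := by simp [natSwap_natSwap]
  right_inv p := by simp [natSwap_natSwap]

/-- The permutations by which the generators act on cosets. -/
def cosetSeq (m i : ℕ) : Equiv.Perm (ℕ × ABraid m) := if i ≤ m then cosetEquiv m i else 1

theorem cosetSeq_apply {i : ℕ} (hi : i ≤ m) (k : ℕ) (h : ABraid m) :
    cosetSeq m i (k, h) = (natSwap i k, coc m i k * h) := by
  rw [cosetSeq, if_pos hi]; rfl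

theorem cosetSeq_of_lt {i k : ℕ} (hi : i ≤ m) (hk : k < i) (h : ABraid m) :
    cosetSeq m i (k, h) = (k, inr (sg m (i - 1)) * h) := by
  rw [cosetSeq_apply hi, natSwap_of_ne (by omega) (by omega), coc, if_pos hk]

theorem cosetSeq_self {i : ℕ} (hi : i ≤ m) (h : ABraid m) :
    cosetSeq m i (i, h) = (i + 1, inl (yy m i) * h) := by
  simp [cosetSeq_apply hi, natSwap, coc]

theorem cosetSeq_succ {i : ℕ} (hi : i ≤ m) (h : ABraid m) :
    cosetSeq m i (i + 1, h) = (i, h) := by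
  simp [cosetSeq_apply hi, natSwap, coc]

theorem cosetSeq_of_gt {i k : ℕ} (hi : i + 1 < k) (hk : k ≤ m + 1) (h : ABraid m) :
    cosetSeq m i (k, h) = (k, inr (sg m i) * h) := by
  rw [cosetSeq_apply (by omega), natSwap_of_ne (by omega) (by omega), coc, if_neg (by omega),
    if_neg (by omega), if_neg (by omega), if_pos hk]

theorem cosetSeq_of_big (i : ℕ) {k : ℕ} (hk : m + 1 < k) (h : ABraid m) :
    cosetSeq m i (k, h) = (k, h) := by
  by_cases hi : i ≤ m
  · rw [cosetSeq_apply hi, natSwap_of_ne (by omega) (by omega), coc, if_neg (by omega),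
      if_neg (by omega), if_neg (by omega), if_neg (by omega), one_mul]
  · rw [cosetSeq, if_neg hi]; rfl

theorem inr_mul_inl (b : BraidGroup m) (f : FreeGroup (Fin (m + 1))) (h : ABraid m) :
    inr b * (inl f * h) = inl (art m b f) * (inr b * h) := by
  rw [← inr_mul_inl_mul_inr]
  group

theorem isBraidSeq_cosetSeq (m : ℕ) : IsBraidSeq (cosetSeq m) (m + 1) where
  far {i j} hij := by
    by_cases hj : j ≤ m
    swap
    · simp [cosetSeq, hj]
    have hi : i ≤ m := by omega
    have hfar {a b : ℕ} (h : a + 2 ≤ b) (x : ABraid m) :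
        inr (sg m a) * (inr (sg m b) * x) = inr (sg m b) * (inr (sg m a) * x) := by
      rw [← mul_assoc, ← map_mul, (isBraidSeq_sg m).far h, map_mul, mul_assoc]
    refine Equiv.ext fun ⟨k, h⟩ => ?_
    simp only [Equiv.Perm.mul_apply]
    by_cases hkm : m + 1 < k
    · simp only [cosetSeq_of_big _ hkm]
    rcases lt_trichotomy k i with hk | rfl | hk
    · simp only [cosetSeq_of_lt hi hk, cosetSeq_of_lt hj (show k < j by omega)]
      rw [hfar (by omega)]
    · simp only [cosetSeq_self hi, cosetSeq_of_lt hj (show k < j by omega),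
        cosetSeq_of_lt hj (show k + 1 < j by omega)]
      rw [inr_mul_inl, art_sg_of_ne (by omega) (by omega)]
    rcases (show i + 1 ≤ k from hk).eq_or_lt with rfl | hk
    · simp only [cosetSeq_succ hi, cosetSeq_of_lt hj (show i < j by omega),
        cosetSeq_of_lt hj (show i + 1 < j by omega)]
    have hgt := cosetSeq_of_gt hk (not_lt.1 hkm)
    rcases lt_trichotomy k j with hk' | rfl | hk'
    · simp only [hgt, cosetSeq_of_lt hj hk']
      rw [hfar (by omega)]
    · simp only [hgt, cosetSeq_self hj, cosetSeq_of_gt (show i + 1 < k + 1 by omega)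
        (show k + 1 ≤ m + 1 by omega)]
      rw [inr_mul_inl, art_sg_of_ne (by omega) (by omega)]
    rcases (show j + 1 ≤ k from hk').eq_or_lt with rfl | hk'
    · simp only [hgt, cosetSeq_succ hj, cosetSeq_of_gt (show i + 1 < j by omega)
        (show j ≤ m + 1 by omega)]
    · simp only [hgt, cosetSeq_of_gt hk' (not_lt.1 hkm)]
      rw [hfar (by omega)]
  braid {i} hi' := by
    have hi : i ≤ m := by omega
    have hj : i + 1 ≤ m := by omega
    have hbr {i : ℕ} (h : i + 1 < m) (x : ABraid m) :
        inr (sg m i) * (inr (sg m (i + 1)) * (inr (sg m i) * x)) =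
          inr (sg m (i + 1)) * (inr (sg m i) * (inr (sg m (i + 1)) * x)) := by
      simp only [← mul_assoc]
      simp only [← map_mul, (isBraidSeq_sg m).braid h]
    refine Equiv.ext fun ⟨k, h⟩ => ?_
    simp only [Equiv.Perm.mul_apply]
    by_cases hkm : m + 1 < k
    · simp only [cosetSeq_of_big _ hkm]
    rcases lt_trichotomy k i with hk | rfl | hk
    · obtain ⟨i, rfl⟩ : ∃ i', i = i' + 1 := ⟨i - 1, by omega⟩
      simp only [cosetSeq_of_lt hi hk, cosetSeq_of_lt hj (show k < i + 1 + 1 by omega)]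
      exact congrArg _ (hbr (by omega) h)
    · simp only [cosetSeq_self hi, cosetSeq_self hj, cosetSeq_of_lt hj (show k < k + 1 by omega),
        cosetSeq_of_gt (show k + 1 < k + 1 + 1 by omega) (show k + 1 + 1 ≤ m + 1 by omega),
        Nat.add_sub_cancel]
      rw [inr_mul_inl, inr_mul_inl, art_sg_succ (by omega), art_sg_self (by omega),
        map_mul, map_mul, map_inv]
      congr 1
      group
    rcases (show i + 1 ≤ k from hk).eq_or_lt with rfl | hk
    · simp only [cosetSeq_succ hi, cosetSeq_succ hj, cosetSeq_self hi, cosetSeq_self hj,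
        cosetSeq_of_lt hj (show i < i + 1 by omega),
        cosetSeq_of_gt (show i + 1 < i + 1 + 1 by omega) (show i + 1 + 1 ≤ m + 1 by omega),
        Nat.add_sub_cancel]
      rw [inr_mul_inl, art_sg_succ (by omega)]
    rcases (show i + 1 + 1 ≤ k from hk).eq_or_lt with rfl | hk
    · simp only [cosetSeq_succ hi, cosetSeq_succ hj,
        cosetSeq_of_lt hj (show i < i + 1 by omega),
        cosetSeq_of_gt (show i + 1 < i + 1 + 1 by omega) (show i + 1 + 1 ≤ m + 1 by omega),
        Nat.add_sub_cancel]
    · simp only [cosetSeq_of_gt (show i + 1 < k by omega) (not_lt.1 hkm),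
        cosetSeq_of_gt hk (not_lt.1 hkm)]
      exact congrArg _ (hbr (by omega) h)

/-- The action of the braid group on the cosets of the stabilizer of the last strand. -/
def cosetAct (m : ℕ) : BraidGroup (m + 1) →* Equiv.Perm (ℕ × ABraid m) :=
  lift (cosetSeq m) (isBraidSeq_cosetSeq m)

theorem cosetAct_sg {i : ℕ} (hi : i ≤ m) : cosetAct m (sg (m + 1) i) = cosetSeq m i :=
  lift_sg _ _ (by omega)

theorem cosetAct_mul (b : BraidGroup (m + 1)) (k : ℕ) (h h' : ABraid m) :
    cosetAct m b (k, h * h') = ((cosetAct m b (k, h)).1, (cosetAct m b (k, h)).2 * h') := by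
  induction b using induction generalizing k h h' with
  | one => simp
  | gen i hi =>
    simp only [cosetAct_sg (show i ≤ m by omega), cosetSeq_apply (show i ≤ m by omega), mul_assoc]
  | mul a b ha hb => simp only [map_mul, Equiv.Perm.mul_apply, hb, ha]
  | inv a ha =>
    rw [map_inv, Equiv.Perm.inv_eq_iff_eq, ha, Prod.mk.eta, ← Equiv.Perm.mul_apply,
      mul_inv_cancel, Equiv.Perm.one_apply]

theorem cosetAct_fst (b : BraidGroup (m + 1)) (k : Fin (m + 2)) (h : ABraid m) :
    (cosetAct m b (k, h)).1 = prm (m + 1) b k := by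
  induction b using induction generalizing k h with
  | one => simp
  | gen i hi =>
    rw [cosetAct_sg (by omega), cosetSeq_apply (by omega), prm_sg hi, Equiv.swap_apply_def,
      natSwap]
    simp only [Fin.ext_iff]
    split_ifs <;> simp_all
  | mul a b ha hb =>
    simp only [map_mul, Equiv.Perm.mul_apply]
    rw [← ha _ (cosetAct m b (k, h)).2, ← hb k h]
  | inv a ha =>
    set i := prm (m + 1) a⁻¹ k with hi
    have h1 : prm (m + 1) a i = k := by
      rw [hi, ← Equiv.Perm.mul_apply, ← map_mul]; simp
    obtain ⟨c, hc⟩ : ∃ c, cosetAct m a (i, 1) = ((k : ℕ), c) :=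
      ⟨_, Prod.ext ((ha i 1).trans (by rw [h1])) rfl⟩
    have h2 := cosetAct_mul a i 1 (c⁻¹ * h)
    rw [one_mul, hc, mul_inv_cancel_left] at h2
    rw [map_inv, ← h2, ← Equiv.Perm.mul_apply, inv_mul_cancel, Equiv.Perm.one_apply]

/-- The stabilizer of the last strand. -/
def lastStab (m : ℕ) : Subgroup (BraidGroup (m + 1)) :=
  (MulAction.stabilizer (Equiv.Perm (Fin (m + 2))) (Fin.last (m + 1))).comap (prm (m + 1))

theorem mem_lastStab {b : BraidGroup (m + 1)} :
    b ∈ lastStab m ↔ prm (m + 1) b (Fin.last (m + 1)) = Fin.last (m + 1) := Iff.rfl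

/-- The canonical homomorphism from the stabilizer of the last strand to `ABraid m`. -/
def kap (m : ℕ) : lastStab m →* ABraid m :=
  MonoidHom.mk' (fun b => (cosetAct m b (m + 1, 1)).2) fun a b => by
    have h : (cosetAct m b (m + 1, 1)).1 = m + 1 := by
      simpa [mem_lastStab.1 b.2] using cosetAct_fst (b : BraidGroup (m + 1)) (Fin.last (m + 1)) 1
    have h1 : cosetAct m b (m + 1, 1) = (m + 1, (cosetAct m b (m + 1, 1)).2) := Prod.ext h rfl
    rw [Subgroup.coe_mul, map_mul, Equiv.Perm.mul_apply, h1]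
    have h2 := cosetAct_mul (a : BraidGroup (m + 1)) (m + 1) 1 (cosetAct m b (m + 1, 1)).2
    rw [one_mul] at h2
    rw [h2]

theorem cosetAct_last (b : lastStab m) : cosetAct m b (m + 1, 1) = (m + 1, kap m b) := by
  refine Prod.ext ?_ rfl
  simpa [mem_lastStab.1 b.2] using cosetAct_fst (b : BraidGroup (m + 1)) (Fin.last (m + 1)) 1

theorem kap_eq_of_cosetAct {b : lastStab m} {h : ABraid m}
    (hb : cosetAct m b (m + 1, 1) = (m + 1, h)) : kap m b = h := by
  rw [cosetAct_last] at hb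
  exact (Prod.mk.inj hb).2

theorem incl_mem (b : BraidGroup m) : incl m b ∈ lastStab m := prm_incl_last b

theorem seqLoop_mem (k : ℕ) : seqLoop (sg (m + 1)) k ∈ lastStab m := by
  rw [mem_lastStab, prm_seqLoop]; rfl

theorem kap_incl (b : BraidGroup m) : kap m ⟨incl m b, incl_mem b⟩ = inr b := by
  suffices h : (kap m).comp ((incl m).codRestrict (lastStab m) incl_mem) = inr from
    DFunLike.congr_fun h b
  refine hom_ext fun i hi => kap_eq_of_cosetAct ?_
  change cosetAct m (incl m (sg m i)) (m + 1, 1) = _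
  rw [incl_sg hi, cosetAct_sg hi.le, cosetSeq_of_gt (by omega) le_rfl, mul_one]

theorem cosetAct_seqLoop {k : ℕ} (hk : k ≤ m + 1) (h : ABraid m) :
    cosetAct m (seqLoop (sg (m + 1)) k) (k, h) = (k, inl (cprod m k) * h) := by
  induction k generalizing h with
  | zero => simp [seqLoop, cprod]
  | succ k ih =>
    rw [seqLoop, map_mul, map_mul, cosetAct_sg (by omega), Equiv.Perm.mul_apply,
      Equiv.Perm.mul_apply, cosetSeq_succ (by omega), ih (by omega), cosetSeq_self (by omega),
      cprod, map_mul, mul_assoc]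

theorem kap_seqLoop : kap m ⟨_, seqLoop_mem (m + 1)⟩ = inl (cprod m (m + 1)) := by
  apply kap_eq_of_cosetAct
  rw [cosetAct_seqLoop le_rfl, mul_one]

theorem zz_mem : zz (m + 1) ∈ lastStab m := by
  rw [mem_lastStab, prm_zz]; rfl

theorem kap_zz : kap m ⟨zz (m + 1), zz_mem⟩ = inl (cprod m (m + 1)) * inr (zz m) := by
  rw [← kap_seqLoop, ← kap_incl, ← map_mul]
  congr 1
  exact Subtype.ext zz_succ

end BraidGroup

theorem IsBraidSeq.seqRun_succ_mul {G : Type*} [Group G] {s : ℕ → G} {N : ℕ} (h : IsBraidSeq s N)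
    {k l n : ℕ} (hl : l < n) (hN : k + n ≤ N) :
    seqRun s (k + 1) l * seqRun s k n = seqRun s k n * seqRun s k l := by
  induction l with
  | zero => simp [seqRun]
  | succ l ih =>
    rw [seqRun_succ_right, seqRun_succ_right, mul_assoc, show k + 1 + l = k + l + 1 by ring,
      h.mul_seqRun (by omega) (by omega) (by omega), ← mul_assoc, ih (by omega), mul_assoc]

namespace BraidGroup

open SemidirectProduct (inl inr)

variable {m : ℕ}

/-- The inverse of `kap`, as a homomorphism to the whole braid group. -/
def unkap (m : ℕ) : ABraid m →* BraidGroup (m + 1) :=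
  annLift (incl m) (sg (m + 1) m * sg (m + 1) m)
    (fun i hi => by
      rw [incl_sg (by omega)]
      have h : Commute (sg (m + 1) i) (sg (m + 1) m) :=
        (isBraidSeq_sg (m + 1)).far (by omega)
      exact h.mul_right h)
    (fun i hi => by
      subst hi
      rw [incl_sg (by omega)]
      have h := (isBraidSeq_sg (i + 1 + 1)).braid (show i + 1 < i + 1 + 1 by omega)
      generalize sg (i + 1 + 1) i = s at *
      generalize sg (i + 1 + 1) (i + 1) = b at *
      calc s * (b * b) * s * (b * b) = s * b * (b * s * b) * b := by group
        _ = s * b * s * (b * s * b) := by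
          rw [← congrArg (s * b * · * b) h]; simp only [mul_assoc]
        _ = b * s * b * (s * b * s) := by rw [h]
        _ = b * (s * b * s) * (b * s) := by simp only [mul_assoc]
        _ = b * b * s * (b * b) * s := by rw [h]; simp only [mul_assoc])

theorem unkap_inr (b : BraidGroup m) : unkap m (inr b) = incl m b := annLift_inr _ _ _ _ b

theorem unkap_last : unkap m (inl (yy m m)) = sg (m + 1) m * sg (m + 1) m :=
  annLift_inl_last _ _ _ _

theorem unkap_yy {k : ℕ} (hk : k ≤ m) :
    seqRun (sg (m + 1)) (k + 1) (m - k) * unkap m (inl (yy m k)) =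
      sg (m + 1) k * seqRun (sg (m + 1)) k (m + 1 - k) := by
  have h1 : annSeq (fun i => incl m (sg m i)) (sg (m + 1) m * sg (m + 1) m) m k =
      annSeq (sg (m + 1)) (sg (m + 1) m * sg (m + 1) m) m k := by
    rw [annSeq, annSeq, seqRun_congr fun i hi => incl_sg (show i < m by omega)]
  have h2 := (isBraidSeq_sg (m + 1)).seqRun_succ_mul (show m - k < m + 1 - k by omega)
    (show k + (m + 1 - k) ≤ m + 1 by omega)
  rw [unkap, annLift_inl_yy _ _ _ _ hk, h1, annSeq]
  rw [show m + 1 - k = m - k + 1 by omega] at *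
  have h3 := seqRun_succ_right (sg (m + 1)) k (m - k)
  rw [show k + (m - k) = m by omega] at h3
  have h4 : seqRun (sg (m + 1)) k (m - k + 1) =
    sg (m + 1) k * seqRun (sg (m + 1)) (k + 1) (m - k) := rfl
  generalize seqRun (sg (m + 1)) k (m - k + 1) = t at *
  generalize seqRun (sg (m + 1)) (k + 1) (m - k) = t' at *
  generalize seqRun (sg (m + 1)) k (m - k) = r at *
  generalize sg (m + 1) m = u at *
  generalize sg (m + 1) k = v at *
  calc t' * (r * (u * u) * r⁻¹) = (t' * (r * u)) * u * r⁻¹ := by group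
    _ = t * (r * u) * r⁻¹ := by rw [← h3, h2]; simp only [h3, mul_assoc]
    _ = v * (t' * t) * r⁻¹ := by rw [← h3]; nth_rewrite 1 [h4]; group
    _ = v * t := by rw [h2]; group

theorem mul_seqRun_mul_unkap (b : BraidGroup (m + 1)) {k : ℕ} (hk : k ≤ m + 1) (h : ABraid m) :
    b * (seqRun (sg (m + 1)) k (m + 1 - k) * unkap m h) =
      seqRun (sg (m + 1)) (cosetAct m b (k, h)).1 (m + 1 - (cosetAct m b (k, h)).1) *
        unkap m (cosetAct m b (k, h)).2 := by
  have hle (b : BraidGroup (m + 1)) {k : ℕ} (hk : k ≤ m + 1) (h : ABraid m) :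
      (cosetAct m b (k, h)).1 ≤ m + 1 := by
    have h1 := cosetAct_fst b ⟨k, by omega⟩ h
    dsimp only at h1
    rw [h1]
    omega
  induction b using induction generalizing k h with
  | one => simp
  | gen i hi =>
    have hi' : i ≤ m := by omega
    have hs := isBraidSeq_sg (m + 1)
    rw [cosetAct_sg hi', ← mul_assoc]
    rcases lt_trichotomy k i with hki | rfl | hki
    · obtain ⟨i, rfl⟩ : ∃ j, i = j + 1 := ⟨i - 1, by omega⟩
      rw [cosetSeq_of_lt hi' hki, map_mul, Nat.add_sub_cancel, unkap_inr, incl_sg (by omega),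
        hs.mul_seqRun (by omega) (by omega) (by omega), mul_assoc]
    · rw [cosetSeq_self hi', map_mul, show m + 1 - (k + 1) = m - k by omega, ← mul_assoc,
        unkap_yy hi']
    rcases (show i + 1 ≤ k from hki).eq_or_lt with rfl | hki
    · rw [cosetSeq_succ hi', show m + 1 - i = m + 1 - (i + 1) + 1 by omega]
      rfl
    · rw [cosetSeq_of_gt hki hk, map_mul, unkap_inr, incl_sg (by omega),
        (hs.commute_seqRun_of_lt (by omega) _).eq, mul_assoc]
  | mul a b ha hb =>
    rw [mul_assoc, hb hk, map_mul, Equiv.Perm.mul_apply, ha (hle b hk h)]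
  | inv a ha =>
    have h1 := ha (hle a⁻¹ hk h) (cosetAct m a⁻¹ (k, h)).2
    rw [Prod.mk.eta, ← Equiv.Perm.mul_apply, ← map_mul, mul_inv_cancel, map_one,
      Equiv.Perm.one_apply] at h1
    rw [← h1, inv_mul_cancel_left]

theorem unkap_kap (b : lastStab m) : unkap m (kap m b) = b := by
  have h := mul_seqRun_mul_unkap (b : BraidGroup (m + 1)) (le_refl (m + 1)) 1
  rw [cosetAct_last] at h
  simpa [seqRun] using h.symm

theorem kap_injective : Function.Injective (kap m) := fun a b h =>
  Subtype.ext (by rw [← unkap_kap a, h, unkap_kap])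

theorem unkap_mem (h : ABraid m) : unkap m h ∈ lastStab m := by
  induction h using ABraid.induction with
  | hr b => rw [unkap_inr]; exact incl_mem b
  | hl =>
    rw [unkap_last, mem_lastStab, map_mul, prm_sg_mul_self]; rfl
  | mul a b ha hb => rw [map_mul]; exact mul_mem ha hb
  | inv a ha => rw [map_inv]; exact inv_mem ha

theorem kap_unkap (h : ABraid m) : kap m ⟨unkap m h, unkap_mem h⟩ = h := by
  suffices h' : (kap m).comp ((unkap m).codRestrict (lastStab m) unkap_mem) = MonoidHom.id _ from
    DFunLike.congr_fun h' h
  refine ABraid.hom_ext (fun b => ?_) ?_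
  · rw [MonoidHom.id_apply]
    refine Eq.trans ?_ (kap_incl b)
    exact congrArg (kap m) (Subtype.ext (a2 := ⟨incl m b, incl_mem b⟩) (unkap_inr b))
  · refine kap_eq_of_cosetAct ?_
    change cosetAct m (unkap m (inl (yy m m))) (m + 1, 1) = _
    rw [unkap_last, map_mul, cosetAct_sg le_rfl, Equiv.Perm.mul_apply, cosetSeq_succ le_rfl,
      cosetSeq_self le_rfl, mul_one, MonoidHom.id_apply]

theorem prm_unkap_castSucc (h : ABraid m) (i : Fin (m + 1)) :
    prm (m + 1) (unkap m h) i.castSucc = (prm m h.right i).castSucc := by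
  induction h using ABraid.induction generalizing i with
  | hr b => rw [unkap_inr, prm_incl_castSucc, SemidirectProduct.right_inr]
  | hl => rw [unkap_last, map_mul, prm_sg_mul_self, SemidirectProduct.right_inl, map_one]; rfl
  | mul a b ha hb =>
    rw [map_mul, map_mul, Equiv.Perm.mul_apply, hb, ha, SemidirectProduct.mul_right, map_mul,
      Equiv.Perm.mul_apply]
  | inv a ha =>
    rw [map_inv, map_inv, Equiv.Perm.inv_eq_iff_eq, ha, SemidirectProduct.inv_right,
      ← Equiv.Perm.mul_apply, ← map_mul, mul_inv_cancel, map_one, Equiv.Perm.one_apply]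

theorem prm_castSucc (b : lastStab m) (i : Fin (m + 1)) :
    prm (m + 1) b i.castSucc = (prm m (kap m b).right i).castSucc := by
  rw [← prm_unkap_castSucc, unkap_kap]

end BraidGroup

namespace FreeGroup

theorem exists_zpow_eq_of_commute {ι : Type*} {u v : FreeGroup ι} (h : Commute u v)
    (hv : v ≠ 1) : ∃ a : ℤ, a ≠ 0 ∧ ∃ b : ℤ, u ^ a = v ^ b := by
  have hcomm : ∀ x ∈ ({u, v} : Set (FreeGroup ι)), ∀ y ∈ ({u, v} : Set (FreeGroup ι)),
      x * y = y * x := by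
    rintro x (rfl | rfl) y (rfl | rfl)
    exacts [rfl, h.eq, h.eq.symm, rfl]
  let H := Subgroup.closure ({u, v} : Set (FreeGroup ι))
  have hH : ∀ x y : H, x * y = y * x := (Subgroup.isMulCommutative_closure hcomm).is_comm.comm
  have : Subsingleton (IsFreeGroup.Generators H) := ⟨fun x y => by
    have h1 := congrArg (IsFreeGroup.toFreeGroup H)
      (hH ((IsFreeGroup.toFreeGroup H).symm (.of x)) ((IsFreeGroup.toFreeGroup H).symm (.of y)))
    simp only [_root_.map_mul, MulEquiv.apply_symm_apply] at h1
    by_contra hxy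
    classical
    have h2 := congrArg (FreeGroup.lift fun i =>
      if i = x then Equiv.swap (0 : Fin 3) 1 else Equiv.swap 1 2) h1
    simp only [_root_.map_mul, FreeGroup.lift_apply_of, if_true, if_neg (Ne.symm hxy)] at h2
    exact absurd h2 (by decide)⟩
  obtain ⟨g, hg⟩ : ∃ g : H, ∀ x : H, ∃ k : ℤ, x = g ^ k := by
    by_cases hne : Nonempty (IsFreeGroup.Generators H)
    · obtain ⟨i⟩ := hne
      refine ⟨(IsFreeGroup.toFreeGroup H).symm (.of i), fun x => ?_⟩
      obtain ⟨y, rfl⟩ := (IsFreeGroup.toFreeGroup H).symm.surjective x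
      simp only [← map_zpow, EmbeddingLike.apply_eq_iff_eq]
      induction y using FreeGroup.induction_on with
      | C1 => exact ⟨0, by simp⟩
      | of j => exact ⟨1, by rw [Subsingleton.elim j i, zpow_one]⟩
      | inv_of j _ => exact ⟨-1, by rw [Subsingleton.elim j i, zpow_neg, zpow_one]⟩
      | mul a b ha hb =>
        obtain ⟨k, rfl⟩ := ha
        obtain ⟨l, rfl⟩ := hb
        exact ⟨k + l, (zpow_add _ _ _).symm⟩
    · rw [not_nonempty_iff] at hne
      exact ⟨1, fun x => ⟨0, (IsFreeGroup.toFreeGroup H).injective (Subsingleton.elim _ _)⟩⟩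
  obtain ⟨i, hi⟩ := hg ⟨u, Subgroup.subset_closure (by simp)⟩
  obtain ⟨j, hj⟩ := hg ⟨v, Subgroup.subset_closure (by simp)⟩
  replace hi : u = (g : FreeGroup ι) ^ i := congrArg Subtype.val hi
  replace hj : v = (g : FreeGroup ι) ^ j := congrArg Subtype.val hj
  refine ⟨j, ?_, i, ?_⟩
  · rintro rfl
    exact hv (by simpa using hj)
  · rw [hi, hj, ← zpow_mul, ← zpow_mul, mul_comm]

theorem of_zpow_ne_one {ι : Type*} (i : ι) {k : ℤ} (hk : k ≠ 0) :
    (FreeGroup.of i) ^ k ≠ 1 := by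
  rw [Ne, IsMulTorsionFree.zpow_eq_one_iff_left hk]
  exact FreeGroup.of_ne_one i

theorem eq_one_of_forall_commute {ι : Type*} [Nontrivial ι] {u : FreeGroup ι}
    (h : ∀ i, Commute (FreeGroup.of i) u) : u = 1 := by
  by_contra hu
  obtain ⟨i, j, hij⟩ := exists_pair_ne ι
  obtain ⟨a, ha, b, hab⟩ := exists_zpow_eq_of_commute (h i) hu
  obtain ⟨c, hc, d, hcd⟩ := exists_zpow_eq_of_commute (h j) hu
  have h1 : (FreeGroup.of i) ^ (a * d) = (FreeGroup.of j) ^ (c * b) := by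
    rw [zpow_mul, zpow_mul, hab, hcd, ← zpow_mul, ← zpow_mul, mul_comm]
  classical
  have h2 := congrArg (FreeGroup.lift fun k => if k = i then Multiplicative.ofAdd (1 : ℤ) else 1) h1
  simp only [map_zpow, FreeGroup.lift_apply_of, if_true, if_neg hij.symm, one_zpow,
    ← ofAdd_zsmul] at h2
  have h3 : a * d = 0 := by simpa using h2
  have h4 : d = 0 := by simpa [ha] using h3
  rw [h4, zpow_zero] at hcd
  exact of_zpow_ne_one j hc hcd

end FreeGroup

/-- The free abelian group of rank `d`, written multiplicatively. -/
abbrev FreeAb (d : ℕ) : Type := Multiplicative (Fin d → ℤ)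

namespace FreeAb

variable {G : Type*} [Group G] {d : ℕ}

/-- Extend a homomorphism from `FreeAb d` by an element commuting with its image. -/
def cons (t : G) (f : FreeAb d →* G) (h : ∀ v, Commute t (f v)) : FreeAb (d + 1) →* G :=
  MonoidHom.mk' (fun v => t ^ (v.toAdd 0) * f (.ofAdd (Fin.tail v.toAdd))) fun v w => by
    have h1 := ((h (.ofAdd (Fin.tail v.toAdd))).zpow_left (w.toAdd 0)).eq
    have h2 : Multiplicative.ofAdd (Fin.tail (v * w).toAdd) =
      .ofAdd (Fin.tail v.toAdd) * .ofAdd (Fin.tail w.toAdd) := rfl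
    have h3 : (v * w).toAdd 0 = v.toAdd 0 + w.toAdd 0 := rfl
    rw [h2, h3, map_mul, zpow_add]
    simp only [mul_assoc]
    rw [← mul_assoc (f _) (t ^ _), ← h1, mul_assoc]

theorem cons_apply (t : G) (f : FreeAb d →* G) (h : ∀ v, Commute t (f v)) (v : FreeAb (d + 1)) :
    cons t f h v = t ^ (v.toAdd 0) * f (.ofAdd (Fin.tail v.toAdd)) := rfl

theorem eq_one_of_tail {v : FreeAb (d + 1)} (h0 : v.toAdd 0 = 0)
    (h : Multiplicative.ofAdd (Fin.tail v.toAdd) = 1) : v = 1 := by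
  refine congrArg Multiplicative.ofAdd (funext fun i => ?_)
  induction i using Fin.cases with
  | zero => exact h0
  | succ i => exact congrFun (congrArg Multiplicative.toAdd h) i

theorem powMonoidHom_injective {N : ℕ} (hN : N ≠ 0) :
    Function.Injective (powMonoidHom N : FreeAb d →* FreeAb d) := by
  refine (injective_iff_map_eq_one _).2 fun v hv => ?_
  refine congrArg Multiplicative.ofAdd (funext fun i => ?_)
  have h1 : N • v.toAdd i = 0 := congrFun (congrArg Multiplicative.toAdd hv) i
  exact (smul_eq_zero.1 h1).resolve_left hN

/-- The embedding inserting a zero coordinate. -/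
def insert (i : Fin (d + 1)) : FreeAb d →* FreeAb (d + 1) :=
  MonoidHom.mk' (fun v => .ofAdd (i.insertNth 0 v.toAdd)) fun v w => by
    rw [← ofAdd_add]
    refine congrArg _ (funext fun j => ?_)
    induction j using i.succAboveCases with
    | x => simp
    | p j => simp

theorem insert_injective (i : Fin (d + 1)) :
    Function.Injective (insert i : FreeAb d →* FreeAb (d + 1)) := fun v w h => by
  have h1 : i.insertNth (α := fun _ => ℤ) 0 v.toAdd = i.insertNth 0 w.toAdd := h
  exact congrArg Multiplicative.ofAdd ((Fin.insertNth_right_injective _) h1)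

/-- A homomorphism into a semidirect product with free kernel that is injective remains injective
modulo that kernel on a free abelian subgroup of corank one. -/
theorem exists_injective_right {ι B : Type*} [Group B] {α : B →* MulAut (FreeGroup ι)}
    (g : FreeAb (d + 1) →* FreeGroup ι ⋊[α] B) (hg : Function.Injective g) :
    ∃ f : FreeAb d →* FreeAb (d + 1),
      Function.Injective (SemidirectProduct.rightHom.comp (g.comp f)) := by
  by_cases h : ∃ v, v ≠ 1 ∧ (g v).right = 1
  · obtain ⟨v, hv, hgv⟩ := h
    obtain ⟨i, hi⟩ : ∃ i, v.toAdd i ≠ 0 := by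
      by_contra! h
      exact hv (congrArg Multiplicative.ofAdd (funext h))
    refine ⟨insert i, (injective_iff_map_eq_one _).2 fun u hu => ?_⟩
    have h1 {w : FreeAb (d + 1)} (hw : (g w).right = 1) : g w = SemidirectProduct.inl (g w).left := by
      conv_lhs => rw [← SemidirectProduct.inl_left_mul_inr_right (g w), hw, map_one, mul_one]
    have h2 := h1 hgv
    have h3 := h1 (w := insert i u) hu
    have h4 : Commute (g (insert i u)).left (g v).left := by
      apply SemidirectProduct.inl_injective (φ := α)
      rw [map_mul, map_mul, ← h2, ← h3, ← map_mul, ← map_mul, mul_comm]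
    obtain ⟨a, ha, b, hab⟩ := FreeGroup.exists_zpow_eq_of_commute h4 (fun h => hv (hg (by
      rw [h2, h, map_one, map_one])))
    have h5 : insert i u ^ a = v ^ b := hg (by
      rw [map_zpow, map_zpow, h2, h3, ← map_zpow, ← map_zpow, hab])
    have h6 : a * (insert i u).toAdd i = b * v.toAdd i :=
      congrFun (congrArg Multiplicative.toAdd h5) i
    have h7 : (insert i u).toAdd i = 0 :=
      Fin.insertNth_apply_same (α := fun _ => ℤ) i 0 u.toAdd
    rw [h7, mul_zero] at h6
    have h8 : b = 0 := by simpa [hi] using h6.symm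
    rw [h8, zpow_zero] at h5
    apply insert_injective i
    refine (powMonoidHom_injective (N := a.natAbs) (by simpa using ha)) ?_
    rw [map_one, map_one, powMonoidHom_apply]
    exact pow_natAbs_eq_one.2 h5
  · push Not at h
    refine ⟨insert 0, (injective_iff_map_eq_one _).2 fun u hu => ?_⟩
    by_contra hne
    exact h (insert 0 u) (fun h => hne (insert_injective 0 (h.trans (map_one _).symm))) hu

end FreeAb

namespace BraidGroup

open SemidirectProduct (inl inr)

variable {m : ℕ}

theorem eq_one_of_zero (b : BraidGroup 0) : b = 1 := by
  induction b using induction with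
  | one => rfl
  | gen i hi => omega
  | mul a b ha hb => rw [ha, hb, mul_one]
  | inv a ha => rw [ha, inv_one]

theorem pow_factorial_mem (b : BraidGroup (m + 1)) : b ^ (m + 2).factorial ∈ lastStab m := by
  have h : prm (m + 1) b ^ (m + 2).factorial = 1 := by
    have h := pow_card_eq_one' (x := prm (m + 1) b)
    rwa [Nat.card_perm, Nat.card_fin] at h
  rw [mem_lastStab, map_pow, h]
  rfl

/-- The restriction of a homomorphism from a free abelian group to a subgroup of finite index mapped
into the stabilizer of the last strand. -/
def restr {d : ℕ} (f : FreeAb d →* BraidGroup (m + 1)) : FreeAb d →* lastStab m :=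
  (f.comp (powMonoidHom (m + 2).factorial)).codRestrict _ fun v => by
    rw [MonoidHom.comp_apply, powMonoidHom_apply, map_pow]
    exact pow_factorial_mem _

theorem coe_restr {d : ℕ} (f : FreeAb d →* BraidGroup (m + 1)) (v : FreeAb d) :
    (restr f v : BraidGroup (m + 1)) = f (v ^ (m + 2).factorial) := rfl

theorem restr_injective {d : ℕ} {f : FreeAb d →* BraidGroup (m + 1)} (hf : Function.Injective f) :
    Function.Injective (restr f) := fun _ _ h =>
  FreeAb.powMonoidHom_injective (Nat.factorial_ne_zero _) (hf (congrArg Subtype.val h))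

theorem exists_injective_right_kap {d : ℕ} {f : FreeAb (d + 1) →* BraidGroup (m + 1)}
    (hf : Function.Injective f) :
    ∃ g : FreeAb d →* FreeAb (d + 1),
      Function.Injective (SemidirectProduct.rightHom.comp (((kap m).comp (restr f)).comp g)) :=
  FreeAb.exists_injective_right _ (kap_injective.comp (restr_injective hf))

theorem le_of_injective {d : ℕ} {f : FreeAb d →* BraidGroup m} (hf : Function.Injective f) :
    d ≤ m := by
  induction m generalizing d with
  | zero =>
    rcases d with _ | d
    · rfl
    · have h : Multiplicative.ofAdd (fun _ => 1 : Fin (d + 1) → ℤ) = 1 :=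
        hf ((eq_one_of_zero _).trans (eq_one_of_zero _).symm)
      exact absurd (congrFun (congrArg Multiplicative.toAdd h) 0) one_ne_zero
  | succ m ih =>
    rcases d with _ | d
    · exact Nat.zero_le _
    · obtain ⟨g, hg⟩ := exists_injective_right_kap hf
      exact Nat.succ_le_succ (ih hg)

theorem exists_ne_one_of_hom {f : FreeAb (m + 1) →* BraidGroup (m + 1)}
    (hf : Function.Injective f) (χ : lastStab m →* BraidGroup m) :
    ∃ b : lastStab m, b ≠ 1 ∧ χ b = 1 ∧ ∃ v, f v = b := by
  by_contra! h
  refine absurd (le_of_injective (f := χ.comp (restr f)) ?_) (Nat.not_succ_le_self m)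
  refine (injective_iff_map_eq_one _).2 fun v hv => ?_
  by_contra hv'
  exact h (restr f v) (fun h => hv' (restr_injective hf (h.trans (map_one _).symm))) hv _
    (coe_restr f v).symm

theorem exists_eq_one_of_lt {d : ℕ} (f : FreeAb d →* BraidGroup m) (hd : m < d) :
    ∃ v, v ≠ 1 ∧ f v = 1 := by
  by_contra! h
  refine absurd (le_of_injective (f := f) ?_) hd.not_ge
  exact (injective_iff_map_eq_one _).2 fun v hv => by_contra fun hv' => h v hv' hv

theorem lift_cprod (k : ℕ) (hk : k ≤ m + 1) :
    FreeGroup.lift (fun i : Fin (m + 1) => if i = 0 then Multiplicative.ofAdd (1 : ℤ) else 1)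
      (cprod m k) = if k = 0 then 1 else .ofAdd 1 := by
  induction k with
  | zero => simp [cprod]
  | succ k ih =>
    rw [cprod, map_mul, ih (by omega), yy, dif_pos (by omega), FreeGroup.lift_apply_of]
    rcases k with _ | k <;> simp [Fin.ext_iff]

theorem cprod_zpow_ne_one {k : ℤ} (hk : k ≠ 0) : cprod m (m + 1) ^ k ≠ 1 := fun h => by
  have h1 := congrArg (FreeGroup.lift
    (fun i : Fin (m + 1) => if i = 0 then Multiplicative.ofAdd (1 : ℤ) else 1)) h
  rw [map_zpow, lift_cprod _ le_rfl, if_neg m.succ_ne_zero, ← ofAdd_zsmul, map_one] at h1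
  have h2 : k • (1 : ℤ) = 0 := congrArg Multiplicative.toAdd h1
  simp [hk] at h2

theorem commute_inl_cprod_inr (b : BraidGroup m) :
    Commute (inl (cprod m (m + 1)) : ABraid m) (inr b) := by
  have h := inr_mul_inl_mul_inr b (cprod m (m + 1))
  rw [art_cprod, mul_inv_eq_iff_eq_mul] at h
  exact h.symm

theorem kap_zz_zpow (k : ℤ) : kap m (⟨zz (m + 1), zz_mem⟩ ^ k) =
    inl (cprod m (m + 1) ^ k) * inr (zz m ^ k) := by
  rw [map_zpow, kap_zz, (commute_inl_cprod_inr _).mul_zpow, map_zpow, map_zpow]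

theorem inl_mul_inr_eq_one {f : FreeGroup (Fin (m + 1))} {b : BraidGroup m} :
    (inl f * inr b : ABraid m) = 1 ↔ f = 1 ∧ b = 1 := by
  rw [SemidirectProduct.ext_iff]
  simp

theorem zz_zpow_ne_one {k : ℤ} (hk : k ≠ 0) : zz (m + 1) ^ k ≠ 1 := fun h => by
  have h1 : (⟨zz (m + 1), zz_mem⟩ : lastStab m) ^ k = 1 := Subtype.ext h
  have h2 := kap_zz_zpow (m := m) k
  rw [h1, map_one, eq_comm, inl_mul_inr_eq_one] at h2
  exact cprod_zpow_ne_one hk h2.1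

/-- The free abelian subgroup of maximal rank generated by the full twists of nested braid
groups. -/
def twists : (m : ℕ) → FreeAb m →* BraidGroup m
  | 0 => 1
  | m + 1 => FreeAb.cons (zz (m + 1)) ((incl m).comp (twists m)) fun _ => (commute_zz _).symm

theorem twists_succ (v : FreeAb (m + 1)) : twists (m + 1) v =
    zz (m + 1) ^ v.toAdd 0 * incl m (twists m (.ofAdd (Fin.tail v.toAdd))) := rfl

theorem twists_injective (m : ℕ) : Function.Injective (twists m) := by
  induction m with
  | zero => exact fun _ _ _ => congrArg Multiplicative.ofAdd (Subsingleton.elim _ _)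
  | succ m ih =>
    refine (injective_iff_map_eq_one _).2 fun v hv => ?_
    rw [twists_succ] at hv
    have h1 : (⟨zz (m + 1), zz_mem⟩ : lastStab m) ^ v.toAdd 0 *
      ⟨incl m (twists m (.ofAdd (Fin.tail v.toAdd))), incl_mem _⟩ = 1 := Subtype.ext hv
    have h2 := congrArg (kap m) h1
    rw [map_mul, kap_zz_zpow, kap_incl, mul_assoc, ← map_mul, map_one, inl_mul_inr_eq_one] at h2
    have h3 : v.toAdd 0 = 0 := by
      by_contra h
      exact cprod_zpow_ne_one h h2.1
    refine FreeAb.eq_one_of_tail h3 (ih ?_)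
    rw [map_one]
    simpa [h3] using h2.2

theorem art_twists_eq_one {v : FreeAb m} (h : art m (twists m v) = 1) : v = 1 := by
  induction m with
  | zero => exact congrArg Multiplicative.ofAdd (Subsingleton.elim _ _)
  | succ m ih =>
    rw [twists_succ, map_mul, map_zpow] at h
    have h0 : v.toAdd 0 = 0 := by
      have h1 := DFunLike.congr_fun h (yy (m + 1) (m + 1))
      rw [MulAut.mul_apply, art_incl_last, MulAut.one_apply] at h1
      have h2 : art (m + 1) (zz (m + 1)) = MulAut.conj (cprod (m + 1) (m + 2))⁻¹ :=
        MulEquiv.ext fun f => by rw [art_zz, MulAut.conj_apply, inv_inv]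
      rw [h2, ← map_zpow, MulAut.conj_apply, mul_inv_eq_iff_eq_mul] at h1
      by_contra hv
      have h3 : Commute (yy (m + 1) (m + 1)) ((cprod (m + 1) (m + 2))⁻¹ ^ v.toAdd 0) := h1.symm
      obtain ⟨a, ha, b, hab⟩ := FreeGroup.exists_zpow_eq_of_commute h3 (by
        rw [inv_zpow']; exact cprod_zpow_ne_one (neg_ne_zero.2 hv))
      rw [inv_zpow', ← zpow_mul] at hab
      have h4 := congrArg (FreeGroup.lift
        (fun i : Fin (m + 2) => if i = 0 then Multiplicative.ofAdd (1 : ℤ) else 1)) hab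
      rw [map_zpow, map_zpow, lift_cprod _ le_rfl, if_neg (by omega), yy, dif_pos (by omega),
        FreeGroup.lift_apply_of, if_neg (by simp [Fin.ext_iff]), one_zpow, ← ofAdd_zsmul] at h4
      have h5 : (0 : ℤ) = (-v.toAdd 0 * b) • (1 : ℤ) := congrArg Multiplicative.toAdd h4
      have h6 : b = 0 := by
        rw [smul_eq_mul, mul_one, eq_comm, mul_eq_zero] at h5
        exact h5.resolve_left (neg_ne_zero.2 hv)
      rw [h6, mul_zero, zpow_zero, yy, dif_pos (by omega)] at hab
      exact FreeGroup.of_zpow_ne_one _ ha hab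
    rw [h0, zpow_zero, one_mul] at h
    refine FreeAb.eq_one_of_tail h0 (ih (MulEquiv.ext fun f => fincl_injective m ?_))
    rw [fincl_art, h]
    rfl

theorem twists_eq_zz_zpow {N : ℕ} (hN : N ≠ 0) {v : FreeAb (m + 1)}
    (h : ∀ b, Commute (b ^ N) (twists (m + 1) v)) :
    ∃ k : ℤ, twists (m + 1) v = zz (m + 1) ^ k := by
  set g := twists m (.ofAdd (Fin.tail v.toAdd)) with hg
  suffices h1 : art m g = 1 by
    refine ⟨v.toAdd 0, ?_⟩
    rw [twists_succ, art_twists_eq_one h1, map_one, map_one, mul_one]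
  refine MulEquiv.ext fun w => ?_
  rw [MulAut.one_apply, ← pow_left_inj hN, ← map_pow]
  have h1 := h (unkap m (inl w))
  rw [twists_succ] at h1
  have h2 : Commute (unkap m (inl w) ^ N) (incl m g) := by
    have h3 := ((commute_zz (unkap m (inl w) ^ N)).zpow_right (v.toAdd 0)).inv_right.mul_right h1
    rwa [inv_mul_cancel_left] at h3
  rw [← map_pow, ← map_pow, ← unkap_inr] at h2
  have h3 : Function.Injective (unkap m) := fun a b hab => by
    rw [← kap_unkap a, ← kap_unkap b]
    congr 2
  have h4 : (inr g * inl (w ^ N) : ABraid m) = inl (w ^ N) * inr g := h3 (by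
    rw [map_mul, map_mul, h2.eq])
  rw [← mul_inv_eq_iff_eq_mul, inr_mul_inl_mul_inr] at h4
  exact SemidirectProduct.inl_injective h4

theorem exists_eq_zz_zpow {x : BraidGroup m} (hx : prm m x = 1) {a l : ℤ} (ha : a ≠ 0)
    (h : x ^ a = zz m ^ l) : ∃ k : ℤ, x = zz m ^ k := by
  induction m generalizing l with
  | zero => exact ⟨0, (eq_one_of_zero _).trans (eq_one_of_zero _).symm⟩
  | succ m ih =>
    have hmem : x ∈ lastStab m := by rw [mem_lastStab, hx]; rfl
    set X : lastStab m := ⟨x, hmem⟩ with hX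
    set Z : lastStab m := ⟨zz (m + 1), zz_mem⟩ with hZ
    have hXZ : X ^ a = Z ^ l := Subtype.ext h
    have hcomm : Commute X Z := Subtype.ext (commute_zz x).eq
    have h1 : (kap m X).right ^ a = zz m ^ l := by
      have h1 := congrArg SemidirectProduct.rightHom (congrArg (kap m) hXZ)
      rwa [kap_zz_zpow, map_zpow, map_zpow, map_mul, SemidirectProduct.rightHom_inl,
        SemidirectProduct.rightHom_inr, one_mul] at h1
    have h2 : prm m (kap m X).right = 1 := Equiv.ext fun i => by
      have h := prm_castSucc X i
      rw [hX, hx] at h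
      exact (Fin.castSucc_injective _ h).symm
    obtain ⟨k, hk⟩ := ih h2 h1
    have h3 : kap m X = inl (kap m X).left * inr (zz m ^ k) := by
      rw [← hk, SemidirectProduct.inl_left_mul_inr_right]
    suffices h4 : ∃ j : ℤ, X = Z ^ j by
      obtain ⟨j, hj⟩ := h4
      exact ⟨j, congrArg Subtype.val hj⟩
    have hY : kap m (X * Z ^ (-k)) = inl ((kap m X).left * cprod m (m + 1) ^ (-k)) := by
      have h4 := (commute_inl_cprod_inr (zz m ^ (-k))).zpow_left (-k)
      rw [map_mul, kap_zz_zpow, map_zpow inl, h4.eq]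
      conv_lhs => rw [h3]
      rw [mul_assoc, ← mul_assoc (inr _), ← map_mul inr, ← zpow_add, add_neg_cancel, zpow_zero,
        map_one, one_mul, map_mul, map_zpow]
    have hYa : (X * Z ^ (-k)) ^ a = Z ^ (l - k * a) := by
      rw [(hcomm.zpow_right _).mul_zpow, hXZ, ← zpow_mul, ← zpow_add]
      congr 1
      ring
    generalize (kap m X).left * cprod m (m + 1) ^ (-k) = w at hY
    rcases m with _ | m
    · obtain ⟨j, hj⟩ : ∃ j : ℤ, w = cprod 0 1 ^ j := by
        have h5 : cprod 0 1 = .of 0 := by rw [cprod_succ]; exact mul_one _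
        rw [h5]
        clear hY
        induction w using FreeGroup.induction_on with
        | C1 => exact ⟨0, by simp⟩
        | of i => exact ⟨1, by rw [Subsingleton.elim (α := Fin 1) i 0, zpow_one]⟩
        | inv_of i _ => exact ⟨-1, by rw [Subsingleton.elim (α := Fin 1) i 0, zpow_neg, zpow_one]⟩
        | mul a b ha hb =>
          obtain ⟨k, rfl⟩ := ha
          obtain ⟨l, rfl⟩ := hb
          exact ⟨k + l, (zpow_add _ _ _).symm⟩
      refine ⟨j + k, ?_⟩
      rw [zpow_add, ← mul_inv_eq_iff_eq_mul, ← zpow_neg]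
      apply kap_injective
      rw [hY, hj, kap_zz_zpow, eq_one_of_zero (zz 0 ^ j), map_one, mul_one]
    · refine ⟨k, ?_⟩
      rw [← mul_inv_eq_one, ← zpow_neg]
      apply kap_injective
      have h5 := congrArg (kap _) hYa
      rw [map_zpow, hY, kap_zz_zpow, ← map_zpow] at h5
      have h6 := congrArg SemidirectProduct.rightHom h5
      rw [map_mul, SemidirectProduct.rightHom_inl, SemidirectProduct.rightHom_inl,
        SemidirectProduct.rightHom_inr, one_mul] at h6
      have h7 : l - k * a = 0 := by
        by_contra hne
        exact zz_zpow_ne_one hne h6.symm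
      rw [h7, zpow_zero, zpow_zero, map_one, map_one, one_mul] at h5
      rw [hY, map_one]
      have h8 : w ^ a = 1 := SemidirectProduct.inl_injective (h5.trans (map_one _).symm)
      rw [(IsMulTorsionFree.zpow_eq_one_iff_left ha).1 h8, map_one]

end BraidGroup

namespace BraidGroup

open SemidirectProduct (inl inr)

variable {m : ℕ}

/-- The quotient of the free group on the punctures by the product of all generators, identified
with a free group on one generator less. -/
def sq (m : ℕ) : FreeGroup (Fin (m + 2)) →* FreeGroup (Fin (m + 1)) :=
  FreeGroup.lift (Fin.lastCases (cprod m (m + 1))⁻¹ FreeGroup.of)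

theorem sq_of_castSucc (i : Fin (m + 1)) : sq m (.of i.castSucc) = .of i := by
  rw [sq, FreeGroup.lift_apply_of, Fin.lastCases_castSucc]

theorem sq_fincl (f : FreeGroup (Fin (m + 1))) : sq m (fincl m f) = f := by
  suffices h : (sq m).comp (fincl m) = MonoidHom.id _ from DFunLike.congr_fun h f
  refine FreeGroup.ext_hom _ _ fun i => ?_
  rw [MonoidHom.comp_apply, fincl_of, sq_of_castSucc, MonoidHom.id_apply]

theorem sq_yy_last : sq m (yy (m + 1) (m + 1)) = (cprod m (m + 1))⁻¹ := by
  rw [yy, dif_pos (by omega), sq, FreeGroup.lift_apply_of]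
  exact Fin.lastCases_last

theorem sq_cprod_succ : sq m (cprod (m + 1) (m + 1)) = cprod m (m + 1) := by
  rw [← fincl_cprod le_rfl, sq_fincl]

theorem sq_cprod : sq m (cprod (m + 1) (m + 2)) = 1 := by
  rw [cprod_succ, map_mul, sq_yy_last, sq_cprod_succ, inv_mul_cancel]

theorem sq_art_fincl_sq (b : BraidGroup (m + 1)) (f : FreeGroup (Fin (m + 2))) :
    sq m (art (m + 1) b (fincl m (sq m f))) = sq m (art (m + 1) b f) := by
  suffices h : (sq m).comp ((art (m + 1) b).toMonoidHom.comp ((fincl m).comp (sq m))) =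
    (sq m).comp (art (m + 1) b).toMonoidHom from DFunLike.congr_fun h f
  refine FreeGroup.ext_hom _ _ fun i => ?_
  change sq m (art (m + 1) b (fincl m (sq m (.of i)))) = sq m (art (m + 1) b (.of i))
  induction i using Fin.lastCases with
  | cast i => rw [sq_of_castSucc, fincl_of]
  | last =>
    have h1 : (FreeGroup.of (Fin.last (m + 1))) = yy (m + 1) (m + 1) := of_eq_yy _
    have h2 := congrArg (sq m) (art_cprod b)
    rw [cprod_succ, map_mul, map_mul, ← cprod_succ, sq_cprod, mul_eq_one_iff_eq_inv] at h2
    rw [h1, h2, sq_yy_last, map_inv, map_inv, map_inv, fincl_cprod le_rfl]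

/-- The action of the braid group on the fundamental group of the sphere with punctures. -/
def sphAct (m : ℕ) : BraidGroup (m + 1) →* MulAut (FreeGroup (Fin (m + 1))) where
  toFun b :=
    { toFun := fun f => sq m (art (m + 1) b (fincl m f))
      invFun := fun f => sq m (art (m + 1) b⁻¹ (fincl m f))
      left_inv := fun f => by
        beta_reduce
        rw [sq_art_fincl_sq, ← MulAut.mul_apply, ← map_mul, inv_mul_cancel, map_one,
          MulAut.one_apply, sq_fincl]
      right_inv := fun f => by
        beta_reduce
        rw [sq_art_fincl_sq, ← MulAut.mul_apply, ← map_mul, mul_inv_cancel, map_one,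
          MulAut.one_apply, sq_fincl]
      map_mul' := fun f g => by simp only [map_mul] }
  map_one' := MulEquiv.ext fun f => by
    change sq m (art (m + 1) 1 (fincl m f)) = f
    rw [map_one, MulAut.one_apply, sq_fincl]
  map_mul' a b := MulEquiv.ext fun f => by
    change sq m (art (m + 1) (a * b) (fincl m f)) =
      sq m (art (m + 1) a (fincl m (sq m (art (m + 1) b (fincl m f)))))
    rw [sq_art_fincl_sq, map_mul, MulAut.mul_apply]

theorem sq_art (b : BraidGroup (m + 1)) (f : FreeGroup (Fin (m + 2))) :
    sq m (art (m + 1) b f) = sphAct m b (sq m f) := (sq_art_fincl_sq b f).symm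

theorem sphAct_seqLoop :
    sphAct m (seqLoop (sg (m + 1)) (m + 1)) = MulAut.conj (cprod m (m + 1)) := by
  refine FreeGroup.mulAut_ext fun i => ?_
  rw [← sq_of_castSucc i, ← sq_art, of_eq_yy, Fin.val_castSucc, (art_seqLoop le_rfl).2.2 _ i.2]
  simp only [map_mul, map_inv, sq_yy_last, sq_cprod_succ, MulAut.conj_apply]
  group

/-- The homomorphism from `ABraid m` to the braid group of the sphere with punctures, lifted to the
braid group, sending the last free generator to the inverse of the loop of the last strand. -/
def sph (m : ℕ) : ABraid m →* BraidGroup m :=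
  annLift (MonoidHom.id _) (seqLoop (sg m) m)⁻¹
    (fun _ hi => ((isBraidSeq_sg m).commute_seqLoop hi le_rfl).inv_right)
    (fun i hi => by
      subst hi
      exact (isBraidSeq_sg (i + 1)).seqLoop_succ_inv_typeB le_rfl)

theorem sph_inr (b : BraidGroup m) : sph m (inr b) = b := annLift_inr _ _ _ _ _

theorem sph_last : sph m (inl (yy m m)) = (seqLoop (sg m) m)⁻¹ := annLift_inl_last _ _ _ _

theorem sph_inl_yy : sph (m + 1) (inl (yy (m + 1) m)) =
    (seqLoop (sg (m + 1)) m)⁻¹ * (sg (m + 1) m * sg (m + 1) m)⁻¹ := by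
  rw [sph, annLift_inl_yy _ _ _ _ m.le_succ, annSeq_of_lt _ _ (Nat.lt_succ_self m), annSeq_self,
    seqLoop]
  simp only [MonoidHom.id_apply]
  group

theorem sphAct_sph_inl (f : FreeGroup (Fin (m + 2))) :
    sphAct m (sph (m + 1) (inl f)) = MulAut.conj (sq m f) := by
  let F : ABraid (m + 1) →* MulAut (FreeGroup (Fin (m + 1))) :=
    SemidirectProduct.lift (MulAut.conj.comp (sq m)) (sphAct m) fun b =>
      MonoidHom.ext fun f => MulEquiv.ext fun g => by
        change sq m (art (m + 1) b f) * g * (sq m (art (m + 1) b f))⁻¹ =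
          sphAct m b (sq m f * (sphAct m b)⁻¹ g * (sq m f)⁻¹)
        rw [sq_art, map_mul, map_mul, map_inv, MulAut.apply_inv_self]
  suffices h : (sphAct m).comp (sph (m + 1)) = F by
    have h1 := DFunLike.congr_fun h (inl f)
    rwa [MonoidHom.comp_apply, SemidirectProduct.lift_inl] at h1
  refine ABraid.hom_ext (fun b => ?_) ?_
  · rw [MonoidHom.comp_apply, sph_inr, SemidirectProduct.lift_inr]
  · rw [MonoidHom.comp_apply, sph_last, SemidirectProduct.lift_inl, map_inv, sphAct_seqLoop,
      MonoidHom.comp_apply, sq_yy_last, map_inv]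

theorem exists_unkap_eq (h : ABraid m) : ∃ w : FreeGroup (Fin (m + 1)),
    unkap m h = sph (m + 1) (inl (fincl m w)) * incl m (sph m h) := by
  have hconj (b : BraidGroup m) (w : FreeGroup (Fin (m + 1))) :
      incl m b * sph (m + 1) (inl (fincl m w)) =
        sph (m + 1) (inl (fincl m (art m b w))) * incl m b := by
    rw [fincl_art, ← inr_mul_inl_mul_inr, map_mul, map_mul, map_inv, sph_inr,
      inv_mul_cancel_right]
  induction h using ABraid.induction with
  | hr b => exact ⟨1, by rw [unkap_inr, sph_inr, map_one, map_one, map_one, one_mul]⟩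
  | hl =>
    refine ⟨(yy m m)⁻¹, ?_⟩
    rw [unkap_last, sph_last, map_inv, map_inv, map_inv, map_inv, fincl_yy m.lt_succ_self,
      sph_inl_yy, incl_seqLoop le_rfl,
      mul_inv_rev, inv_inv, inv_inv, mul_assoc, mul_inv_cancel, mul_one]
  | mul a b ha hb =>
    obtain ⟨w, hw⟩ := ha
    obtain ⟨v, hv⟩ := hb
    refine ⟨w * art m (sph m a) v, ?_⟩
    have h1 := hconj (sph m a) v
    simp only [map_mul, hw, hv] at h1 ⊢
    rw [mul_assoc _ (incl m _), ← mul_assoc (incl m _), h1]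
    simp only [mul_assoc]
  | inv a ha =>
    obtain ⟨w, hw⟩ := ha
    refine ⟨art m (sph m a)⁻¹ w⁻¹, ?_⟩
    rw [map_inv, hw, map_inv (sph m), ← hconj, mul_inv_rev, map_inv (incl m), map_inv (fincl m),
      map_inv inl, map_inv (sph _)]

theorem sphAct_of_sph_kap_eq_one {b : lastStab m} (hb : sph m (kap m b) = 1) (hb1 : b ≠ 1) :
    ∃ w : FreeGroup (Fin (m + 1)), w ≠ 1 ∧ sphAct m b = MulAut.conj w := by
  obtain ⟨w, hw⟩ := exists_unkap_eq (kap m b)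
  rw [hb, map_one, mul_one, unkap_kap] at hw
  refine ⟨w, ?_, by rw [hw, sphAct_sph_inl, sq_fincl]⟩
  rintro rfl
  exact hb1 (Subtype.ext (by rw [hw, map_one, map_one, map_one]; rfl))

end BraidGroup

namespace BraidGroup

open SemidirectProduct (inl inr)

variable {m : ℕ}

theorem grDelta_cprod_cong (m : ℕ) :
    FCong (foxFilt (Fin (m + 1))) 2 (grDelta (cprod m (m + 1))) (∑ i, grDelta (.of i)) := by
  have h (k : ℕ) : FCong (foxFilt (Fin (m + 1))) 2 (grDelta (cprod m k))
      (∑ i ∈ Finset.range k, grDelta (yy m i)) := by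
    induction k with
    | zero => exact FCong.of_eq grDelta_one
    | succ k ih =>
      rw [cprod_succ, Finset.sum_range_succ, add_comm (∑ i ∈ _, _)]
      exact (grDelta_mul_cong _ _).trans (FCong.rfl'.add ih)
  have h1 := h (m + 1)
  rw [Finset.sum_range] at h1
  simpa only [of_eq_yy] using h1

/-- The conjugation action of `ABraid m` on its free normal subgroup. -/
def ABraid.act (m : ℕ) : ABraid m →* MulAut (FreeGroup (Fin (m + 1))) :=
  SemidirectProduct.lift MulAut.conj (art m) fun b =>
    MonoidHom.ext fun f => MulEquiv.ext fun g => by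
      change art m b f * g * (art m b f)⁻¹ = art m b (f * (art m b)⁻¹ g * f⁻¹)
      rw [map_mul, map_mul, map_inv, MulAut.apply_inv_self]

theorem ABraid.act_apply (h : ABraid m) (f : FreeGroup (Fin (m + 1))) :
    ABraid.act m h f = h.left * art m h.right f * h.left⁻¹ := rfl

theorem ABraid.inl_act (h : ABraid m) (f : FreeGroup (Fin (m + 1))) :
    inl (ABraid.act m h f) = h * inl f * h⁻¹ := by
  conv_rhs => rw [← SemidirectProduct.inl_left_mul_inr_right h]
  rw [ABraid.act_apply, map_mul, map_mul, map_inv, ← inr_mul_inl_mul_inr, mul_inv_rev]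
  simp only [mul_assoc]

theorem ABraid.act_kap_zz : ABraid.act m (kap m ⟨zz (m + 1), zz_mem⟩) = 1 := by
  refine MulEquiv.ext fun f => ?_
  rw [kap_zz, map_mul, MulAut.mul_apply, act, SemidirectProduct.lift_inl,
    SemidirectProduct.lift_inr, art_zz, MulAut.conj_apply, MulAut.one_apply]
  group

variable {p : ℕ} {μ : ℤ}

theorem right_kap_pow {x : lastStab m} (hx : (x : BraidGroup (m + 1)) ^ p = zz (m + 1) ^ μ) :
    (kap m x).right ^ p = zz m ^ μ := by
  have h : x ^ p = ⟨zz (m + 1), zz_mem⟩ ^ μ := Subtype.ext hx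
  have h1 := congrArg (fun b => SemidirectProduct.rightHom (kap m b)) h
  simp only [kap_zz_zpow, map_pow, map_mul, SemidirectProduct.rightHom_inl,
    SemidirectProduct.rightHom_inr, one_mul] at h1
  exact h1

theorem false_of_right_kap_ne (hp : p.Prime) {x : lastStab m}
    (hx : (x : BraidGroup (m + 1)) ^ p = zz (m + 1) ^ μ)
    (hs : prm m (kap m x).right ^ p = 1) (hfix : ∀ i, prm m (kap m x).right i ≠ i)
    {f : FreeAb (m + 1) →* BraidGroup (m + 1)} (hf : Function.Injective f)
    (hc : ∀ v, Commute (x : BraidGroup (m + 1)) (f v)) : False := by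
  obtain ⟨b, hb1, hb, v, hv⟩ := exists_ne_one_of_hom hf (SemidirectProduct.rightHom.comp (kap m))
  have hbl : kap m b = inl (kap m b).left := by
    refine SemidirectProduct.ext rfl ?_
    rw [SemidirectProduct.right_inl]
    exact hb
  have hxb : Commute x b := Subtype.ext (hv ▸ hc v).eq
  refine hb1 (kap_injective ?_)
  suffices h : (kap m b).left = 1 by rw [hbl, h, map_one, map_one]
  refine FreeGroup.eq_one_of_map_eq_self hp (φ := ABraid.act m (kap m x)) ?_ hs hfix
    (fun i => ?_) ?_
  · have h : x ^ p = ⟨zz (m + 1), zz_mem⟩ ^ μ := Subtype.ext hx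
    rw [← map_pow, ← map_pow, h, map_zpow, map_zpow, ABraid.act_kap_zz, one_zpow]
  · rw [ABraid.act_apply]
    have h : IsConj (art m (kap m x).right (.of i))
        ((kap m x).left * art m (kap m x).right (.of i) * (kap m x).left⁻¹) :=
      isConj_iff.2 ⟨_, rfl⟩
    exact h.symm.trans (isConj_art _ i)
  · refine SemidirectProduct.inl_injective (φ := art m) ?_
    rw [ABraid.inl_act, ← hbl, ← map_mul, hxb.eq, map_mul, mul_inv_cancel_right]

theorem sphAct_apply_eq_of_commute {x : BraidGroup (m + 2)} {w : FreeGroup (Fin (m + 2))}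
    {b : BraidGroup (m + 2)} (hxb : Commute x b) (hb : sphAct (m + 1) b = MulAut.conj w) :
    sphAct (m + 1) x w = w := by
  have h := congrArg (sphAct (m + 1)) hxb.eq
  rw [map_mul, map_mul, hb] at h
  have h1 (f : FreeGroup (Fin (m + 2))) : Commute f (w⁻¹ * sphAct (m + 1) x w) := by
    obtain ⟨f, rfl⟩ := (sphAct (m + 1) x).surjective f
    have h2 : sphAct (m + 1) x (w * f * w⁻¹) = w * sphAct (m + 1) x f * w⁻¹ := DFunLike.congr_fun h f
    rw [map_mul, map_mul, map_inv, mul_inv_eq_iff_eq_mul] at h2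
    rw [Commute, SemiconjBy, mul_assoc w⁻¹, h2]
    group
  exact (inv_mul_eq_one.1 (FreeGroup.eq_one_of_forall_commute fun i => h1 _)).symm

theorem false_of_prm_ne_of_pow_eq_zz (hp : p.Prime) {x : BraidGroup (m + 2)} (hx : x ^ p = zz (m + 2))
    (hs : prm (m + 2) x ^ p = 1) (hfix : ∀ i, prm (m + 2) x i ≠ i)
    {f : FreeAb (m + 2) →* BraidGroup (m + 2)} (hf : Function.Injective f)
    (hc : ∀ v, Commute x (f v)) : False := by
  obtain ⟨b, hb1, hb, v, hv⟩ := exists_ne_one_of_hom hf ((sph (m + 1)).comp (kap (m + 1)))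
  obtain ⟨w, hw, hw'⟩ := sphAct_of_sph_kap_eq_one hb hb1
  refine hw (FreeGroup.eq_one_of_map_eq_self_of_quotient hp sq_of_castSucc sq_cprod
    (grDelta_cprod_cong (m + 2)) (φ := art (m + 2) x) (ψ := sphAct (m + 1) x) (sq_art x) hs hfix
    (art_cprod x) (fun f => ?_) (isConj_art x)
    (sphAct_apply_eq_of_commute (hv ▸ hc v) hw'))
  rw [← map_pow, hx, art_zz]

theorem false_of_prm_ne (hp : p.Prime) {x : BraidGroup (m + 2)} (hx : x ^ p = zz (m + 2) ^ μ)
    (hs : prm (m + 2) x ^ p = 1) (hfix : ∀ i, prm (m + 2) x i ≠ i)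
    {f : FreeAb (m + 2) →* BraidGroup (m + 2)} (hf : Function.Injective f)
    (hc : ∀ v, Commute x (f v)) : False := by
  by_cases hpμ : (p : ℤ) ∣ μ
  · obtain ⟨ν, rfl⟩ := hpμ
    have h1 : (x * zz (m + 2) ^ (-ν)) ^ p = 1 := by
      rw [((commute_zz x).zpow_right _).mul_pow, hx, ← zpow_natCast, ← zpow_mul, ← zpow_add]
      rw [show (p : ℤ) * ν + -ν * p = 0 by ring, zpow_zero]
    have h2 : prm (m + 2) (x * zz (m + 2) ^ (-ν)) = prm (m + 2) x := by
      rw [map_mul, map_zpow, prm_zz, one_zpow, mul_one]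
    have h3 := FreeGroup.eq_one_of_map_eq_self hp (φ := art (m + 2) (x * zz (m + 2) ^ (-ν)))
      (by rw [← map_pow, h1, map_one]) hs hfix (fun i => h2 ▸ isConj_art _ i) (art_cprod _)
    exact cprod_zpow_ne_one one_ne_zero ((zpow_one _).trans h3)
  · obtain ⟨k, j, hkj⟩ : IsCoprime μ (p : ℤ) :=
      ((Nat.prime_iff_prime_int.1 hp).coprime_iff_not_dvd.2 hpμ).symm
    have h2 : prm (m + 2) (x ^ k * zz (m + 2) ^ j) = prm (m + 2) x ^ k := by
      rw [map_mul, map_zpow, map_zpow, prm_zz, one_zpow, mul_one]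
    have hs' : prm (m + 2) x ^ (p : ℤ) = 1 := by rw [zpow_natCast, hs]
    refine false_of_prm_ne_of_pow_eq_zz hp (x := x ^ k * zz (m + 2) ^ j) ?_ ?_ (fun i hi => ?_) hf
      fun v => ((hc v).zpow_left k).mul_left ((commute_zz _).zpow_right j).symm
    · rw [((commute_zz _).zpow_right _).mul_pow, ← zpow_natCast, ← zpow_mul, mul_comm k, zpow_mul,
        zpow_natCast, hx, ← zpow_natCast, ← zpow_mul, ← zpow_mul, ← zpow_add, mul_comm μ, hkj,
        zpow_one]
    · rw [h2, ← zpow_natCast, ← zpow_mul, mul_comm, zpow_mul, hs', one_zpow]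
    · rw [h2] at hi
      have h3 := Equiv.Perm.zpow_apply_eq_self_of_apply_eq_self hi μ
      rw [← zpow_mul, eq_sub_of_add_eq hkj, sub_eq_add_neg, zpow_add, zpow_one,
        mul_comm j, ← mul_neg, zpow_mul, hs', one_zpow, mul_one] at h3
      exact hfix i h3

/-- A periodic braid with nontrivial permutation does not commute with a free abelian group of
maximal rank, as soon as there are at least three strands. -/
theorem false_of_forall_commute {m : ℕ} {μ : ℤ} (hp : p.Prime) {x : BraidGroup (m + 2)}
    (hx : x ^ p = zz (m + 2) ^ μ) (hs1 : prm (m + 2) x ≠ 1) (hs : prm (m + 2) x ^ p = 1)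
    {f : FreeAb (m + 2) →* BraidGroup (m + 2)} (hf : Function.Injective f)
    (hc : ∀ v, Commute x (f v)) : False := by
  by_cases hfix : ∀ i, prm (m + 2) x i ≠ i
  · exact false_of_prm_ne hp hx hs hfix hf hc
  push Not at hfix
  obtain ⟨i, hi⟩ := hfix
  obtain ⟨b, hb⟩ := exists_prm_apply_eq i (Fin.last (m + 2))
  suffices h : ∀ {x : lastStab (m + 1)} {f : FreeAb (m + 2) →* BraidGroup (m + 2)},
      (x : BraidGroup (m + 2)) ^ p = zz (m + 2) ^ μ → prm (m + 2) x ≠ 1 →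
      prm (m + 2) x ^ p = 1 → Function.Injective f →
      (∀ v, Commute (x : BraidGroup (m + 2)) (f v)) → False by
    have hmem : b * x * b⁻¹ ∈ lastStab (m + 1) := by
      rw [mem_lastStab, map_mul, map_mul, Equiv.Perm.mul_apply, Equiv.Perm.mul_apply, ← hb,
        ← Equiv.Perm.mul_apply (prm _ b⁻¹), ← map_mul, inv_mul_cancel, map_one,
        Equiv.Perm.one_apply, hi]
    refine h (x := ⟨_, hmem⟩) (f := (MulAut.conj b).toMonoidHom.comp f) ?_ ?_ ?_
      ((MulAut.conj b).injective.comp hf) fun v => ?_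
    · change (b * x * b⁻¹) ^ p = _
      rw [conj_pow, hx, ((commute_zz b).zpow_right μ).eq, mul_inv_cancel_right]
    · change prm _ (b * x * b⁻¹) ≠ 1
      rwa [map_mul, map_mul, map_inv, Ne, conj_eq_one_iff]
    · change prm _ (b * x * b⁻¹) ^ p = 1
      rw [map_mul, map_mul, map_inv, conj_pow, hs, mul_one, mul_inv_cancel]
    · exact (hc v).map (MulAut.conj b)
  clear hx hs1 hs hf hc hi hb
  intro x f hx hs1 hs hf hc
  have hr : prm (m + 1) (kap (m + 1) x).right ≠ 1 := fun h => hs1 <| Equiv.ext fun i => by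
    induction i using Fin.lastCases with
    | cast i => rw [prm_castSucc, h]; rfl
    | last => exact x.2
  have hr' : prm (m + 1) (kap (m + 1) x).right ^ p = 1 := by
    refine Equiv.ext fun i => Fin.castSucc_injective _ ?_
    have h := prm_castSucc (x ^ p) i
    rw [Subgroup.coe_pow, map_pow, hs, map_pow] at h
    have h1 : ((kap (m + 1) x) ^ p).right = (kap (m + 1) x).right ^ p :=
      map_pow SemidirectProduct.rightHom _ _
    rw [h1, map_pow] at h
    exact h.symm
  by_cases hfix : ∀ i, prm (m + 1) (kap (m + 1) x).right i ≠ i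
  · exact false_of_right_kap_ne hp hx hr' hfix hf hc
  cases m with
  | zero =>
    refine hfix fun i hi => hr ?_
    generalize prm 1 (kap 1 x).right = s at hi ⊢
    revert s i
    decide
  | succ m =>
    obtain ⟨g, hg⟩ := exists_injective_right_kap hf
    refine false_of_forall_commute hp (right_kap_pow hx) hr hr' hg fun v => ?_
    have h : Commute x (restr f (g v)) := Subtype.ext (hc _).eq
    exact (h.map (kap _)).map SemidirectProduct.rightHom
termination_by m

theorem zz_mem_center (m : ℕ) : zz m ∈ Subgroup.center (BraidGroup m) :=
  Subgroup.mem_center_iff.2 fun b => (commute_zz b).eq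

theorem mem_center_of_zpow_eq {x : BraidGroup (m + 2)} {a l : ℤ} (ha : a ≠ 0)
    (hx : x ^ a = zz (m + 2) ^ l) {f : FreeAb (m + 2) →* BraidGroup (m + 2)}
    (hf : Function.Injective f) (hc : ∀ v, Commute x (f v)) :
    x ∈ Subgroup.center (BraidGroup (m + 2)) := by
  by_cases hs : prm (m + 2) x = 1
  · obtain ⟨k, rfl⟩ := exists_eq_zz_zpow hs ha hx
    exact zpow_mem (zz_mem_center _) k
  · set s := prm (m + 2) x
    have ho : orderOf s ≠ 1 := fun h => hs (orderOf_eq_one_iff.1 h)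
    obtain ⟨p, hp, k, hk⟩ := Nat.exists_prime_and_dvd ho
    have hsp : prm (m + 2) (x ^ k) ^ p = 1 := by
      rw [map_pow, ← pow_mul, mul_comm, ← hk, pow_orderOf_eq_one]
    obtain ⟨μ, hμ⟩ := exists_eq_zz_zpow (x := (x ^ k) ^ p) (a := a) (l := l * k * p)
      (by rw [map_pow, hsp]) ha
      (by
        rw [← pow_mul, ← zpow_natCast, ← zpow_mul, mul_comm, zpow_mul, hx, ← zpow_mul,
          Nat.cast_mul, mul_assoc])
    refine (false_of_forall_commute hp hμ (fun h => ?_) hsp hf fun v => (hc v).pow_left k).elim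
    rw [map_pow] at h
    have h0 : orderOf s ≠ 0 := (orderOf_pos s).ne'
    have h1 : p * k ∣ k := hk ▸ orderOf_dvd_of_pow_eq_one h
    have h2 : k ≠ 0 := by rintro rfl; exact h0 (by rw [hk, mul_zero])
    have h3 := Nat.le_of_dvd (Nat.pos_of_ne_zero h2) h1
    have := hp.two_le
    nlinarith [Nat.pos_of_ne_zero h2]

theorem exists_pow_mem (G : Subgroup (BraidGroup m)) (hG : G.FiniteIndex) :
    ∃ N ≠ 0, ∀ b : BraidGroup m, b ^ N ∈ G :=
  ⟨G.normalCore.index, Subgroup.FiniteIndex.index_ne_zero,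
    fun b => G.normalCore_le (G.normalCore.pow_index_mem b)⟩

theorem map_mem_center_of_mem_center (G : Subgroup (BraidGroup (m + 2))) (hG : G.FiniteIndex)
    {ρ : G →* BraidGroup (m + 2)} (hρ : Function.Injective ρ) {g : G}
    (hg : g ∈ Subgroup.center G) : ρ g ∈ Subgroup.center (BraidGroup (m + 2)) := by
  obtain ⟨N, hN, hpow⟩ := exists_pow_mem G hG
  let t : FreeAb (m + 2) →* G := ((twists (m + 2)).comp (powMonoidHom N)).codRestrict G
    fun v => by
      rw [MonoidHom.comp_apply, powMonoidHom_apply, map_pow]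
      exact hpow _
  have ht : Function.Injective t := fun v w h =>
    FreeAb.powMonoidHom_injective hN (twists_injective _ (congrArg Subtype.val h))
  have hzz {v : FreeAb (m + 2)} (hv : t v ∈ Subgroup.center G) :
      ∃ k : ℤ, (t v : BraidGroup (m + 2)) = zz (m + 2) ^ k :=
    twists_eq_zz_zpow (v := v ^ N) hN fun b =>
      congrArg Subtype.val (Subgroup.mem_center_iff.1 hv ⟨b ^ N, hpow b⟩)
  obtain ⟨v, hv1, hv⟩ := exists_eq_one_of_lt
    (FreeAb.cons (zz (m + 2)) (ρ.comp t) fun _ => (commute_zz _).symm) (Nat.lt_succ_self _)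
  rw [FreeAb.cons_apply, MonoidHom.comp_apply, mul_eq_one_iff_inv_eq] at hv
  set h := t (.ofAdd (Fin.tail v.toAdd)) with hh
  have hh1 : h ≠ 1 := fun h1 => by
    rw [h1, map_one, inv_eq_one] at hv
    refine hv1 (FreeAb.eq_one_of_tail ?_ (ht (h1.trans (map_one t).symm)))
    by_contra h0
    exact zz_zpow_ne_one h0 hv
  have hhc : h ∈ Subgroup.center G := Subgroup.mem_center_iff.2 fun b => hρ <| by
    rw [map_mul, map_mul, ← hv]
    exact ((commute_zz _).zpow_right _).inv_right.eq
  obtain ⟨b, hb⟩ := hzz hhc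
  have hb0 : b ≠ 0 := by
    rintro rfl
    exact hh1 (Subtype.ext (by rw [hb, zpow_zero]; rfl))
  have hgc (b : G) : Commute g b := (Subgroup.mem_center_iff.1 hg b).symm
  obtain ⟨u, hu1, hu⟩ := exists_eq_one_of_lt
    (FreeAb.cons (G.subtype g) (G.subtype.comp t) fun v =>
      (hgc (t v)).map G.subtype) (Nat.lt_succ_self _)
  rw [FreeAb.cons_apply, MonoidHom.comp_apply, mul_eq_one_iff_inv_eq] at hu
  have hu' : (g ^ u.toAdd 0)⁻¹ = t (.ofAdd (Fin.tail u.toAdd)) := Subtype.ext hu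
  have hu0 : u.toAdd 0 ≠ 0 := fun h0 => by
    rw [h0, zpow_zero, inv_one] at hu'
    exact hu1 (FreeAb.eq_one_of_tail h0 (ht (hu'.symm.trans (map_one t).symm)))
  obtain ⟨l, hl⟩ := hzz (hu' ▸ inv_mem (zpow_mem hg _))
  have hgl : (g ^ u.toAdd 0)⁻¹ ^ b = h ^ l := Subtype.ext (by
    rw [Subgroup.coe_zpow, Subgroup.coe_zpow, hb, hu', hl, ← zpow_mul, ← zpow_mul, mul_comm])
  refine mem_center_of_zpow_eq (f := ρ.comp t) (a := u.toAdd 0 * -b) (l := v.toAdd 0 * -l)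
    (mul_ne_zero hu0 (neg_ne_zero.2 hb0)) ?_ (hρ.comp ht)
    (fun w => (hgc (t w)).map ρ)
  rw [zpow_mul, ← inv_zpow', zpow_mul, ← inv_zpow', hv, ← map_zpow, ← map_inv, ← map_zpow, hgl,
    map_zpow]

end BraidGroup

/-- For `n ≥ 3`, a finite-index subgroup `G ≤ B_{n+1}` and an injective
homomorphism `ρ : G → B_{n+1}` satisfy `ρ(Z(G)) ⊆ Z(B_{n+1})` and
`ρ⁻¹(Z(B_{n+1})) ⊆ Z(G)`; hence `ρ` descends to a well-defined injective homomorphism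
`G/Z(G) → B_{n+1}/Z(B_{n+1})`. -/
theorem injective_hom_descends_to_central_quotients
    (n : ℕ) (hn : 3 ≤ n) (G : Subgroup (BraidGroup n)) (hG : G.FiniteIndex)
    (ρ : G →* BraidGroup n) (hρ : Function.Injective ρ) :
    (∀ g : G, g ∈ Subgroup.center G → ρ g ∈ Subgroup.center (BraidGroup n)) ∧
    (∀ g : G, ρ g ∈ Subgroup.center (BraidGroup n) → g ∈ Subgroup.center G) ∧
    (∃ ρbar : G ⧸ Subgroup.center G →* BraidGroup n ⧸ Subgroup.center (BraidGroup n),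
      Function.Injective ρbar ∧ ∀ g : G, ρbar (g : G ⧸ Subgroup.center G) = (ρ g :)) := by
  obtain ⟨m, rfl⟩ : ∃ m, n = m + 2 := ⟨n - 2, by omega⟩
  have h1 (g : G) (hg : g ∈ Subgroup.center G) : ρ g ∈ Subgroup.center (BraidGroup (m + 2)) :=
    BraidGroup.map_mem_center_of_mem_center G hG hρ hg
  have h2 (g : G) (hg : ρ g ∈ Subgroup.center (BraidGroup (m + 2))) : g ∈ Subgroup.center G :=
    Subgroup.mem_center_iff.2 fun b => hρ <| by
      rw [map_mul, map_mul, Subgroup.mem_center_iff.1 hg]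
  refine ⟨h1, h2, QuotientGroup.map _ _ ρ h1, ?_, fun g => rfl⟩
  rw [injective_iff_map_eq_one]
  intro a ha
  induction a using QuotientGroup.induction_on with
  | H g =>
    exact (QuotientGroup.eq_one_iff g).2 (h2 g ((QuotientGroup.eq_one_iff (ρ g)).1 ha))
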